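/- arXiv:1503.04408 — 3 statements merged into one kernel-verified Lean document; each statement's English description precedes it below -/
import Mathlib

section
/- Let G be a general skew-symmetric matrix of homogeneous forms in three variables over ℂ, of odd size (2k−1)×(2k−1), whose degree matrix A is non-negative and homogeneous. Let I be the ideal of R' = ℂ[x,y,z] generated by the submaximal Pfaffians of G. Then multiplication by a general linear form L defines a surjection (R'/I)_{d−1} → (R'/I)_d for all d ≥ tr(A)/2 − 1. -/
open MvPolynomial

/-- The Pfaffian of a `2n × 2n` matrix of multivariate polynomials over `ℂ`,
given by the standard averaged signed sum over permutations. -/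
noncomputable def pfaff {σ : Type*} {n : ℕ}
    (M : Matrix (Fin (2*n)) (Fin (2*n)) (MvPolynomial σ ℂ)) : MvPolynomial σ ℂ :=
  (((2^n * n.factorial : ℕ) : ℂ)⁻¹) •
    ∑ p : Equiv.Perm (Fin (2*n)),
      (Equiv.Perm.sign p : ℤ) •
        ∏ i : Fin n, M (p ⟨2*i.1, by have := i.2; omega⟩) (p ⟨2*i.1+1, by have := i.2; omega⟩)

/-- A square matrix of polynomials is skew-symmetric. -/
def IsSkew {m : Type*} {R : Type*} [Ring R] (M : Matrix m m R) : Prop :=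
  ∀ i j, M j i = - M i j

/-- A square integer matrix is homogeneous. -/
def HomogMat {m : Type*} (A : Matrix m m ℕ) : Prop :=
  ∀ i j l r, A i j + A l r = A i r + A l j

/-- A matrix of polynomials has degree matrix `A`. -/
def DegMat {σ m : Type*} (M : Matrix m m (MvPolynomial σ ℂ)) (A : Matrix m m ℕ) : Prop :=
  ∀ i j, (M i j).IsHomogeneous (A i j)

/-- The set of submaximal Pfaffians of a skew-symmetric matrix of even size `2k`:
Pfaffians of the submatrices obtained by erasing two rows and the two columns
with the same indexes. -/
def submaxPfEven {σ : Type*} {k : ℕ}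
    (M : Matrix (Fin (2*k)) (Fin (2*k)) (MvPolynomial σ ℂ)) : Set (MvPolynomial σ ℂ) :=
  { q | ∃ e : Fin (2*(k-1)) ↪o Fin (2*k), q = pfaff (M.submatrix e e) }

/-- The set of submaximal Pfaffians of a skew-symmetric matrix of odd size `2k-1`:
Pfaffians of the submatrices obtained by erasing one row and the column
with the same index. -/
def submaxPfOdd {σ : Type*} {k : ℕ}
    (M : Matrix (Fin (2*k-1)) (Fin (2*k-1)) (MvPolynomial σ ℂ)) : Set (MvPolynomial σ ℂ) :=
  { q | ∃ e : Fin (2*(k-1)) ↪o Fin (2*k-1), q = pfaff (M.submatrix e e) }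

/-- The identification of `Fin (2 * n)` with `n` consecutive pairs. -/
def finPairEquiv (n : ℕ) : Fin n × Fin 2 ≃ Fin (2 * n) :=
  finProdFinEquiv.trans (finCongr (mul_comm n 2))

theorem finPairEquiv_zero {n : ℕ} (i : Fin n) :
    finPairEquiv n (i, 0) = ⟨2 * i.1, by have := i.2; omega⟩ := by
  ext; simp [finPairEquiv, finProdFinEquiv]

theorem finPairEquiv_one {n : ℕ} (i : Fin n) :
    finPairEquiv n (i, 1) = ⟨2 * i.1 + 1, by have := i.2; omega⟩ := by
  ext; simp [finPairEquiv, finProdFinEquiv, add_comm]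

theorem pfaff_eq {σ : Type*} {n : ℕ}
    (M : Matrix (Fin (2*n)) (Fin (2*n)) (MvPolynomial σ ℂ)) :
    pfaff M = (((2^n * n.factorial : ℕ) : ℂ)⁻¹) • ∑ p : Equiv.Perm (Fin (2*n)),
      (Equiv.Perm.sign p : ℤ) •
        ∏ i : Fin n, M (p (finPairEquiv n (i, 0))) (p (finPairEquiv n (i, 1))) := by
  simp only [pfaff, finPairEquiv_zero, finPairEquiv_one]

/-- A permutation of `ι × Fin 2` compatible with the pairing is a permutation of the pairs
followed by permutations inside each pair. -/
theorem exists_perm_prod_fin_two {ι : Type*} [Finite ι] (q : Equiv.Perm (ι × Fin 2))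
    (hq : ∀ i, q (i, 1) = ((q (i, 0)).1, Equiv.swap 0 1 (q (i, 0)).2)) :
    ∃ (τ : Equiv.Perm ι) (s : ι → Equiv.Perm (Fin 2)),
      q = Equiv.prodCongrLeft (fun _ => τ) * Equiv.prodCongrRight s := by
  have hinj : Function.Injective fun i => (q (i, 0)).1 := by
    intro i j hij
    by_cases h : (q (i, 0)).2 = (q (j, 0)).2
    · simpa using q.injective (Prod.ext hij h)
    · have h2 : (q (i, 0)).2 = Equiv.swap 0 1 (q (j, 0)).2 := by
        generalize (q (i, 0)).2 = a at *
        generalize (q (j, 0)).2 = b at *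
        revert a b; decide
      have : q (i, 0) = q (j, 1) := by rw [hq]; exact Prod.ext hij h2
      simpa using q.injective this
  refine ⟨Equiv.ofBijective _ (Finite.injective_iff_bijective.mp hinj),
    fun i => Equiv.swap 0 (q (i, 0)).2, ?_⟩
  refine Equiv.ext fun ⟨i, b⟩ => ?_
  have key : ∀ c : Fin 2, Equiv.swap 0 1 c = Equiv.swap 0 c 1 := by decide
  fin_cases b
  · simp
  · simp [hq, key]

/-- If the standard matching is the only perfect matching supported on the nonzero entries of a
skew-symmetric matrix, then its Pfaffian is a nonzero multiple of the corresponding product. -/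
theorem pfaff_eq_smul_prod {σ : Type*} {n : ℕ}
    (M : Matrix (Fin (2*n)) (Fin (2*n)) (MvPolynomial σ ℂ)) (hM : IsSkew M)
    (huniq : ∀ μ : Fin (2*n) → Fin (2*n), (∀ x, μ (μ x) = x) → (∀ x, M x (μ x) ≠ 0) →
      ∀ i, μ (finPairEquiv n (i, 0)) = finPairEquiv n (i, 1))
    (hne : ∀ i, M (finPairEquiv n (i, 0)) (finPairEquiv n (i, 1)) ≠ 0) :
    ∃ c : ℂ, c ≠ 0 ∧
      pfaff M = c • ∏ i, M (finPairEquiv n (i, 0)) (finPairEquiv n (i, 1)) := by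
  classical
  set D := ∏ i, M (finPairEquiv n (i, 0)) (finPairEquiv n (i, 1)) with hD
  have hterm : ∀ p : Equiv.Perm (Fin (2*n)),
      (∀ i, M (p (finPairEquiv n (i, 0))) (p (finPairEquiv n (i, 1))) ≠ 0) →
      (Equiv.Perm.sign p : ℤ) •
        ∏ i : Fin n, M (p (finPairEquiv n (i, 0))) (p (finPairEquiv n (i, 1))) = D := by
    intro p hp
    set q : Equiv.Perm (Fin n × Fin 2) := (finPairEquiv n).trans (p.trans (finPairEquiv n).symm)
      with hqdef
    have hpq : ∀ y, p (finPairEquiv n y) = finPairEquiv n (q y) := by simp [hqdef]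
    let sw : Fin n × Fin 2 → Fin n × Fin 2 := fun y => (y.1, Equiv.swap 0 1 y.2)
    have hsw : ∀ y, sw (sw y) = y := by simp [sw]
    have hmu := huniq (fun x => finPairEquiv n (q (sw (q.symm ((finPairEquiv n).symm x)))))
      (by simp [hsw]) (by
        intro x
        obtain ⟨y, rfl⟩ := (finPairEquiv n).surjective x
        obtain ⟨⟨i, b⟩, rfl⟩ := q.surjective y
        have h := hp i
        simp only [hpq] at h
        fin_cases b
        · simpa [sw] using h
        · simp only [Equiv.symm_apply_apply, sw]
          rw [hM]
          simpa using h)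
    have hmu' : ∀ i, q (sw (q.symm (i, 0))) = (i, 1) := by simpa using hmu
    have hcomm : ∀ y, q (sw y) = sw (q y) := by
      intro y
      obtain ⟨z, rfl⟩ := q.symm.surjective y
      obtain ⟨i, b⟩ := z
      fin_cases b
      · simp [hmu', sw]
      · simp only [Equiv.apply_symm_apply]
        have := hmu' i
        have h2 : q.symm (i, 1) = sw (q.symm (i, 0)) := by rw [← this]; simp
        simp [h2, hsw, sw]
    obtain ⟨τ, s, hts⟩ := exists_perm_prod_fin_two q (fun i => by
      have := hcomm (i, 0); simpa [sw] using this)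
    have hsign : Equiv.Perm.sign p = ∏ i, Equiv.Perm.sign (s i) := by
      have : Equiv.Perm.sign q = Equiv.Perm.sign p :=
        Equiv.Perm.sign_trans_trans_symm p (finPairEquiv n)
      rw [← this, hts, map_mul, Equiv.Perm.sign_prodCongrLeft, Equiv.Perm.sign_prodCongrRight]
      simp
    have hentry : ∀ i, M (p (finPairEquiv n (i, 0))) (p (finPairEquiv n (i, 1))) =
        (((Equiv.Perm.sign (s i) : ℤˣ) : ℤ) : MvPolynomial σ ℂ) *
          M (finPairEquiv n (τ i, 0)) (finPairEquiv n (τ i, 1)) := by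
      intro i
      simp only [hpq, hts, Equiv.Perm.mul_apply, Equiv.prodCongrLeft_apply,
        Equiv.prodCongrRight_apply]
      have key : ∀ t : Equiv.Perm (Fin 2), (t 0 = 0 ∧ t 1 = 1 ∧ Equiv.Perm.sign t = 1) ∨
        (t 0 = 1 ∧ t 1 = 0 ∧ Equiv.Perm.sign t = -1) := by decide
      rcases key (s i) with ⟨h0, h1, h2⟩ | ⟨h0, h1, h2⟩
      · simp [h0, h1, h2]
      · rw [h0, h1, h2, hM]; simp
    simp only [hentry, Finset.prod_mul_distrib]
    rw [Equiv.prod_comp τ fun i => M (finPairEquiv n (i, 0)) (finPairEquiv n (i, 1)), ← hD, hsign,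
      zsmul_eq_mul, ← mul_assoc, ← Int.cast_prod, ← Units.coe_prod, ← Int.cast_mul,
      ← Units.val_mul]
    simp [Int.units_mul_self]
  have hsum : ∑ p : Equiv.Perm (Fin (2*n)), (Equiv.Perm.sign p : ℤ) •
        ∏ i : Fin n, M (p (finPairEquiv n (i, 0))) (p (finPairEquiv n (i, 1))) =
      (Finset.univ.filter fun p : Equiv.Perm (Fin (2*n)) =>
        ∀ i, M (p (finPairEquiv n (i, 0))) (p (finPairEquiv n (i, 1))) ≠ 0).card • D := by
    rw [← Finset.sum_const, Finset.sum_filter]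
    refine Finset.sum_congr rfl fun p _ => ?_
    split_ifs with h
    · exact hterm p h
    · push Not at h
      obtain ⟨i, hi⟩ := h
      rw [Finset.prod_eq_zero (Finset.mem_univ i) hi, smul_zero]
  refine ⟨((2^n * n.factorial : ℕ) : ℂ)⁻¹ * ((Finset.univ.filter fun p : Equiv.Perm (Fin (2*n)) =>
        ∀ i, M (p (finPairEquiv n (i, 0))) (p (finPairEquiv n (i, 1))) ≠ 0).card : ℂ), ?_, ?_⟩
  · refine mul_ne_zero (inv_ne_zero (Nat.cast_ne_zero.mpr (by positivity)))
      (Nat.cast_ne_zero.mpr (Finset.card_ne_zero.mpr ⟨1, ?_⟩))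
    simpa using hne
  · rw [pfaff_eq, hsum, mul_smul, Nat.cast_smul_eq_nsmul]

theorem pfaff_isHomogeneous {σ : Type*} {n : ℕ}
    {M : Matrix (Fin (2*n)) (Fin (2*n)) (MvPolynomial σ ℂ)} {B : Matrix (Fin (2*n)) (Fin (2*n)) ℕ}
    (hM : ∀ i j, (M i j).IsHomogeneous (B i j)) (hB : ∀ i j, 2 * B i j = B i i + B j j) :
    (pfaff M).IsHomogeneous (∑ i, B (finPairEquiv n (i, 0)) (finPairEquiv n (i, 1))) := by
  have hdeg : ∀ p : Equiv.Perm (Fin (2*n)),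
      2 * ∑ i, B (p (finPairEquiv n (i, 0))) (p (finPairEquiv n (i, 1))) = ∑ x, B x x := by
    intro p
    rw [← Equiv.sum_comp ((finPairEquiv n).trans p), Fintype.sum_prod_type, Finset.mul_sum]
    simp [hB]
  have hterm : ∀ p : Equiv.Perm (Fin (2*n)), ((Equiv.Perm.sign p : ℤ) •
      ∏ i : Fin n, M (p (finPairEquiv n (i, 0))) (p (finPairEquiv n (i, 1)))).IsHomogeneous
        (∑ i, B (finPairEquiv n (i, 0)) (finPairEquiv n (i, 1))) := by
    intro p
    have h := IsHomogeneous.prod Finset.univ _ _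
      fun i _ => hM (p (finPairEquiv n (i, 0))) (p (finPairEquiv n (i, 1)))
    have h1 : ∑ i, B (p (finPairEquiv n (i, 0))) (p (finPairEquiv n (i, 1))) =
        ∑ i, B (finPairEquiv n (i, 0)) (finPairEquiv n (i, 1)) :=
      Nat.eq_of_mul_eq_mul_left two_pos ((hdeg p).trans (hdeg 1).symm)
    rw [h1] at h
    rcases Int.units_eq_one_or (Equiv.Perm.sign p) with hs | hs
    · simpa [hs] using h
    · simpa [hs] using h.neg
  rw [pfaff_eq, MvPolynomial.smul_eq_C_mul]
  exact (IsHomogeneous.sum _ _ _ fun p _ => hterm p).C_mul _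

/-- The increasing edges of the chain of triangles `{2i, 2i + 1, 2i + 2}`. -/
def ChainEdge (i j : ℕ) : Prop := j = i + 1 ∨ (i % 2 = 0 ∧ j = i + 2)

/-- The enumeration of the naturals different from `v`. -/
def skipNat (v x : ℕ) : ℕ := if x < v then x else x + 1

/-- After erasing a vertex, a chain of triangles has only one perfect matching. -/
theorem chain_matching_unique {n v : ℕ} (m : ℕ → ℕ)
    (hlt : ∀ x < 2 * n, m x < 2 * n) (hinv : ∀ x < 2 * n, m (m x) = x)
    (hadj : ∀ x < 2 * n, ChainEdge (skipNat v x) (skipNat v (m x)) ∨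
      ChainEdge (skipNat v (m x)) (skipNat v x)) (i : ℕ) (hi : i < n) :
    m (2 * i) = 2 * i + 1 := by
  simp only [ChainEdge, skipNat] at hadj
  have hleft : ∀ i < n, 2 * i + 1 < v → m (2 * i) = 2 * i + 1 := by
    intro i
    induction i using Nat.strong_induction_on with
    | _ i ih =>
      intro hi hv
      have h0 := hadj (2 * i) (by omega)
      have h1 := hadj (2 * i + 1) (by omega)
      have l0 := hinv (2 * i) (by omega)
      have l1 := hinv (2 * i + 1) (by omega)
      have hprev : i = 0 ∨ (m (2 * i - 2) = 2 * i - 1 ∧ m (2 * i - 1) = 2 * i - 2) := by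
        rcases Nat.eq_zero_or_pos i with h | h
        · exact Or.inl h
        · have h2 := ih (i - 1) (by omega) (by omega) (by omega)
          have h3 := hinv (2 * (i - 1)) (by omega)
          rw [h2] at h3
          rw [show 2 * (i - 1) + 1 = 2 * i - 1 by omega] at h2 h3
          rw [show 2 * (i - 1) = 2 * i - 2 by omega] at h2 h3
          exact Or.inr ⟨h2, h3⟩
      have c0 : m (2 * i) = 2 * i + 1 ∨ m (2 * i) = 2 * i + 2 ∨ (0 < i ∧
          (m (2 * i) = 2 * i - 1 ∨ m (2 * i) = 2 * i - 2)) := by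
        clear hprev ih l0 l1 h1
        generalize m (2 * i) = y at *
        split_ifs at h0 <;> omega
      have c1 : m (2 * i + 1) = 2 * i ∨ m (2 * i + 1) = 2 * i + 2 := by
        clear hprev ih l0 l1 h0 c0
        generalize m (2 * i + 1) = y at *
        split_ifs at h1 <;> omega
      rcases c0 with c | c | ⟨hi, c | c⟩ <;> rw [c] at l0 ⊢
      · rcases c1 with c1 | c1 <;> rw [c1] at l1 <;> omega
      · omega
      · omega
  have hright : ∀ k < n, v ≤ 2 * (n - 1 - k) →
      m (2 * (n - 1 - k)) = 2 * (n - 1 - k) + 1 := by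
    intro k
    induction k using Nat.strong_induction_on with
    | _ k ih =>
      intro hk hv
      obtain ⟨i, hi⟩ : ∃ i, i = n - 1 - k := ⟨_, rfl⟩
      rw [← hi] at hv ⊢
      have h0 := hadj (2 * i) (by omega)
      have h1 := hadj (2 * i + 1) (by omega)
      have l0 := hinv (2 * i) (by omega)
      have l1 := hinv (2 * i + 1) (by omega)
      have b0 := hlt (2 * i) (by omega)
      have b1 := hlt (2 * i + 1) (by omega)
      have hnext : i + 1 = n ∨ (m (2 * i + 2) = 2 * i + 3 ∧ m (2 * i + 3) = 2 * i + 2) := by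
        rcases Nat.eq_zero_or_pos k with h | h
        · exact Or.inl (by omega)
        · have h2 := ih (k - 1) (by omega) (by omega) (by omega)
          have h3 := hinv (2 * (n - 1 - (k - 1))) (by omega)
          rw [h2] at h3
          rw [show n - 1 - (k - 1) = i + 1 by omega] at h2 h3
          exact Or.inr ⟨h2, h3⟩
      have c1 : m (2 * i + 1) = 2 * i ∨ m (2 * i + 1) = 2 * i - 1 ∧ 0 < i ∨ (i + 1 < n ∧
          (m (2 * i + 1) = 2 * i + 2 ∨ m (2 * i + 1) = 2 * i + 3)) := by
        clear hnext ih l0 l1 h0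
        generalize m (2 * i + 1) = y at *
        split_ifs at h1 <;> omega
      have c0 : m (2 * i) = 2 * i + 1 ∨ m (2 * i) = 2 * i - 1 ∧ 0 < i := by
        clear hnext ih l0 l1 h1 c1
        generalize m (2 * i) = y at *
        split_ifs at h0 <;> omega
      rcases c1 with c | ⟨c, hi⟩ | ⟨hi, c | c⟩ <;> rw [c] at l1
      · exact l1
      · rcases c0 with c0 | ⟨c0, -⟩
        · exact c0
        · rw [c0] at l0; omega
      · omega
      · omega
  rcases lt_trichotomy (2 * i + 1) v with h | h | h
  · exact hleft i hi h
  · have h0 := hadj (2 * i) (by omega)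
    have l0 := hinv (2 * i) (by omega)
    have hprev : i = 0 ∨ (m (2 * i - 2) = 2 * i - 1 ∧ m (2 * i - 1) = 2 * i - 2) := by
      rcases Nat.eq_zero_or_pos i with h | h
      · exact Or.inl h
      · have h2 := hleft (i - 1) (by omega) (by omega)
        have h3 := hinv (2 * (i - 1)) (by omega)
        rw [h2] at h3
        rw [show 2 * (i - 1) + 1 = 2 * i - 1 by omega] at h2 h3
        rw [show 2 * (i - 1) = 2 * i - 2 by omega] at h2 h3
        exact Or.inr ⟨h2, h3⟩
    have c0 : m (2 * i) = 2 * i + 1 ∨ (0 < i ∧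
        (m (2 * i) = 2 * i - 1 ∨ m (2 * i) = 2 * i - 2)) := by
      clear hprev hleft hright l0
      generalize m (2 * i) = y at *
      split_ifs at h0 <;> omega
    rcases c0 with c | ⟨hi, c | c⟩ <;> rw [c] at l0 ⊢ <;> omega
  · have := hright (n - 1 - i) (by omega) (by omega)
    rwa [show n - 1 - (n - 1 - i) = i by omega] at this

instance (i j : ℕ) : Decidable (ChainEdge i j) :=
  inferInstanceAs (Decidable (j = i + 1 ∨ (i % 2 = 0 ∧ j = i + 2)))

/-- The exponent of the first variable in the entry of the chain matrix at an edge. -/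
def chainExp (a : ℕ → ℕ) (i j : ℕ) : ℕ :=
  if j = i + 2 then a i / 2 else if i % 2 = 0 then (a i + a j) / 2 else 0

/-- The entries of the chain matrix above the diagonal. -/
noncomputable def chainEntry (a : ℕ → ℕ) (i j : ℕ) : MvPolynomial (Fin 3) ℂ :=
  if ChainEdge i j then
    X 0 ^ chainExp a i j * X 1 ^ ((a i + a j) / 2 - chainExp a i j)
  else 0

/-- A skew-symmetric matrix of monomials in two variables supported on a chain of triangles. -/
noncomputable def chainMatrix (N : ℕ) (a : ℕ → ℕ) :
    Matrix (Fin N) (Fin N) (MvPolynomial (Fin 3) ℂ) :=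
  fun i j => chainEntry a i j - chainEntry a j i

theorem chainMatrix_isSkew (N : ℕ) (a : ℕ → ℕ) : IsSkew (chainMatrix N a) := fun i j => by
  simp [chainMatrix]

theorem chainEntry_isHomogeneous (a : ℕ → ℕ) (i j : ℕ) :
    (chainEntry a i j).IsHomogeneous ((a i + a j) / 2) := by
  rw [chainEntry]
  split_ifs
  · have hle : chainExp a i j ≤ (a i + a j) / 2 := by
      rw [chainExp]; split_ifs <;> omega
    have h := (isHomogeneous_X_pow (R := ℂ) (0 : Fin 3) (chainExp a i j)).mul
      (isHomogeneous_X_pow (R := ℂ) (1 : Fin 3) ((a i + a j) / 2 - chainExp a i j))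
    rwa [Nat.add_sub_cancel' hle] at h
  · exact isHomogeneous_zero _ _ _

theorem chainMatrix_isHomogeneous {N : ℕ} (a : ℕ → ℕ) (i j : Fin N) :
    (chainMatrix N a i j).IsHomogeneous ((a i + a j) / 2) :=
  (chainEntry_isHomogeneous a i j).sub (by
    rw [add_comm]; exact chainEntry_isHomogeneous a j i)

theorem ChainEdge.not_symm {i j : ℕ} (h : ChainEdge i j) : ¬ ChainEdge j i := by
  simp only [ChainEdge] at *; omega

theorem chainMatrix_of_edge {N : ℕ} (a : ℕ → ℕ) {i j : Fin N} (h : ChainEdge i j) :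
    chainMatrix N a i j = X 0 ^ chainExp a i j * X 1 ^ ((a i + a j) / 2 - chainExp a i j) := by
  simp [chainMatrix, chainEntry, h, h.not_symm]

theorem edge_of_chainMatrix_ne_zero {N : ℕ} {a : ℕ → ℕ} {i j : Fin N}
    (h : chainMatrix N a i j ≠ 0) : ChainEdge i j ∨ ChainEdge j i := by
  by_contra! hc
  exact h (by simp [chainMatrix, chainEntry, hc])

theorem val_succAbove_eq_skipNat {n : ℕ} (v : Fin (n + 1)) (x : Fin n) :
    (v.succAbove x : ℕ) = skipNat v x := by
  simp only [Fin.succAbove, skipNat, Fin.lt_def, Fin.val_castSucc]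
  split_ifs <;> simp

/-- The contribution of the `i`-th pair to the exponent of the first variable in the `v`-th
submaximal Pfaffian of the chain matrix. -/
def pfaffExpX (a : ℕ → ℕ) (v i : ℕ) : ℕ :=
  if 2 * i + 1 < v then (a (2 * i) + a (2 * i + 1)) / 2
  else if 2 * i < v then a (2 * i) / 2 else 0

/-- The contribution of the `i`-th pair to the exponent of the second variable in the `v`-th
submaximal Pfaffian of the chain matrix. -/
def pfaffExpY (a : ℕ → ℕ) (v i : ℕ) : ℕ :=
  if 2 * i + 1 < v then 0
  else if 2 * i < v then (a (2 * i) + a (2 * i + 2)) / 2 - a (2 * i) / 2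
  else (a (2 * i + 1) + a (2 * i + 2)) / 2

theorem chainMatrix_pair {n : ℕ} (a : ℕ → ℕ) (v : Fin (2 * n + 1)) (i : Fin n) :
    chainMatrix (2 * n + 1) a (v.succAbove (finPairEquiv n (i, 0)))
      (v.succAbove (finPairEquiv n (i, 1))) =
    X 0 ^ pfaffExpX a v i * X 1 ^ pfaffExpY a v i := by
  have h0 : (v.succAbove (finPairEquiv n (i, 0)) : ℕ) = skipNat v (2 * i) := by
    rw [val_succAbove_eq_skipNat, finPairEquiv_zero]
  have h1 : (v.succAbove (finPairEquiv n (i, 1)) : ℕ) = skipNat v (2 * i + 1) := by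
    rw [val_succAbove_eq_skipNat, finPairEquiv_one]
  have hedge : ChainEdge (skipNat v (2 * i)) (skipNat v (2 * i + 1)) := by
    simp only [skipNat, ChainEdge]
    split_ifs <;> omega
  rw [chainMatrix_of_edge _ (by rwa [h0, h1]), h0, h1]
  rcases lt_trichotomy (2 * (i : ℕ) + 1) v with h | h | h
  · have e0 : skipNat v (2 * i) = 2 * i := if_pos (by omega)
    have e1 : skipNat v (2 * i + 1) = 2 * i + 1 := if_pos h
    rw [e0, e1]
    simp [chainExp, pfaffExpX, pfaffExpY, h]
  · have e0 : skipNat v (2 * i) = 2 * i := if_pos (by omega)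
    have e1 : skipNat v (2 * i + 1) = 2 * i + 2 := if_neg (by omega)
    rw [e0, e1]
    simp [chainExp, pfaffExpX, pfaffExpY, ← h]
  · have e0 : skipNat v (2 * i) = 2 * i + 1 := if_neg (by omega)
    have e1 : skipNat v (2 * i + 1) = 2 * i + 2 := if_neg (by omega)
    have h2 : (2 * (i : ℕ) + 1) % 2 = 1 := by omega
    rw [e0, e1]
    simp [chainExp, pfaffExpX, pfaffExpY, h2, show ¬ 2 * (i : ℕ) + 1 < v by omega,
      show ¬ 2 * (i : ℕ) < v by omega]

theorem pfaff_chainMatrix {n : ℕ} (a : ℕ → ℕ) (v : Fin (2 * n + 1)) :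
    ∃ c : ℂ, c ≠ 0 ∧
      pfaff ((chainMatrix (2 * n + 1) a).submatrix v.succAbove v.succAbove) =
        c • (X 0 ^ (∑ i : Fin n, pfaffExpX a v i) * X 1 ^ (∑ i : Fin n, pfaffExpY a v i)) := by
  obtain ⟨c, hc, h⟩ := pfaff_eq_smul_prod
    ((chainMatrix (2 * n + 1) a).submatrix v.succAbove v.succAbove)
    (fun i j => chainMatrix_isSkew _ a _ _) (fun μ hinv hne i => by
      have key := chain_matching_unique (n := n) (v := v)
        (fun x => if h : x < 2 * n then (μ ⟨x, h⟩ : ℕ) else x)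
        (fun x hx => by simp [hx]) (fun x hx => by simp [hx, hinv])
        (fun x hx => by
          have := edge_of_chainMatrix_ne_zero (hne ⟨x, hx⟩)
          simpa only [val_succAbove_eq_skipNat, hx, dif_pos] using this) i i.2
      rw [dif_pos (by omega)] at key
      rw [finPairEquiv_zero, finPairEquiv_one]
      exact Fin.ext key)
    (fun i => by
      rw [Matrix.submatrix_apply, chainMatrix_pair]
      exact mul_ne_zero (pow_ne_zero _ (X_ne_zero _)) (pow_ne_zero _ (X_ne_zero _)))
  refine ⟨c, hc, ?_⟩
  simp only [h, Matrix.submatrix_apply, chainMatrix_pair, Finset.prod_mul_distrib,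
    Finset.prod_pow_eq_pow_sum]

theorem sum_pfaffExp_le (a : ℕ → ℕ) (hpar : ∀ i j, Even (a i + a j)) (v n : ℕ) (hv : v < 2 * n) :
    2 * (∑ i ∈ Finset.range n, pfaffExpX a (v + 1) i + ∑ i ∈ Finset.range n, pfaffExpY a v i) ≤
      ∑ x ∈ Finset.range (2 * n + 1), a x + 1 := by
  have key : ∀ m, 2 * (∑ i ∈ Finset.range m, pfaffExpX a (v + 1) i +
      ∑ i ∈ Finset.range m, pfaffExpY a v i) ≤
      if v < 2 * m then ∑ x ∈ Finset.range (2 * m + 1), a x + 1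
        else ∑ x ∈ Finset.range (2 * m), a x := by
    intro m
    induction m with
    | zero => simp
    | succ m ih =>
      rw [show 2 * (m + 1) + 1 = 2 * m + 1 + 1 + 1 by ring, show 2 * (m + 1) = 2 * m + 1 + 1 by ring]
      simp only [Finset.sum_range_succ _ (2 * m + 1 + 1), Finset.sum_range_succ _ (2 * m + 1),
        Finset.sum_range_succ _ (2 * m), Finset.sum_range_succ _ m, pfaffExpX, pfaffExpY] at ih ⊢
      have h0 := hpar (2 * m) (2 * m + 1)
      have h1 := hpar (2 * m + 1) (2 * m + 2)
      have h2 := hpar (2 * m) (2 * m + 2)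
      have h3 : a (2 * m + 1 + 1) = a (2 * m + 2) := rfl
      rw [Nat.even_iff] at h0 h1 h2
      rw [h3]
      split_ifs at ih ⊢ <;> omega
  simpa [hv] using key n

/-- Every exponent of large degree dominates the exponent of a submaximal Pfaffian. -/
theorem exists_pfaffExp_le (a : ℕ → ℕ) (hpar : ∀ i j, Even (a i + a j)) (n u w : ℕ)
    (h : ∑ x ∈ Finset.range (2 * n + 1), a x ≤ 2 * (u + w) + 2) :
    ∃ v ≤ 2 * n, ∑ i ∈ Finset.range n, pfaffExpX a v i ≤ u ∧
      ∑ i ∈ Finset.range n, pfaffExpY a v i ≤ w := by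
  by_contra! hc
  have hX : ∀ v ≤ 2 * n, ∑ i ∈ Finset.range n, pfaffExpX a v i ≤ u := by
    intro v
    induction v with
    | zero => simp [pfaffExpX]
    | succ v ih =>
      intro hv
      have h1 := hc v (by omega) (ih (by omega))
      have h2 := sum_pfaffExp_le a hpar v n (by omega)
      omega
  have h1 := hc (2 * n) le_rfl (hX _ le_rfl)
  have h2 : ∑ i ∈ Finset.range n, pfaffExpY a (2 * n) i = 0 :=
    Finset.sum_eq_zero fun i hi => by
      rw [pfaffExpY, if_pos (by have := Finset.mem_range.mp hi; omega)]
  omega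

/-- The functions on `α` that are polynomials in the coordinates `κ`. -/
noncomputable def coordSubalgebra {α τ : Type*} (κ : α → τ → ℂ) : Subalgebra ℂ (α → ℂ) :=
  (aeval (fun t a => κ a t) : MvPolynomial τ ℂ →ₐ[ℂ] α → ℂ).range

theorem exists_eval_eq_of_mem_coordSubalgebra {α τ : Type*} {κ : α → τ → ℂ} {f : α → ℂ}
    (hf : f ∈ coordSubalgebra κ) : ∃ p : MvPolynomial τ ℂ, ∀ a, eval (κ a) p = f a := by
  obtain ⟨p, rfl⟩ := hf
  refine ⟨p, fun a => ?_⟩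
  induction p using MvPolynomial.induction_on with
  | C r => simp
  | add p q hp hq => simp_all
  | mul_X p i hp => simp_all

theorem coord_mem_coordSubalgebra {α τ : Type*} (κ : α → τ → ℂ) (t : τ) :
    (fun a => κ a t) ∈ coordSubalgebra κ := ⟨X t, by simp⟩

/-- A family of polynomials whose coefficients are polynomials in the coordinates `κ`. -/
def PolyCoeffs {α τ σ : Type*} (κ : α → τ → ℂ) (g : α → MvPolynomial σ ℂ) : Prop :=
  ∀ s, (fun a => coeff s (g a)) ∈ coordSubalgebra κ

namespace PolyCoeffs

variable {α τ σ : Type*} {κ : α → τ → ℂ}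

theorem const (p : MvPolynomial σ ℂ) : PolyCoeffs κ fun _ => p := fun s =>
  (coordSubalgebra κ).algebraMap_mem (coeff s p)

theorem add {g h : α → MvPolynomial σ ℂ} (hg : PolyCoeffs κ g) (hh : PolyCoeffs κ h) :
    PolyCoeffs κ fun a => g a + h a := fun s => by
  simp only [coeff_add]
  exact (coordSubalgebra κ).add_mem (hg s) (hh s)

theorem sum {ι : Type*} {S : Finset ι} {g : ι → α → MvPolynomial σ ℂ}
    (hg : ∀ i ∈ S, PolyCoeffs κ (g i)) : PolyCoeffs κ fun a => ∑ i ∈ S, g i a := fun s => by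
  simp only [coeff_sum]
  convert (coordSubalgebra κ).sum_mem fun i hi => hg i hi s using 1
  ext; simp

theorem mul {g h : α → MvPolynomial σ ℂ} (hg : PolyCoeffs κ g) (hh : PolyCoeffs κ h) :
    PolyCoeffs κ fun a => g a * h a := fun s => by
  classical
  simp only [coeff_mul]
  convert (coordSubalgebra κ).sum_mem (t := Finset.HasAntidiagonal.antidiagonal s) fun x _ =>
    (coordSubalgebra κ).mul_mem (hg x.1) (hh x.2) using 1
  ext; simp

theorem prod {ι : Type*} {S : Finset ι} {g : ι → α → MvPolynomial σ ℂ}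
    (hg : ∀ i ∈ S, PolyCoeffs κ (g i)) : PolyCoeffs κ fun a => ∏ i ∈ S, g i a := by
  classical
  induction S using Finset.induction_on with
  | empty => simpa using const 1
  | insert i S hi ih =>
    simp only [Finset.prod_insert hi]
    exact (hg i (Finset.mem_insert_self i S)).mul
      (ih fun j hj => hg j (Finset.mem_insert_of_mem hj))

theorem pfaff {n : ℕ} {M : α → Matrix (Fin (2*n)) (Fin (2*n)) (MvPolynomial σ ℂ)}
    (hM : ∀ i j, PolyCoeffs κ fun a => M a i j) : PolyCoeffs κ fun a => pfaff (M a) := by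
  simp only [_root_.pfaff, smul_eq_C_mul, zsmul_eq_mul]
  exact (const _).mul (sum fun p _ => (const _).mul (prod fun i _ => hM _ _))

theorem exists_det_eq {ι : Type*} [Fintype ι] [DecidableEq ι] {g : ι → α → MvPolynomial σ ℂ}
    (hg : ∀ i, PolyCoeffs κ (g i)) (m : ι → σ →₀ ℕ) :
    ∃ p : MvPolynomial τ ℂ, ∀ a, eval (κ a) p =
      (Matrix.of fun i j => coeff (m j) (g i a)).det := by
  refine exists_eval_eq_of_mem_coordSubalgebra ?_
  simp only [Matrix.det_apply, Matrix.of_apply, Units.smul_def]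
  convert (coordSubalgebra κ).sum_mem (t := Finset.univ) fun (p : Equiv.Perm ι) _ =>
    (coordSubalgebra κ).zsmul_mem
      ((coordSubalgebra κ).prod_mem (t := Finset.univ) fun i _ => hg (p i) (m i))
      (Equiv.Perm.sign p : ℤ) using 1
  ext; simp

end PolyCoeffs

/-- Forms of degree `d` are spanned by any family of forms with invertible coefficient matrix. -/
theorem exists_eq_sum_smul_of_det_ne_zero {σ : Type*} [Fintype σ] [DecidableEq σ] {d : ℕ}
    (g : (Finset.univ : Finset σ).finsuppAntidiag d → MvPolynomial σ ℂ)
    (hg : ∀ i, (g i).IsHomogeneous d)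
    (hdet : (Matrix.of fun i j : (Finset.univ : Finset σ).finsuppAntidiag d =>
      coeff j.1 (g i)).det ≠ 0)
    {F : MvPolynomial σ ℂ} (hF : F.IsHomogeneous d) :
    ∃ x : (Finset.univ : Finset σ).finsuppAntidiag d → ℂ, F = ∑ i, x i • g i := by
  set B := Matrix.of fun i j : (Finset.univ : Finset σ).finsuppAntidiag d => coeff j.1 (g i)
  have hB : IsUnit B.det := isUnit_iff_ne_zero.mpr hdet
  refine ⟨Matrix.vecMul (fun j => coeff j.1 F) B⁻¹, ?_⟩
  ext s
  by_cases hs : s.degree = d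
  · have hmem : s ∈ (Finset.univ : Finset σ).finsuppAntidiag d := by
      simpa [Finsupp.degree_eq_sum] using hs
    have h : Matrix.vecMul (Matrix.vecMul (fun j => coeff j.1 F) B⁻¹) B = fun j => coeff j.1 F := by
      rw [Matrix.vecMul_vecMul, Matrix.nonsing_inv_mul _ hB, Matrix.vecMul_one]
    have h' := congrFun h ⟨s, hmem⟩
    simp only [coeff_sum, coeff_smul, smul_eq_mul]
    exact h'.symm
  · rw [hF.coeff_eq_zero hs, coeff_sum]
    simp [fun i => (hg i).coeff_eq_zero hs]

/-- `F` is of the form `L * G'` modulo `I`, with `G'` of degree `d - 1` (zero for `d = 0`). -/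
def LiftsMod {σ : Type*} (I : Ideal (MvPolynomial σ ℂ)) (L : MvPolynomial σ ℂ) (d : ℕ)
    (F : MvPolynomial σ ℂ) : Prop :=
  ∃ G' : MvPolynomial σ ℂ, G'.IsHomogeneous (d - 1) ∧ (d = 0 → G' = 0) ∧ F - L * G' ∈ I

namespace LiftsMod

variable {σ : Type*} {I : Ideal (MvPolynomial σ ℂ)} {L F : MvPolynomial σ ℂ} {d : ℕ}

theorem sum {ι : Type*} {S : Finset ι} {F : ι → MvPolynomial σ ℂ}
    (h : ∀ i ∈ S, LiftsMod I L d (F i)) : LiftsMod I L d (∑ i ∈ S, F i) := by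
  choose! G' h1 h2 h3 using h
  refine ⟨∑ i ∈ S, G' i, IsHomogeneous.sum _ _ _ h1,
    fun hd => Finset.sum_eq_zero fun i hi => h2 i hi hd, ?_⟩
  rw [Finset.mul_sum, ← Finset.sum_sub_distrib]
  exact I.sum_mem h3

theorem mul_homogeneous {p : MvPolynomial σ ℂ} {e : ℕ} (h : LiftsMod I L d F)
    (hp : p.IsHomogeneous e) : LiftsMod I L (d + e) (p * F) := by
  obtain ⟨G', h1, h2, h3⟩ := h
  refine ⟨p * G', ?_, fun hd => by rw [h2 (by omega), mul_zero], ?_⟩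
  · rcases Nat.eq_zero_or_pos d with rfl | hd
    · rw [h2 rfl, mul_zero]; exact isHomogeneous_zero _ _ _
    · rw [show d + e - 1 = e + (d - 1) by omega]
      exact hp.mul h1
  · rw [show p * F - L * (p * G') = p * (F - L * G') by ring]
    exact I.mul_mem_left p h3

theorem of_le (h : ∀ F : MvPolynomial σ ℂ, F.IsHomogeneous d → LiftsMod I L d F) {e : ℕ}
    (hde : d ≤ e) (hF : F.IsHomogeneous e) : LiftsMod I L e F := by
  induction e, hde using Nat.le_induction generalizing F with
  | base => exact h F hF
  | succ e _ ih =>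
    rw [F.as_sum]
    refine sum fun s hs => ?_
    have hdeg : s.degree = e + 1 := by
      by_contra hne
      exact mem_support_iff.mp hs (hF.coeff_eq_zero hne)
    obtain ⟨i, hi⟩ : ∃ i, s i ≠ 0 := by
      by_contra! hc
      rw [show s = 0 from Finsupp.ext hc] at hdeg
      simp at hdeg
    have hle : Finsupp.single i 1 ≤ s := by
      simpa using Nat.one_le_iff_ne_zero.mpr hi
    have hs' : Finsupp.single i 1 + (s - Finsupp.single i 1) = s := add_tsub_cancel_of_le hle
    have hdeg' : (s - Finsupp.single i 1).degree = e := by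
      have := congrArg Finsupp.degree hs'
      rw [map_add, Finsupp.degree_single, hdeg] at this
      omega
    have := (ih (isHomogeneous_monomial (coeff s F) hdeg')).mul_homogeneous
      (isHomogeneous_X ℂ i)
    rwa [X, monomial_mul, hs', one_mul] at this

end LiftsMod

/-- The `v`-th submaximal Pfaffian of a matrix of odd size. -/
noncomputable def oddPfaff {σ : Type*} {n : ℕ}
    (G : Matrix (Fin (2 * n + 1)) (Fin (2 * n + 1)) (MvPolynomial σ ℂ)) (v : Fin (2 * n + 1)) :
    MvPolynomial σ ℂ :=
  pfaff (G.submatrix v.succAbove v.succAbove)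

theorem exists_oddPfaff_isHomogeneous {σ : Type*} {n : ℕ} (a : ℕ → ℕ)
    (hpar : ∀ i j, Even (a i + a j)) (v : Fin (2 * n + 1)) :
    ∃ D, ∀ G : Matrix (Fin (2 * n + 1)) (Fin (2 * n + 1)) (MvPolynomial σ ℂ),
      (∀ i j, (G i j).IsHomogeneous ((a i + a j) / 2)) → (oddPfaff G v).IsHomogeneous D :=
  ⟨_, fun G hG => pfaff_isHomogeneous (M := G.submatrix v.succAbove v.succAbove)
    (B := Matrix.of fun i j => (a (v.succAbove i) + a (v.succAbove j)) / 2)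
    (fun i j => hG _ _) fun i j => by
      have := hpar (v.succAbove i) (v.succAbove j)
      rw [Nat.even_iff] at this
      simp only [Matrix.of_apply]
      omega⟩

/-- Each monomial of large degree is in the ideal generated by the last variable and the
submaximal Pfaffians of the chain matrix, in a way that makes sense degree-wise. -/
theorem exists_monomial_eq {n d : ℕ} (a : ℕ → ℕ) (hpar : ∀ i j, Even (a i + a j))
    (h : ∑ x ∈ Finset.range (2 * n + 1), a x ≤ 2 * d + 2) (s : Fin 3 →₀ ℕ) (hs : s.degree = d) :
    ∃ (H : MvPolynomial (Fin 3) ℂ) (c : Fin (2 * n + 1) → MvPolynomial (Fin 3) ℂ),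
      H.IsHomogeneous (d - 1) ∧ (d = 0 → H = 0) ∧
      (∀ G : Matrix (Fin (2 * n + 1)) (Fin (2 * n + 1)) (MvPolynomial (Fin 3) ℂ),
        (∀ i j, (G i j).IsHomogeneous ((a i + a j) / 2)) →
          (∑ v, oddPfaff G v * c v).IsHomogeneous d) ∧
      X 2 * H + ∑ v, oddPfaff (chainMatrix (2 * n + 1) a) v * c v = monomial s 1 := by
  have hmon : (monomial s 1 : MvPolynomial (Fin 3) ℂ) = X 0 ^ s 0 * X 1 ^ s 1 * X 2 ^ s 2 := by
    rw [monomial_eq, Finsupp.prod_fintype _ _ (by simp), Fin.prod_univ_three]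
    simp
  have hdeg : s 0 + s 1 + s 2 = d := by
    rw [← hs, Finsupp.degree_eq_sum, Fin.sum_univ_three]
  have hXY (i j : ℕ) : (X 0 ^ i * X 1 ^ j : MvPolynomial (Fin 3) ℂ).IsHomogeneous (i + j) :=
    (isHomogeneous_X_pow 0 i).mul (isHomogeneous_X_pow 1 j)
  rcases Nat.eq_zero_or_pos (s 2) with h2 | h2
  · obtain ⟨v, hv, hX, hY⟩ := exists_pfaffExp_le a hpar n (s 0) (s 1) (by omega)
    lift v to Fin (2 * n + 1) using by omega
    obtain ⟨r, hr, hpf⟩ := pfaff_chainMatrix a v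
    rw [Fin.sum_univ_eq_sum_range (pfaffExpX a v), Fin.sum_univ_eq_sum_range (pfaffExpY a v)] at hpf
    set x := ∑ i ∈ Finset.range n, pfaffExpX a v i
    set y := ∑ i ∈ Finset.range n, pfaffExpY a v i
    set q : MvPolynomial (Fin 3) ℂ := C r⁻¹ * (X 0 ^ (s 0 - x) * X 1 ^ (s 1 - y))
    have hsum (f : Fin (2 * n + 1) → MvPolynomial (Fin 3) ℂ) :
        ∑ w, f w * (Pi.single v q : Fin (2 * n + 1) → MvPolynomial (Fin 3) ℂ) w = f v * q := by
      simp [Pi.single_apply]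
    refine ⟨0, Pi.single v q, isHomogeneous_zero _ _ _, fun _ => rfl, fun G hG => ?_, ?_⟩
    · rw [hsum]
      obtain ⟨D, hD⟩ := exists_oddPfaff_isHomogeneous (σ := Fin 3) a hpar v
      have h1 := hD _ (chainMatrix_isHomogeneous a)
      have h0 : oddPfaff (chainMatrix (2 * n + 1) a) v ≠ 0 := by
        rw [oddPfaff, hpf]
        exact smul_ne_zero hr (mul_ne_zero (pow_ne_zero _ (X_ne_zero _))
          (pow_ne_zero _ (X_ne_zero _)))
      have h3 : (oddPfaff (chainMatrix (2 * n + 1) a) v).IsHomogeneous (x + y) := by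
        rw [oddPfaff, hpf, smul_eq_C_mul]
        exact (hXY x y).C_mul r
      have hDxy := h1.inj_right h3 h0
      have h4 := (hD G hG).mul ((hXY (s 0 - x) (s 1 - y)).C_mul r⁻¹)
      rwa [show D + (s 0 - x + (s 1 - y)) = d by omega] at h4
    · rw [hsum, oddPfaff, hpf, hmon, h2, mul_zero, zero_add, smul_eq_C_mul]
      have hC : (C r : MvPolynomial (Fin 3) ℂ) * C r⁻¹ = 1 := by
        rw [← C_mul, mul_inv_cancel₀ hr, C_1]
      calc C r * (X 0 ^ x * X 1 ^ y) * q
          = (C r * C r⁻¹) * ((X 0 ^ x * X 0 ^ (s 0 - x)) * (X 1 ^ y * X 1 ^ (s 1 - y))) := by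
            simp only [q]; ring
        _ = _ := by
            rw [hC, ← pow_add, ← pow_add, Nat.add_sub_cancel' hX, Nat.add_sub_cancel' hY]; ring
  · refine ⟨X 0 ^ s 0 * X 1 ^ s 1 * X 2 ^ (s 2 - 1), 0, ?_, by omega, fun G _ => ?_, ?_⟩
    · rw [show d - 1 = s 0 + s 1 + (s 2 - 1) by omega]
      exact (hXY _ _).mul (isHomogeneous_X_pow 2 _)
    · simpa using isHomogeneous_zero _ _ _
    · obtain ⟨m, hm⟩ : ∃ m, s 2 = m + 1 := ⟨s 2 - 1, by omega⟩
      rw [hmon, hm]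
      simp
      ring

/-- Let `G` be a general skew-symmetric matrix of forms in three
variables, of odd size `(2k-1) × (2k-1)`, whose degree matrix `A` is non-negative,
symmetric and homogeneous, and let `I` be the ideal generated by the submaximal
Pfaffians of `G`. Then multiplication by a general linear form `L` gives a surjection
`(R'/I)_{d-1} → (R'/I)_d` for all `d ≥ tr(A)/2 - 1`. Genericity (for `G` and then
for `L`) is expressed by nonzero polynomials in the coefficients, cutting out nonempty
Zariski-open subsets of the parameter spaces. -/
theorem mult_by_general_linear_form_surjective_modulo_odd_pfaffian_ideal_three_vars
    (k : ℕ) (hk : 0 < k)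
    (A : Matrix (Fin (2*k-1)) (Fin (2*k-1)) ℕ) (hsym : A.IsSymm) (hhom : HomogMat A) :
    ∃ P : MvPolynomial (Fin (2*k-1) × Fin (2*k-1) × ((Fin 3) →₀ ℕ)) ℂ, P ≠ 0 ∧
      (∃ G : Matrix (Fin (2*k-1)) (Fin (2*k-1)) (MvPolynomial (Fin 3) ℂ),
        IsSkew G ∧ DegMat G A ∧
        MvPolynomial.eval (fun x => MvPolynomial.coeff x.2.2 (G x.1 x.2.1)) P ≠ 0) ∧
      ∀ G : Matrix (Fin (2*k-1)) (Fin (2*k-1)) (MvPolynomial (Fin 3) ℂ),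
        IsSkew G → DegMat G A →
        MvPolynomial.eval (fun x => MvPolynomial.coeff x.2.2 (G x.1 x.2.1)) P ≠ 0 →
        ∃ Q : MvPolynomial ((Fin 3) →₀ ℕ) ℂ, Q ≠ 0 ∧
          (∃ L : MvPolynomial (Fin 3) ℂ, L.IsHomogeneous 1 ∧
            MvPolynomial.eval (fun m => MvPolynomial.coeff m L) Q ≠ 0) ∧
          ∀ L : MvPolynomial (Fin 3) ℂ, L.IsHomogeneous 1 →
            MvPolynomial.eval (fun m => MvPolynomial.coeff m L) Q ≠ 0 →
            ∀ d : ℕ, Matrix.trace A ≤ 2 * d + 2 →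
              ∀ F : MvPolynomial (Fin 3) ℂ, F.IsHomogeneous d →
                ∃ G' : MvPolynomial (Fin 3) ℂ, G'.IsHomogeneous (d - 1) ∧
                  F - L * G' ∈ Ideal.span (submaxPfOdd G) := by
  obtain ⟨n, rfl⟩ : ∃ n, k = n + 1 := ⟨k - 1, by omega⟩
  change Matrix (Fin (2 * n + 1)) (Fin (2 * n + 1)) ℕ at A
  have hA : ∀ i j : Fin (2 * n + 1), 2 * A i j = A i i + A j j := fun i j => by
    have h1 := hhom i j j i
    have h2 : A j i = A i j := hsym.apply i j
    omega
  set a : ℕ → ℕ := fun x => if h : x < 2 * n + 1 then A ⟨x, h⟩ ⟨x, h⟩ else A 0 0 with ha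
  have hpar : ∀ i j, Even (a i + a j) := fun i j => by
    simp only [ha]
    split_ifs <;> rw [← hA] <;> exact even_two_mul _
  have haA : ∀ i j : Fin (2 * n + 1), (a i + a j) / 2 = A i j := fun i j => by
    have := hA i j
    simp only [ha, i.2, j.2, dif_pos, Fin.eta]
    omega
  have htr : ∑ x ∈ Finset.range (2 * n + 1), a x = Matrix.trace A := by
    rw [← Fin.sum_univ_eq_sum_range]
    exact Finset.sum_congr rfl fun i _ => by simp only [ha, i.2, dif_pos, Fin.eta, Matrix.diag_apply]
  set d₀ := (Matrix.trace A - 1) / 2 with hd₀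
  choose H c hH hH0 hc hHc using fun s : (Finset.univ : Finset (Fin 3)).finsuppAntidiag d₀ =>
    exists_monomial_eq (n := n) (d := d₀) a hpar (by rw [htr]; omega) s.1
      (by rw [Finsupp.degree_eq_sum]; exact (Finset.mem_finsuppAntidiag.mp s.2).1)
  have hpoly : ∀ {α τ : Type} {κ : α → τ → ℂ} {L : α → MvPolynomial (Fin 3) ℂ}
      {G : α → Matrix (Fin (2 * n + 1)) (Fin (2 * n + 1)) (MvPolynomial (Fin 3) ℂ)},
      PolyCoeffs κ L → (∀ i j, PolyCoeffs κ fun x => G x i j) →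
      ∃ p : MvPolynomial τ ℂ, ∀ x, eval (κ x) p =
        (Matrix.of fun i j : (Finset.univ : Finset (Fin 3)).finsuppAntidiag d₀ =>
          coeff j.1 (L x * H i + ∑ v, oddPfaff (G x) v * c i v)).det :=
    fun {α τ κ L G} hL hG => PolyCoeffs.exists_det_eq
      (g := fun i x => L x * H i + ∑ v, oddPfaff (G x) v * c i v)
      (fun i => (hL.mul (.const _)).add (.sum fun v _ =>
        (PolyCoeffs.pfaff fun _ _ => hG _ _).mul (.const _))) (fun j => j.1)
  obtain ⟨P, hP⟩ := hpoly
    (κ := fun (G : Matrix (Fin (2 * n + 1)) (Fin (2 * n + 1)) (MvPolynomial (Fin 3) ℂ))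
      (x : Fin (2 * n + 1) × Fin (2 * n + 1) × (Fin 3 →₀ ℕ)) => coeff x.2.2 (G x.1 x.2.1))
    (L := fun _ => X 2) (G := id) (.const _)
    (fun i j s => coord_mem_coordSubalgebra _ (i, j, s))
  have hP0 : eval (fun x : Fin (2 * n + 1) × Fin (2 * n + 1) × (Fin 3 →₀ ℕ) =>
      coeff x.2.2 (chainMatrix (2 * n + 1) a x.1 x.2.1)) P ≠ 0 := by
    rw [hP (chainMatrix (2 * n + 1) a)]
    have h1 : (Matrix.of fun i j : (Finset.univ : Finset (Fin 3)).finsuppAntidiag d₀ =>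
        coeff j.1 (X 2 * H i + ∑ v, oddPfaff (id (chainMatrix (2 * n + 1) a)) v * c i v)) = 1 := by
      ext i j
      rw [Matrix.of_apply, id, hHc, coeff_monomial, Matrix.one_apply]
      exact if_congr Subtype.ext_iff.symm rfl rfl
    rw [h1, Matrix.det_one]
    exact one_ne_zero
  refine ⟨P, fun h => hP0 (by rw [h, map_zero]), ⟨chainMatrix (2 * n + 1) a,
    chainMatrix_isSkew _ a, fun i j => ?_, hP0⟩, fun G _ hdeg hG => ?_⟩
  · rw [← haA i j]
    exact chainMatrix_isHomogeneous a i j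
  change Matrix (Fin (2 * n + 1)) (Fin (2 * n + 1)) (MvPolynomial (Fin 3) ℂ) at G
  have hGhom : ∀ i j : Fin (2 * n + 1), (G i j).IsHomogeneous ((a i + a j) / 2) := fun i j => by
    rw [haA]
    exact hdeg i j
  obtain ⟨Q, hQ⟩ := hpoly
    (κ := fun (L : MvPolynomial (Fin 3) ℂ) (m : Fin 3 →₀ ℕ) => coeff m L)
    (L := id) (G := fun _ => G) (fun s => coord_mem_coordSubalgebra _ s) (fun _ _ => .const _)
  have hQ0 : eval (fun m => coeff m (X 2 : MvPolynomial (Fin 3) ℂ)) Q ≠ 0 := by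
    rw [hQ (X 2)]
    exact fun h => hG ((hP G).trans h)
  refine ⟨Q, fun h => hQ0 (by rw [h, map_zero]), ⟨X 2, isHomogeneous_X _ _, hQ0⟩,
    fun L hL hLQ d hd F hF => ?_⟩
  rw [hQ L] at hLQ
  have hbase : ∀ F : MvPolynomial (Fin 3) ℂ, F.IsHomogeneous d₀ →
      LiftsMod (Ideal.span (submaxPfOdd (k := n + 1) G)) L d₀ F := by
    intro F hF
    obtain ⟨x, rfl⟩ := exists_eq_sum_smul_of_det_ne_zero _ (fun i => by
      refine IsHomogeneous.add ?_ (hc i G hGhom)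
      rcases Nat.eq_zero_or_pos d₀ with h | h
      · simpa [hH0 i h] using isHomogeneous_zero _ _ _
      · have := hL.mul (hH i)
        rwa [show 1 + (d₀ - 1) = d₀ by omega] at this) hLQ hF
    refine LiftsMod.sum fun i _ => ⟨x i • H i, ?_, fun h => by rw [hH0 i h, smul_zero], ?_⟩
    · rw [smul_eq_C_mul]
      exact (hH i).C_mul _
    · rw [id, smul_add, mul_smul_comm, add_sub_cancel_left, smul_eq_C_mul]
      refine Ideal.mul_mem_left _ _ (Ideal.sum_mem _ fun v _ => Ideal.mul_mem_right _ _ ?_)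
      exact Ideal.subset_span ⟨v.succAboveOrderEmb, rfl⟩
  obtain ⟨G', h1, -, h3⟩ := LiftsMod.of_le hbase (show d₀ ≤ d by
    have : Matrix.trace A ≤ 2 * d + 2 := hd
    omega) hF
  exact ⟨G', h1, h3⟩
end

section
/- Let A = (a_{ij}) be a non-negative, ordered, symmetric, homogeneous integer matrix of odd size (2k−1)×(2k−1), with k > 1. For a general choice of k skew-symmetric matrices G_1, …, G_k of homogeneous forms in three variables over ℂ, each with degree matrix A, the submaximal Pfaffians of all the G_i generate an ideal I of R' = ℂ[x,y,z] which coincides with R' in every degree d ≥ (a_{11} + tr(A))/2. -/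
open MvPolynomial

section PairingSum

variable {ι κ S : Type*} [Fintype ι] [DecidableEq ι] [Fintype κ] [DecidableEq κ] [CommRing S]

/-- The signed contribution of a permutation to the unnormalised Pfaffian of a matrix whose
index set is organised in pairs. -/
def pairingTerm (N : Matrix (ι × Fin 2) (ι × Fin 2) S) (s : Equiv.Perm (ι × Fin 2)) : S :=
  ((Equiv.Perm.sign s : ℤ) : S) * ∏ i, N (s (i, 0)) (s (i, 1))

/-- The unnormalised Pfaffian of a matrix whose index set is organised in pairs. -/
def pairingSum (N : Matrix (ι × Fin 2) (ι × Fin 2) S) : S :=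
  ∑ s, pairingTerm N s

lemma pairingSum_submatrix_perm (N : Matrix (ι × Fin 2) (ι × Fin 2) S)
    (t : Equiv.Perm (ι × Fin 2)) :
    pairingSum (N.submatrix t t) = ((Equiv.Perm.sign t : ℤ) : S) * pairingSum N := by
  unfold pairingSum
  rw [← Equiv.sum_comp (Equiv.mulLeft t) (pairingTerm N), Finset.mul_sum]
  refine Finset.sum_congr rfl fun s _ => ?_
  simp only [pairingTerm, Matrix.submatrix_apply, Equiv.coe_mulLeft, Equiv.Perm.coe_mul,
    Function.comp, Equiv.Perm.sign_mul, Units.val_mul, Int.cast_mul]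
  have h : ((Equiv.Perm.sign t : ℤ) : S) * ((Equiv.Perm.sign t : ℤ) : S) = 1 := by
    rw [← Int.cast_mul, ← Units.val_mul, Int.units_mul_self]; simp
  linear_combination (-(((Equiv.Perm.sign s : ℤ) : S) * ∏ i, N (t (s (i, 0))) (t (s (i, 1))))) * h

lemma pairingSum_submatrix_prodCongr (N : Matrix (ι × Fin 2) (ι × Fin 2) S) (h : κ ≃ ι) :
    pairingSum (N.submatrix (h.prodCongr (Equiv.refl _)) (h.prodCongr (Equiv.refl _))) =
      pairingSum N := by
  unfold pairingSum
  rw [← Equiv.sum_comp (Equiv.permCongr (h.prodCongr (Equiv.refl (Fin 2)))) (pairingTerm N)]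
  refine Finset.sum_congr rfl fun s _ => ?_
  simp only [pairingTerm, Matrix.submatrix_apply, Equiv.Perm.sign_permCongr]
  congr 1
  refine Fintype.prod_equiv h _ _ fun i => ?_
  simp [Equiv.permCongr_apply]

lemma pairingSum_submatrix_equiv (N : Matrix (ι × Fin 2) (ι × Fin 2) S) (h : κ ≃ ι)
    (t : κ × Fin 2 ≃ ι × Fin 2) :
    ∃ u : ℤˣ, pairingSum (N.submatrix t t) = ((u : ℤ) : S) * pairingSum N := by
  refine ⟨Equiv.Perm.sign ((h.prodCongr (Equiv.refl (Fin 2))).symm.trans t), ?_⟩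
  rw [← pairingSum_submatrix_perm, ← pairingSum_submatrix_prodCongr _ h, Matrix.submatrix_submatrix]
  have hx : ∀ x, t x = t (h.prodCongr (Equiv.refl (Fin 2)) |>.symm
      (h.prodCongr (Equiv.refl (Fin 2)) x)) := fun x => by rw [Equiv.symm_apply_apply]
  congr 1
  ext x y
  rw [Matrix.submatrix_apply, Matrix.submatrix_apply, hx x, hx y]
  rfl

lemma pairingTerm_mul_blockPerm (N : Matrix (ι × Fin 2) (ι × Fin 2) S)
    (s : Equiv.Perm (ι × Fin 2)) (b : Equiv.Perm ι) :
    pairingTerm N (s * Equiv.prodCongrLeft fun _ => b) = pairingTerm N s := by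
  unfold pairingTerm
  rw [Equiv.Perm.sign_mul, Equiv.Perm.sign_prodCongrLeft]
  simp only [Fin.prod_univ_two, Int.units_mul_self, mul_one, Equiv.Perm.coe_mul, Function.comp]
  congr 1
  exact Equiv.prod_comp b (fun i => N (s (i, 0)) (s (i, 1)))

lemma pairingTerm_mul_swap (N : Matrix (ι × Fin 2) (ι × Fin 2) S) (hN : IsSkew N)
    (s : Equiv.Perm (ι × Fin 2)) (j : ι) :
    pairingTerm N (s * Equiv.swap (j, 0) (j, 1)) = pairingTerm N s := by
  unfold pairingTerm
  rw [Equiv.Perm.sign_mul, Equiv.Perm.sign_swap (by simp),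
    ← Finset.mul_prod_erase Finset.univ _ (Finset.mem_univ j),
    ← Finset.mul_prod_erase Finset.univ (fun i => N (s (i, 0)) (s (i, 1))) (Finset.mem_univ j)]
  have h : ∏ x ∈ Finset.univ.erase j,
      N ((s * Equiv.swap (j, (0 : Fin 2)) (j, 1) : Equiv.Perm _) (x, 0))
      ((s * Equiv.swap (j, (0 : Fin 2)) (j, 1) : Equiv.Perm _) (x, 1)) =
      ∏ x ∈ Finset.univ.erase j, N (s (x, 0)) (s (x, 1)) := by
    refine Finset.prod_congr rfl fun x hx => ?_
    have hx' : x ≠ j := (Finset.mem_erase.1 hx).1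
    simp only [Equiv.Perm.coe_mul, Function.comp]
    rw [Equiv.swap_apply_of_ne_of_ne (by simp [hx']) (by simp [hx']),
      Equiv.swap_apply_of_ne_of_ne (by simp [hx']) (by simp [hx'])]
  rw [h]
  simp [hN (s (j, 0)) (s (j, 1))]

lemma sum_pairingTerm_fiber (N : Matrix (ι × Fin 2) (ι × Fin 2) S) (hN : IsSkew N)
    (j : ι) (x : ι × Fin 2) :
    ∑ s with s x = (j, 1), pairingTerm N s = ∑ s with s (j, 1) = (j, 1), pairingTerm N s := by
  obtain ⟨r, hr, hterm⟩ : ∃ r : Equiv.Perm (ι × Fin 2), r x = (j, 1) ∧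
      ∀ s, pairingTerm N (s * r) = pairingTerm N s := by
    obtain ⟨i, c⟩ := x
    fin_cases c
    · refine ⟨Equiv.swap (j, 0) (j, 1) * Equiv.prodCongrLeft fun _ => Equiv.swap i j, ?_,
        fun s => ?_⟩
      · simp
      · rw [← mul_assoc, pairingTerm_mul_blockPerm, pairingTerm_mul_swap N hN]
    · exact ⟨Equiv.prodCongrLeft fun _ => Equiv.swap i j, by simp,
        fun s => pairingTerm_mul_blockPerm N s _⟩
  symm
  refine Finset.sum_nbij' (fun s => s * r) (fun s => s * r⁻¹) ?_ ?_ ?_ ?_ ?_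
  · intro s hs
    simpa [hr] using hs
  · intro s hs
    have h : r.symm (j, 1) = x := by rw [← hr]; simp
    simpa [h] using hs
  · intro s _; simp
  · intro s _; simp
  · intro s _; exact (hterm s).symm

lemma pairingSum_eq_card_mul (N : Matrix (ι × Fin 2) (ι × Fin 2) S) (hN : IsSkew N) (j : ι) :
    pairingSum N = (2 * Fintype.card ι : ℕ) * ∑ s with s (j, 1) = (j, 1), pairingTerm N s := by
  have h : pairingSum N = ∑ x : ι × Fin 2, ∑ s with s x = (j, 1), pairingTerm N s := by
    unfold pairingSum
    simp only [Finset.sum_filter]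
    rw [Finset.sum_comm]
    refine Finset.sum_congr rfl fun s _ => ?_
    rw [Finset.sum_eq_single (s⁻¹ (j, 1))]
    · simp
    · intro x _ hx
      rw [if_neg]
      rintro h
      exact hx (by rw [← h]; simp)
    · simp
  rw [h, Finset.sum_congr rfl fun x _ => sum_pairingTerm_fiber N hN j x]
  simp [mul_comm]

/-- The index `(none, 1)` can only be paired with `(none, 0)`, because every other partner
would leave `(none, 0)` without a partner. -/
def PairForced (N : Matrix (Option ι × Fin 2) (Option ι × Fin 2) S) : Prop :=
  ∀ i l, i ≠ (none, 0) → l ≠ i → l ≠ (none, 1) → N i (none, 1) = 0 ∨ N (none, 0) l = 0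

lemma pairingTerm_eq_zero (N : Matrix (Option ι × Fin 2) (Option ι × Fin 2) S) (hN : IsSkew N)
    (h : PairForced N) (s : Equiv.Perm (Option ι × Fin 2)) (hs : s (none, 1) = (none, 1))
    (hs' : s (none, 0) ≠ (none, 0)) : pairingTerm N s = 0 := by
  unfold pairingTerm
  obtain ⟨⟨j, c⟩, hjc⟩ := s.surjective (none, 0)
  have hj : j ≠ none := by
    rintro rfl
    fin_cases c
    · exact hs' hjc
    · simp [hs] at hjc
  suffices hz : N (s (none, 0)) (none, 1) = 0 ∨ N (s (j, 0)) (s (j, 1)) = 0 by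
    rcases hz with hz | hz
    · rw [Finset.prod_eq_zero (Finset.mem_univ none) (by rw [hs, hz]), mul_zero]
    · rw [Finset.prod_eq_zero (Finset.mem_univ j) hz, mul_zero]
  have hne : ∀ c d, s (j, c) ≠ s (none, d) := fun c d e =>
    hj (by simpa using congrArg Prod.fst (s.injective e))
  fin_cases c
  · have := h (s (none, 0)) (s (j, 1)) hs' (hne _ _) (hs ▸ hne _ _)
    simp only [Fin.zero_eta] at hjc
    rwa [hjc]
  · have := h (s (none, 0)) (s (j, 0)) hs' (hne _ _) (hs ▸ hne _ _)
    simp only [Fin.mk_one] at hjc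
    rw [hN (s (j, 1)) (s (j, 0)), hjc, neg_eq_zero]
    exact this

lemma pairingSum_option (N : Matrix (Option ι × Fin 2) (Option ι × Fin 2) S) (hN : IsSkew N)
    (h : PairForced N) :
    pairingSum N = (2 * (Fintype.card ι + 1) : ℕ) * (N (none, 0) (none, 1) *
      pairingSum (N.submatrix (Prod.map some id) (Prod.map some id))) := by
  rw [pairingSum_eq_card_mul N hN none, Fintype.card_option]
  congr 1
  let p : Option ι × Fin 2 → Prop := fun x => x.1 ≠ none
  let e : ι × Fin 2 ≃ {x : Option ι × Fin 2 // p x} :=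
    { toFun := fun x => ⟨(some x.1, x.2), by simp [p]⟩
      invFun := fun x => (x.1.1.get (Option.ne_none_iff_isSome.1 x.2), x.1.2)
      left_inv := fun x => by simp
      right_inv := fun x => by ext <;> simp }
  have he : ∀ (t : Equiv.Perm (ι × Fin 2)) (i : ι) (c : Fin 2),
      Equiv.Perm.ofSubtype (e.permCongr t) (some i, c) = Prod.map some id (t (i, c)) := by
    intro t i c
    rw [Equiv.Perm.ofSubtype_apply_of_mem _ (show p (some i, c) by simp [p])]
    rfl
  have he' : ∀ (t : Equiv.Perm (ι × Fin 2)) (c : Fin 2),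
      Equiv.Perm.ofSubtype (e.permCongr t) (none, c) = (none, c) := fun t c =>
    Equiv.Perm.ofSubtype_apply_of_not_mem _ (by simp [p])
  have hterm : ∀ t : Equiv.Perm (ι × Fin 2),
      pairingTerm N (Equiv.Perm.ofSubtype (e.permCongr t)) = N (none, 0) (none, 1) *
        pairingTerm (N.submatrix (Prod.map some id) (Prod.map some id)) t := by
    intro t
    unfold pairingTerm
    rw [Equiv.Perm.sign_ofSubtype, Equiv.Perm.sign_permCongr, Fintype.prod_option]
    simp only [he, he', Matrix.submatrix_apply]
    ring
  rw [pairingSum, Finset.mul_sum, ← Finset.sum_congr rfl fun t _ => hterm t,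
    ← Finset.sum_filter_add_sum_filter_not _ (fun s => s (none, 0) = (none, 0))]
  rw [add_eq_left.2]
  · symm
    refine Finset.sum_bij (fun t _ => Equiv.Perm.ofSubtype (e.permCongr t)) ?_ ?_ ?_ ?_
    · intro t _
      simp [he']
    · intro t _ t' _ htt
      exact e.permCongr.injective (Equiv.Perm.ofSubtype_injective htt)
    · intro s hs
      simp only [Finset.mem_filter, Finset.mem_univ, true_and] at hs
      have hfix : ∀ x, ¬ p x → s x = x := by
        rintro ⟨j, c⟩ hj
        obtain rfl : j = none := by simpa [p] using hj
        fin_cases c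
        · exact hs.2
        · exact hs.1
      refine ⟨e.permCongr.symm ((Equiv.Perm.subtypeEquivSubtypePerm p).symm ⟨s, hfix⟩),
        Finset.mem_univ _, ?_⟩
      rw [Equiv.apply_symm_apply]
      exact congrArg Subtype.val
        ((Equiv.Perm.subtypeEquivSubtypePerm p).apply_symm_apply ⟨s, hfix⟩)
    · intro t _
      rfl
  · refine Finset.sum_eq_zero fun s hs => ?_
    simp only [Finset.mem_filter, Finset.mem_univ, true_and] at hs
    exact pairingTerm_eq_zero N hN h s hs.1 hs.2

end PairingSum

section Pfaffian

variable {σ : Type*}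

/-- Consecutive indices of a `2n × 2n` matrix, grouped in pairs. -/
def pairEquiv (n : ℕ) : Fin n × Fin 2 ≃ Fin (2 * n) where
  toFun x := ⟨2 * x.1 + x.2, by omega⟩
  invFun i := (⟨i / 2, by omega⟩, ⟨i % 2, by omega⟩)
  left_inv x := by ext <;> simp <;> omega
  right_inv i := by ext; simp; omega

lemma pfaff_eq_pairingSum {n : ℕ} (M : Matrix (Fin (2 * n)) (Fin (2 * n)) (MvPolynomial σ ℂ)) :
    pfaff M = (((2 ^ n * n.factorial : ℕ) : ℂ)⁻¹) •
      pairingSum (M.submatrix (pairEquiv n) (pairEquiv n)) := by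
  unfold pfaff pairingSum
  congr 1
  rw [← Equiv.sum_comp (pairEquiv n).permCongr]
  refine Finset.sum_congr rfl fun s _ => ?_
  rw [pairingTerm, Equiv.Perm.sign_permCongr, zsmul_eq_mul]
  congr 1
  refine Finset.prod_congr rfl fun i _ => ?_
  rw [Matrix.submatrix_apply, Equiv.permCongr_apply, Equiv.permCongr_apply]
  congr 3
  · rw [Equiv.symm_apply_eq]; rfl
  · rw [Equiv.symm_apply_eq]; rfl

lemma pfaff_of_isEmpty (M : Matrix (Fin (2 * 0)) (Fin (2 * 0)) (MvPolynomial σ ℂ)) :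
    pfaff M = 1 := by
  have h : Subsingleton (Equiv.Perm (Fin (2 * 0))) := by simp only [mul_zero]; infer_instance
  rw [pfaff, Fintype.sum_subsingleton _ (1 : Equiv.Perm (Fin (2 * 0)))]
  simp

lemma IsSkew.submatrix {m l R : Type*} [Ring R] {M : Matrix m m R} (h : IsSkew M) (e : l → m) :
    IsSkew (M.submatrix e e) := fun i j => h (e i) (e j)

/-- If the index `b` can only be paired with `a`, the Pfaffian splits off the entry `(a, b)`. -/
lemma pfaff_split {n : ℕ}
    (N : Matrix (Fin (2 * (n + 1))) (Fin (2 * (n + 1))) (MvPolynomial σ ℂ)) (hN : IsSkew N)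
    (j : Fin (2 * n) → Fin (2 * (n + 1))) (a b : Fin (2 * (n + 1)))
    (hj : Function.Injective j) (hab : a ≠ b) (hja : ∀ i, j i ≠ a) (hjb : ∀ i, j i ≠ b)
    (h : ∀ i l, i ≠ a → l ≠ i → l ≠ b → N i b = 0 ∨ N a l = 0) :
    ∃ u : ℤˣ, pfaff N = (u : ℤ) • (N a b * pfaff (N.submatrix j j)) := by
  let f : Option (Fin n) × Fin 2 → Fin (2 * (n + 1)) := fun x =>
    x.1.elim (![a, b] x.2) fun i => j (pairEquiv n (i, x.2))
  have f0 : f (none, 0) = a := rfl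
  have f1 : f (none, 1) = b := rfl
  have hf : Function.Injective f := by
    rintro ⟨_ | i, c⟩ ⟨_ | i', c'⟩ hx
    · fin_cases c <;> fin_cases c' <;> simp_all [f]
    · fin_cases c
      · exact absurd hx.symm (hja _)
      · exact absurd hx.symm (hjb _)
    · fin_cases c'
      · exact absurd hx (hja _)
      · exact absurd hx (hjb _)
    · have := (pairEquiv n).injective (hj hx)
      simp_all
  have hcard : Fintype.card (Option (Fin n) × Fin 2) = Fintype.card (Fin (2 * (n + 1))) := by
    simp [mul_comm]
  let t := Equiv.ofBijective f ((Fintype.bijective_iff_injective_and_card f).2 ⟨hf, hcard⟩)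
  have ht : ∀ x, t x = f x := fun _ => rfl
  obtain ⟨u, hu⟩ := pairingSum_submatrix_equiv
    (N.submatrix (pairEquiv (n + 1)) (pairEquiv (n + 1))) (finSuccEquiv n).symm
    (t.trans (pairEquiv (n + 1)).symm)
  have hsub : (N.submatrix (pairEquiv (n + 1)) (pairEquiv (n + 1))).submatrix
      (t.trans (pairEquiv (n + 1)).symm) (t.trans (pairEquiv (n + 1)).symm) = N.submatrix f f := by
    ext1 x y
    simp [ht]
  have hforced : PairForced (N.submatrix f f) := by
    intro x y hx hy hy'
    refine h (f x) (f y) ?_ (hf.ne hy) ?_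
    · rw [← f0]; exact hf.ne hx
    · rw [← f1]; exact hf.ne hy'
  rw [hsub, pairingSum_option _ (hN.submatrix f) hforced] at hu
  have hrest : (N.submatrix f f).submatrix (Prod.map some id) (Prod.map some id) =
      (N.submatrix j j).submatrix (pairEquiv n) (pairEquiv n) := rfl
  rw [hrest, Matrix.submatrix_apply, f0, f1, Fintype.card_fin] at hu
  refine ⟨u, ?_⟩
  rw [pfaff_eq_pairingSum, pfaff_eq_pairingSum]
  set B := pairingSum ((N.submatrix j j).submatrix (pairEquiv n) (pairEquiv n))
  set T := pairingSum (N.submatrix (pairEquiv (n + 1)) (pairEquiv (n + 1)))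
  have hT : T = ((u : ℤ) : MvPolynomial σ ℂ) * ((2 * (n + 1) : ℕ) * (N a b * B)) := by
    have huu : ((u : ℤ) : MvPolynomial σ ℂ) * ((u : ℤ) : MvPolynomial σ ℂ) = 1 := by
      rw [← Int.cast_mul, ← Units.val_mul, Int.units_mul_self]; simp
    rw [hu, ← mul_assoc, huu, one_mul]
  have hc : (((2 ^ (n + 1) * (n + 1).factorial : ℕ) : ℂ)⁻¹) * ((2 * (n + 1) : ℕ) : ℂ) =
      ((2 ^ n * n.factorial : ℕ) : ℂ)⁻¹ := by
    have h1 : (n.factorial : ℂ) ≠ 0 := by exact_mod_cast n.factorial_ne_zero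
    have h2 : ((n : ℂ) + 1) ≠ 0 := by exact_mod_cast n.succ_ne_zero
    push_cast [Nat.factorial_succ, pow_succ]
    field_simp
  rw [hT, ← hc, mul_smul, Algebra.smul_def, zsmul_eq_mul, mul_smul_comm, Algebra.smul_def,
    Algebra.smul_def]
  simp only [map_natCast]
  ring

end Pfaffian

section Attach

variable {σ : Type*} {m : ℕ}

lemma associated_of_eq_zsmul {R : Type*} [CommRing R] {a b : R} {u : ℤˣ} (h : a = (u : ℤ) • b) :
    Associated a b := by
  rcases Int.units_eq_one_or u with rfl | rfl
  · exact Associated.of_eq (by simpa using h)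
  · exact (Associated.of_eq (by simpa using h : a = -b)).trans (Associated.refl b).neg_left

/-- The Pfaffian of the matrix obtained by erasing the row and the column of index `v`. -/
noncomputable def subPf (M : Matrix (Fin (2 * m + 1)) (Fin (2 * m + 1)) (MvPolynomial σ ℂ))
    (v : Fin (2 * m + 1)) : MvPolynomial σ ℂ :=
  pfaff (n := m) (M.submatrix v.succAbove v.succAbove)

/-- The ideal generated by the Pfaffians obtained by erasing one index. -/
noncomputable def pfIdeal (M : Matrix (Fin (2 * m + 1)) (Fin (2 * m + 1)) (MvPolynomial σ ℂ)) :
    Ideal (MvPolynomial σ ℂ) :=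
  Ideal.span (Set.range (subPf M))

lemma subPf_mem_pfIdeal (M : Matrix (Fin (2 * m + 1)) (Fin (2 * m + 1)) (MvPolynomial σ ℂ))
    (v : Fin (2 * m + 1)) : subPf M v ∈ pfIdeal M :=
  Ideal.subset_span ⟨v, rfl⟩

/-- The inclusion of the first `2m + 1` indices among `2m + 3` indices. -/
def oldIdx (i : Fin (2 * m + 1)) : Fin (2 * (m + 1) + 1) := ⟨i, by omega⟩

variable (m) in
/-- The last but one of `2m + 3` indices. -/
def penIdx : Fin (2 * (m + 1) + 1) := ⟨2 * m + 1, by omega⟩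

variable (m) in
/-- The last of `2m + 3` indices. -/
def ultIdx : Fin (2 * (m + 1) + 1) := ⟨2 * m + 2, by omega⟩

lemma idx_cases {motive : Fin (2 * (m + 1) + 1) → Prop} (old : ∀ i, motive (oldIdx i))
    (pen : motive (penIdx m)) (ult : motive (ultIdx m)) : ∀ i, motive i := by
  rintro ⟨i, hi⟩
  rcases (by omega : i < 2 * m + 1 ∨ i = 2 * m + 1 ∨ i = 2 * m + 2) with h | rfl | rfl
  · exact old ⟨i, h⟩
  · exact pen
  · exact ult

lemma oldIdx_injective : Function.Injective (oldIdx (m := m)) := fun i j h => by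
  simpa [oldIdx, Fin.ext_iff] using h

/-- Enlarge a skew-symmetric matrix by two indices which are paired with each other (entry `f`)
and with the index `v` (entries `g` and `h`), and with nothing else. -/
def attach {R : Type*} [Ring R] (M : Matrix (Fin (2 * m + 1)) (Fin (2 * m + 1)) R)
    (v : Fin (2 * m + 1)) (f g h : R) :
    Matrix (Fin (2 * (m + 1) + 1)) (Fin (2 * (m + 1) + 1)) R :=
  fun i j =>
    if hi : i.1 < 2 * m + 1 then
      if hj : j.1 < 2 * m + 1 then M ⟨i, hi⟩ ⟨j, hj⟩
      else if i.1 = v.1 then (if j.1 = 2 * m + 1 then g else h) else 0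
    else
      if j.1 < 2 * m + 1 then
        if j.1 = v.1 then (if i.1 = 2 * m + 1 then -g else -h) else 0
      else if i.1 = j.1 then 0 else if i.1 = 2 * m + 1 then f else -f

section Entries

variable {R : Type*} [Ring R] (M : Matrix (Fin (2 * m + 1)) (Fin (2 * m + 1)) R)
  (v : Fin (2 * m + 1)) (f g h : R)

@[simp] lemma attach_old_old (i j : Fin (2 * m + 1)) :
    attach M v f g h (oldIdx i) (oldIdx j) = M i j := by
  have hi : i.1 ≤ 2 * m := by omega
  have hj : j.1 ≤ 2 * m := by omega
  simp [attach, oldIdx, Nat.lt_succ_of_le hi, Nat.lt_succ_of_le hj]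

@[simp] lemma attach_old_pen (i : Fin (2 * m + 1)) :
    attach M v f g h (oldIdx i) (penIdx m) = if i = v then g else 0 := by
  have hi : i.1 ≤ 2 * m := by omega
  simp [attach, oldIdx, penIdx, Fin.ext_iff, hi.not_gt]

@[simp] lemma attach_old_ult (i : Fin (2 * m + 1)) :
    attach M v f g h (oldIdx i) (ultIdx m) = if i = v then h else 0 := by
  have hi : i.1 ≤ 2 * m := by omega
  simp [attach, oldIdx, ultIdx, Fin.ext_iff, hi.not_gt]

@[simp] lemma attach_pen_old (i : Fin (2 * m + 1)) :
    attach M v f g h (penIdx m) (oldIdx i) = if i = v then -g else 0 := by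
  have hi : i.1 ≤ 2 * m := by omega
  simp [attach, oldIdx, penIdx, Fin.ext_iff, hi.not_gt]

@[simp] lemma attach_ult_old (i : Fin (2 * m + 1)) :
    attach M v f g h (ultIdx m) (oldIdx i) = if i = v then -h else 0 := by
  have hi : i.1 ≤ 2 * m := by omega
  simp [attach, oldIdx, ultIdx, Fin.ext_iff, hi.not_gt]

@[simp] lemma attach_pen_pen : attach M v f g h (penIdx m) (penIdx m) = 0 := by
  simp [attach, penIdx]

@[simp] lemma attach_ult_ult : attach M v f g h (ultIdx m) (ultIdx m) = 0 := by
  simp [attach, ultIdx]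

@[simp] lemma attach_pen_ult : attach M v f g h (penIdx m) (ultIdx m) = f := by
  simp [attach, penIdx, ultIdx]

@[simp] lemma attach_ult_pen : attach M v f g h (ultIdx m) (penIdx m) = -f := by
  simp [attach, penIdx, ultIdx]

variable {M v f g h}

lemma IsSkew.attach (hM : IsSkew M) : IsSkew (attach M v f g h) := by
  intro i j
  induction i using idx_cases with
  | old i =>
    induction j using idx_cases with
    | old j => simpa using hM i j
    | pen => by_cases hi : i = v <;> simp [hi]
    | ult => by_cases hi : i = v <;> simp [hi]
  | pen =>
    induction j using idx_cases with
    | old j => by_cases hj : j = v <;> simp [hj]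
    | pen => simp
    | ult => simp
  | ult =>
    induction j using idx_cases with
    | old j => by_cases hj : j = v <;> simp [hj]
    | pen => simp
    | ult => simp

end Entries

lemma DegMat.attach {M : Matrix (Fin (2 * m + 1)) (Fin (2 * m + 1)) (MvPolynomial σ ℂ)}
    {A : Matrix (Fin (2 * (m + 1) + 1)) (Fin (2 * (m + 1) + 1)) ℕ} (hA : A.IsSymm)
    (hM : DegMat M (A.submatrix oldIdx oldIdx)) {v : Fin (2 * m + 1)} {f g h : MvPolynomial σ ℂ}
    (hf : f.IsHomogeneous (A (penIdx m) (ultIdx m)))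
    (hg : g.IsHomogeneous (A (oldIdx v) (penIdx m)))
    (hh : h.IsHomogeneous (A (oldIdx v) (ultIdx m))) :
    DegMat (attach M v f g h) A := by
  have hs : ∀ i j, A i j = A j i := fun i j => hA.apply j i
  intro i j
  induction i using idx_cases with
  | old i =>
    induction j using idx_cases with
    | old j => simpa using hM i j
    | pen =>
      rw [attach_old_pen]
      split_ifs with hi
      · exact hi ▸ hg
      · exact isHomogeneous_zero _ _ _
    | ult =>
      rw [attach_old_ult]
      split_ifs with hi
      · exact hi ▸ hh
      · exact isHomogeneous_zero _ _ _
  | pen =>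
    induction j using idx_cases with
    | old j =>
      rw [attach_pen_old, hs]
      split_ifs with hi
      · exact hi ▸ hg.neg
      · exact isHomogeneous_zero _ _ _
    | pen => rw [attach_pen_pen]; exact isHomogeneous_zero _ _ _
    | ult => rwa [attach_pen_ult]
  | ult =>
    induction j using idx_cases with
    | old j =>
      rw [attach_ult_old, hs]
      split_ifs with hi
      · exact hi ▸ hh.neg
      · exact isHomogeneous_zero _ _ _
    | pen => rw [attach_ult_pen, hs]; exact hf.neg
    | ult => rw [attach_ult_ult]; exact isHomogeneous_zero _ _ _

section Minors

variable {M : Matrix (Fin (2 * m + 1)) (Fin (2 * m + 1)) (MvPolynomial σ ℂ)}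

lemma subPf_attach_old (hM : IsSkew M) (v : Fin (2 * m + 1))
    (f g h : MvPolynomial σ ℂ) (w : Fin (2 * m + 1)) :
    Associated (subPf (attach M v f g h) (oldIdx w)) (f * subPf M w) := by
  have hs : Function.Injective (oldIdx w).succAbove := Fin.succAbove_right_injective
  let j : Fin (2 * m) → Fin (2 * (m + 1)) := fun i => ⟨i, by omega⟩
  let a : Fin (2 * (m + 1)) := ⟨2 * m, by omega⟩
  let b : Fin (2 * (m + 1)) := ⟨2 * m + 1, by omega⟩
  have hsj : ∀ i, (oldIdx w).succAbove (j i) = oldIdx (w.succAbove i) := by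
    intro i
    simp only [j, oldIdx, Fin.succAbove, Fin.lt_def, Fin.ext_iff, Fin.val_castSucc]
    split_ifs <;> simp
  have hsa : (oldIdx w).succAbove a = penIdx m := by
    rw [Fin.succAbove_of_le_castSucc]
    · rfl
    · simp [Fin.le_def, oldIdx, a]; omega
  have hsb : (oldIdx w).succAbove b = ultIdx m := by
    rw [Fin.succAbove_of_le_castSucc]
    · rfl
    · simp [Fin.le_def, oldIdx, b]
  obtain ⟨u, hu⟩ := pfaff_split (n := m)
    ((attach M v f g h).submatrix (oldIdx w).succAbove (oldIdx w).succAbove)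
    (hM.attach.submatrix _) j a b (fun i i' hi => by simpa [j, Fin.ext_iff] using hi)
    (by simp [a, b]) (fun i => by simp only [a, j, ne_eq, Fin.mk.injEq]; omega)
    (fun i => by simp only [b, j, ne_eq, Fin.mk.injEq]; omega)
    (by
      intro i l hi hl hlb
      have hi' := hs.ne hi
      have hl' := hs.ne hl
      have hlb' := hs.ne hlb
      rw [Matrix.submatrix_apply, Matrix.submatrix_apply, hsa, hsb]
      rw [hsa] at hi'
      rw [hsb] at hlb'
      generalize (oldIdx w).succAbove i = x at *
      generalize (oldIdx w).succAbove l = y at *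
      induction x using idx_cases with
      | old x =>
        induction y using idx_cases with
        | old y =>
          have := oldIdx_injective.ne_iff.1 hl'
          by_cases hx : x = v
          · right; rw [attach_pen_old, if_neg (by rintro rfl; exact this hx.symm)]
          · left; rw [attach_old_ult, if_neg hx]
        | pen => right; simp
        | ult => exact absurd rfl hlb'
      | pen => exact absurd rfl hi'
      | ult => left; simp)
  refine associated_of_eq_zsmul (u := u) ?_
  rw [subPf, hu, Matrix.submatrix_apply, hsa, hsb, attach_pen_ult, subPf]
  congr 3
  ext1 x y
  simp [hsj]

lemma subPf_attach_ult (hM : IsSkew M) (v : Fin (2 * m + 1))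
    (f g h : MvPolynomial σ ℂ) :
    Associated (subPf (attach M v f g h) (ultIdx m)) (g * subPf M v) := by
  have hs : Function.Injective (ultIdx m).succAbove := Fin.succAbove_right_injective
  let o : Fin (2 * m + 1) → Fin (2 * (m + 1)) := fun i => ⟨i, by omega⟩
  let b : Fin (2 * (m + 1)) := ⟨2 * m + 1, by omega⟩
  have hso : ∀ i, (ultIdx m).succAbove (o i) = oldIdx i := by
    intro i
    rw [Fin.succAbove_of_castSucc_lt]
    · rfl
    · simp [Fin.lt_def, ultIdx, o]; omega
  have hsb : (ultIdx m).succAbove b = penIdx m := by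
    rw [Fin.succAbove_of_castSucc_lt]
    · rfl
    · simp [Fin.lt_def, ultIdx, b]
  have ho : Function.Injective o := fun i i' hi => by simpa [o, Fin.ext_iff] using hi
  have hob : ∀ i, o i ≠ b := fun i => by simp only [o, b, ne_eq, Fin.mk.injEq]; omega
  obtain ⟨u, hu⟩ := pfaff_split (n := m)
    ((attach M v f g h).submatrix (ultIdx m).succAbove (ultIdx m).succAbove)
    (hM.attach.submatrix _) (o ∘ v.succAbove) (o v) b
    (ho.comp Fin.succAbove_right_injective) (hob v)
    (fun i => ho.ne (Fin.succAbove_ne v i)) (fun i => hob _)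
    (by
      intro i l hi hl hlb
      left
      have hi' := hs.ne hi
      have hq : (ultIdx m).succAbove i ≠ ultIdx m := Fin.succAbove_ne _ _
      rw [Matrix.submatrix_apply, hsb]
      rw [hso] at hi'
      generalize (ultIdx m).succAbove i = x at *
      induction x using idx_cases with
      | old x => rw [attach_old_pen, if_neg (by rintro rfl; exact hi' rfl)]
      | pen => simp
      | ult => exact absurd rfl hq)
  refine associated_of_eq_zsmul (u := u) ?_
  rw [subPf, hu, Matrix.submatrix_apply, hso, hsb, attach_old_pen, if_pos rfl, subPf]
  congr 3
  ext1 x y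
  simp [hso]

lemma subPf_attach_pen (hM : IsSkew M) (v : Fin (2 * m + 1))
    (f g h : MvPolynomial σ ℂ) :
    Associated (subPf (attach M v f g h) (penIdx m)) (h * subPf M v) := by
  have hs : Function.Injective (penIdx m).succAbove := Fin.succAbove_right_injective
  let o : Fin (2 * m + 1) → Fin (2 * (m + 1)) := fun i => ⟨i, by omega⟩
  let b : Fin (2 * (m + 1)) := ⟨2 * m + 1, by omega⟩
  have hso : ∀ i, (penIdx m).succAbove (o i) = oldIdx i := by
    intro i
    rw [Fin.succAbove_of_castSucc_lt]
    · rfl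
    · simp [Fin.lt_def, penIdx, o]; omega
  have hsb : (penIdx m).succAbove b = ultIdx m := by
    rw [Fin.succAbove_of_le_castSucc]
    · rfl
    · simp [penIdx, b]
  have ho : Function.Injective o := fun i i' hi => by simpa [o, Fin.ext_iff] using hi
  have hob : ∀ i, o i ≠ b := fun i => by simp only [o, b, ne_eq, Fin.mk.injEq]; omega
  obtain ⟨u, hu⟩ := pfaff_split (n := m)
    ((attach M v f g h).submatrix (penIdx m).succAbove (penIdx m).succAbove)
    (hM.attach.submatrix _) (o ∘ v.succAbove) (o v) b
    (ho.comp Fin.succAbove_right_injective) (hob v)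
    (fun i => ho.ne (Fin.succAbove_ne v i)) (fun i => hob _)
    (by
      intro i l hi hl hlb
      left
      have hi' := hs.ne hi
      have hq : (penIdx m).succAbove i ≠ penIdx m := Fin.succAbove_ne _ _
      rw [Matrix.submatrix_apply, hsb]
      rw [hso] at hi'
      generalize (penIdx m).succAbove i = x at *
      induction x using idx_cases with
      | old x => rw [attach_old_ult, if_neg (by rintro rfl; exact hi' rfl)]
      | pen => exact absurd rfl hq
      | ult => simp)
  refine associated_of_eq_zsmul (u := u) ?_
  rw [subPf, hu, Matrix.submatrix_apply, hso, hsb, attach_old_ult, if_pos rfl, subPf]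
  congr 3
  ext1 x y
  simp [hso]

lemma mul_subPf_mem_attach_old (hM : IsSkew M) (v : Fin (2 * m + 1))
    (f g h : MvPolynomial σ ℂ) (w : Fin (2 * m + 1)) :
    f * subPf M w ∈ pfIdeal (attach M v f g h) := by
  exact Ideal.mem_of_dvd _ (subPf_attach_old hM v f g h w).dvd (subPf_mem_pfIdeal _ _)

lemma mul_subPf_mem_attach_ult (hM : IsSkew M) (v : Fin (2 * m + 1))
    (f g h : MvPolynomial σ ℂ) : g * subPf M v ∈ pfIdeal (attach M v f g h) := by
  exact Ideal.mem_of_dvd _ (subPf_attach_ult hM v f g h).dvd (subPf_mem_pfIdeal _ _)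

lemma mul_subPf_mem_attach_pen (hM : IsSkew M) (v : Fin (2 * m + 1))
    (f g h : MvPolynomial σ ℂ) : h * subPf M v ∈ pfIdeal (attach M v f g h) := by
  exact Ideal.mem_of_dvd _ (subPf_attach_pen hM v f g h).dvd (subPf_mem_pfIdeal _ _)

lemma mul_mem_attach (hM : IsSkew M) (v : Fin (2 * m + 1))
    (f g h : MvPolynomial σ ℂ) {r : MvPolynomial σ ℂ} (hr : r ∈ pfIdeal M) :
    f * r ∈ pfIdeal (attach M v f g h) := by
  have hle : Ideal.span {f} * pfIdeal M ≤ pfIdeal (attach M v f g h) := by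
    rw [pfIdeal, Ideal.span_mul_span', Ideal.span_le]
    rintro _ ⟨_, rfl, _, ⟨w, rfl⟩, rfl⟩
    exact mul_subPf_mem_attach_old hM v _ g h w
  exact hle (Ideal.mul_mem_mul (Ideal.mem_span_singleton_self f) hr)

end Minors

end Attach

section Fills

/-- The ideal `I` contains every form of degree `d`. -/
def Fills (d : ℕ) (I : Ideal (MvPolynomial (Fin 3) ℂ)) : Prop :=
  ∀ F : MvPolynomial (Fin 3) ℂ, F.IsHomogeneous d → F ∈ I

lemma isHomogeneous_monomial_three (a b c : ℕ) :
    (X 0 ^ a * X 1 ^ b * X 2 ^ c : MvPolynomial (Fin 3) ℂ).IsHomogeneous (a + b + c) :=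
  ((isHomogeneous_X_pow 0 a).mul (isHomogeneous_X_pow 1 b)).mul (isHomogeneous_X_pow 2 c)

lemma fills_of_monomials {d : ℕ} {I : Ideal (MvPolynomial (Fin 3) ℂ)}
    (h : ∀ a b c, a + b + c = d → X 0 ^ a * X 1 ^ b * X 2 ^ c ∈ I) : Fills d I := by
  intro F hF
  rw [F.as_sum]
  refine Ideal.sum_mem _ fun u hu => ?_
  have hdeg := hF (mem_support_iff.1 hu)
  rw [monomial_eq, Finsupp.prod_fintype _ _ (by simp)]
  refine Ideal.mul_mem_left _ _ ?_
  rw [Fin.prod_univ_three]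
  apply h
  rw [← hdeg, Finsupp.weight_apply, Finsupp.sum_fintype _ _ (by simp), Fin.sum_univ_three]
  simp

lemma Fills.succ {d : ℕ} {I : Ideal (MvPolynomial (Fin 3) ℂ)} (h : Fills d I) :
    Fills (d + 1) I := by
  refine fills_of_monomials fun a b c habc => ?_
  rcases a with _ | a
  · rcases b with _ | b
    · obtain rfl : c = d + 1 := by omega
      have := Ideal.mul_mem_left I (X 2) (h _ (isHomogeneous_X_pow 2 d))
      rw [← pow_succ'] at this
      simpa using this
    · have := Ideal.mul_mem_left I (X 1) (h (X 0 ^ 0 * X 1 ^ b * X 2 ^ c) (by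
        convert isHomogeneous_monomial_three 0 b c using 1; omega))
      convert this using 1; ring
  · have := Ideal.mul_mem_left I (X 0) (h (X 0 ^ a * X 1 ^ b * X 2 ^ c) (by
      convert isHomogeneous_monomial_three a b c using 1; omega))
    convert this using 1; ring

lemma Fills.of_le {d d' : ℕ} {I : Ideal (MvPolynomial (Fin 3) ℂ)} (h : Fills d I) (hd : d ≤ d') :
    Fills d' I := by
  induction hd with
  | refl => exact h
  | step _ ih => exact ih.succ

lemma homogeneousComponent_mem_span {T : Set (MvPolynomial (Fin 3) ℂ)}
    (hT : ∀ t ∈ T, ∃ k, t.IsHomogeneous k) {F : MvPolynomial (Fin 3) ℂ} (hF : F ∈ Ideal.span T)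
    (d : ℕ) : homogeneousComponent d F ∈ Ideal.span T := by
  let := MvPolynomial.gradedAlgebra (σ := Fin 3) (R := ℂ)
  exact homogeneousComponent_mem_of_mem (Ideal.homogeneous_span _ _ hT) hF d

lemma homogeneousComponent_X_mul (i : Fin 3) (n : ℕ) (F : MvPolynomial (Fin 3) ℂ) :
    homogeneousComponent (n + 1) (X i * F) = X i * homogeneousComponent n F := by
  ext u
  rw [coeff_homogeneousComponent, coeff_X_mul', coeff_X_mul', coeff_homogeneousComponent]
  by_cases hi : i ∈ u.support
  · have hle : Finsupp.single i 1 ≤ u := by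
      rw [Finsupp.single_le_iff]
      exact Nat.one_le_iff_ne_zero.2 (Finsupp.mem_support_iff.1 hi)
    have hdeg : (u - Finsupp.single i 1).degree + 1 = u.degree := by
      conv_rhs => rw [← tsub_add_cancel_of_le hle]
      rw [map_add, Finsupp.degree_single]
    simp only [if_pos hi, ← hdeg, Nat.add_right_cancel_iff]
  · simp [hi]

/-- If a set `T` of forms, multiplied by `X i ^ s`, lies in `I` and fills degree `n + 1` modulo
`X i`, then multiples of `X i ^ (s + 1)` may be replaced by multiples of `X i ^ s`. -/
lemma mul_mem_of_fills_span_insert {I : Ideal (MvPolynomial (Fin 3) ℂ)}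
    {T : Set (MvPolynomial (Fin 3) ℂ)} {s n : ℕ} {i : Fin 3}
    (hT : ∀ t ∈ T, ∃ k, t.IsHomogeneous k)
    (hfill : Fills (n + 1) (Ideal.span (insert (X i) T)))
    (hTI : ∀ t ∈ T, X i ^ s * t ∈ I)
    (hI : ∀ H : MvPolynomial (Fin 3) ℂ, H.IsHomogeneous n → X i ^ (s + 1) * H ∈ I)
    (H : MvPolynomial (Fin 3) ℂ) (hH : H.IsHomogeneous (n + 1)) : X i ^ s * H ∈ I := by
  obtain ⟨a, b, hb, hab⟩ := Ideal.mem_span_insert.1 (hfill H hH)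
  have hH' : H = X i * homogeneousComponent n a + homogeneousComponent (n + 1) b := by
    rw [← homogeneousComponent_X_mul, ← map_add, mul_comm, ← hab, homogeneousComponent_eq_self hH]
  have hb' : ∀ t ∈ Ideal.span T, X i ^ s * t ∈ I := by
    have hle : Ideal.span {X i ^ s} * Ideal.span T ≤ I := by
      rw [Ideal.span_mul_span', Ideal.span_le]
      rintro _ ⟨_, rfl, t, ht, rfl⟩
      exact hTI t ht
    exact fun t ht => hle (Ideal.mul_mem_mul (Ideal.mem_span_singleton_self _) ht)
  rw [hH', mul_add, ← mul_assoc, ← pow_succ]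
  exact I.add_mem (hI _ (homogeneousComponent_isHomogeneous _ _))
    (hb' _ (homogeneousComponent_mem_span hT hb _))

/-- Filling degree `d` is a Zariski-open condition on forms depending polynomially on
parameters. -/
lemma exists_polynomial_fills {τ κ : Type*} (Ψ : κ → MvPolynomial (Fin 3) (MvPolynomial τ ℂ))
    (hΨ : ∀ c : τ → ℂ, ∀ j, ∃ n, (map (eval c) (Ψ j)).IsHomogeneous n) {d : ℕ} {c₀ : τ → ℂ}
    (h₀ : Fills d (Ideal.span (Set.range fun j => map (eval c₀) (Ψ j)))) :
    ∃ P : MvPolynomial τ ℂ, eval c₀ P ≠ 0 ∧ ∀ c, eval c P ≠ 0 →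
      Fills d (Ideal.span (Set.range fun j => map (eval c) (Ψ j))) := by
  classical
  let D := Finset.finsuppAntidiag (Finset.univ : Finset (Fin 3)) d
  have hD : ∀ u : Fin 3 →₀ ℕ, u ∈ D ↔ u.degree = d := by
    intro u
    simp [D, Finset.mem_finsuppAntidiag, Finsupp.degree_eq_sum]
  have hE : ∀ u : D, ∃ E : MvPolynomial (Fin 3) (MvPolynomial τ ℂ),
      map (eval c₀) E = monomial u.1 1 ∧
      ∀ c, map (eval c) E ∈ Ideal.span (Set.range fun j => map (eval c) (Ψ j)) := by
    intro u
    have hu := h₀ (monomial u.1 1) (isHomogeneous_monomial _ ((hD _).1 u.2))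
    obtain ⟨r, hr⟩ := (Finsupp.mem_ideal_span_range_iff_exists_finsupp).1 hu
    have hC : ∀ (c : τ → ℂ) (a : MvPolynomial (Fin 3) ℂ), map (eval c) (map C a) = a := by
      intro c a
      rw [map_map, show (eval c).comp C = RingHom.id ℂ from RingHom.ext fun x => eval_C x, map_id]
    have hmap : ∀ c : τ → ℂ, map (eval c) (r.sum fun j a => map C a * Ψ j) =
        r.sum fun j a => a * map (eval c) (Ψ j) := by
      intro c
      rw [map_finsuppSum]
      simp only [map_mul, hC]
    refine ⟨r.sum fun j a => map C a * Ψ j, (hmap c₀).trans hr, fun c => ?_⟩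
    rw [hmap]
    exact Ideal.sum_mem _ fun j _ => Ideal.mul_mem_left _ _ (Ideal.subset_span ⟨j, rfl⟩)
  choose E hE₀ hE using hE
  let Q : Matrix D D (MvPolynomial τ ℂ) := fun u v => coeff v.1 (E u)
  have hQ : ∀ c u v, eval c (Q u v) = coeff v.1 (map (eval c) (E u)) := fun c u v =>
    (coeff_map _ _ _).symm
  refine ⟨Q.det, ?_, fun c hc F hF => ?_⟩
  · have : (eval c₀).mapMatrix Q = 1 := by
      ext u v
      simp only [RingHom.mapMatrix_apply, Matrix.map_apply, hQ, hE₀, coeff_monomial,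
        Matrix.one_apply, Subtype.ext_iff]
    rw [RingHom.map_det, this, Matrix.det_one]
    exact one_ne_zero
  · rw [RingHom.map_det] at hc
    set B := (eval c).mapMatrix Q
    have hBu : IsUnit B.det := isUnit_iff_ne_zero.2 hc
    let w : D → ℂ := Matrix.vecMul (fun v => coeff v.1 F) B⁻¹
    have hw : Matrix.vecMul w B = fun v => coeff v.1 F := by
      simp only [w, Matrix.vecMul_vecMul, Matrix.nonsing_inv_mul B hBu, Matrix.vecMul_one]
    have hF' : F = homogeneousComponent d (∑ u : D, C (w u) * map (eval c) (E u)) := by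
      ext v
      rw [coeff_homogeneousComponent]
      split_ifs with hv
      · have := congrFun hw ⟨v, (hD v).2 hv⟩
        simp only [coeff_sum, coeff_C_mul]
        rw [← this, Matrix.vecMul, dotProduct]
        rfl
      · by_contra hne
        refine hv ?_
        rw [Finsupp.degree_eq_weight_one]
        exact hF hne
    rw [hF']
    refine homogeneousComponent_mem_span ?_ (Ideal.sum_mem _ fun u _ =>
      Ideal.mul_mem_left _ _ (hE u c)) d
    rintro _ ⟨j, rfl⟩
    exact hΨ c j

end Fills

section Averaged

/-- Every entry is the mean of the two diagonal entries in its row and column. -/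
def IsAveraged {ι : Type*} (A : Matrix ι ι ℕ) : Prop :=
  ∀ i j, 2 * A i j = A i i + A j j

lemma IsAveraged.isSymm {ι : Type*} {A : Matrix ι ι ℕ} (hA : IsAveraged A) : A.IsSymm := by
  ext i j
  have h1 := hA i j
  have h2 := hA j i
  rw [Matrix.transpose_apply]
  omega

lemma IsAveraged.submatrix {ι κ : Type*} {A : Matrix ι ι ℕ} (hA : IsAveraged A) (e : κ → ι) :
    IsAveraged (A.submatrix e e) := fun i j => hA (e i) (e j)

variable {m : ℕ}

lemma trace_eq_trace_oldIdx (A : Matrix (Fin (2 * (m + 1) + 1)) (Fin (2 * (m + 1) + 1)) ℕ) :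
    A.trace = (A.submatrix oldIdx oldIdx).trace + A (penIdx m) (penIdx m) +
      A (ultIdx m) (ultIdx m) := by
  simp only [Matrix.trace, Matrix.diag_apply, Matrix.submatrix_apply]
  exact (Fin.sum_univ_castSucc (n := 2 * m + 2) _).trans
    (congrArg (· + _) (Fin.sum_univ_castSucc (n := 2 * m + 1) _))

lemma subPf_of_size_one {σ : Type*} (M : Matrix (Fin (2 * 0 + 1)) (Fin (2 * 0 + 1))
    (MvPolynomial σ ℂ)) (v : Fin (2 * 0 + 1)) : subPf M v = 1 := pfaff_of_isEmpty _

lemma isSkew_zero {ι R : Type*} [Ring R] : IsSkew (0 : Matrix ι ι R) := fun _ _ => by simp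

lemma degMat_zero {ι σ : Type*} (A : Matrix ι ι ℕ) :
    DegMat (0 : Matrix ι ι (MvPolynomial σ ℂ)) A := fun _ _ => isHomogeneous_zero _ _ _

/-- A matrix one of whose Pfaffians is a power of `X 1`, and whose Pfaffians fill the degree
`tr A / 2` modulo `X 2`. -/
lemma exists_fills_of_one_matrix : ∀ (m : ℕ)
    (A : Matrix (Fin (2 * m + 1)) (Fin (2 * m + 1)) ℕ), IsAveraged A →
    ∃ (M : Matrix (Fin (2 * m + 1)) (Fin (2 * m + 1)) (MvPolynomial (Fin 3) ℂ)) (N : ℕ),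
      IsSkew M ∧ DegMat M A ∧ 2 * N + A (Fin.last _) (Fin.last _) = A.trace ∧
      Associated (subPf M (Fin.last _)) (X 1 ^ N) ∧
      Fills (A.trace / 2) (Ideal.span {X 2} ⊔ pfIdeal M) := by
  intro m
  induction m with
  | zero =>
    intro A hA
    refine ⟨0, 0, isSkew_zero, degMat_zero A, ?_, ?_, fun F _ => ?_⟩
    · simp [Matrix.trace]
    · rw [subPf_of_size_one, pow_zero]
    · have h1 : (1 : MvPolynomial (Fin 3) ℂ) ∈
          pfIdeal (0 : Matrix (Fin (2 * 0 + 1)) (Fin (2 * 0 + 1)) (MvPolynomial (Fin 3) ℂ)) := by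
        have := subPf_mem_pfIdeal
          (0 : Matrix (Fin (2 * 0 + 1)) (Fin (2 * 0 + 1)) (MvPolynomial (Fin 3) ℂ)) 0
        rwa [subPf_of_size_one] at this
      rw [(Ideal.eq_top_iff_one _).2 h1, sup_top_eq]
      trivial
  | succ m ih =>
    intro A hA
    obtain ⟨M, N, hM, hdeg, hN, hpf, hfill⟩ := ih _ (hA.submatrix oldIdx)
    have htr := trace_eq_trace_oldIdx A
    simp only [Matrix.submatrix_apply] at hN
    set v : Fin (2 * m + 1) := Fin.last _
    set p := penIdx m
    set q := ultIdx m
    have hpq := hA p q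
    have hvp := hA (oldIdx v) p
    have hvq := hA (oldIdx v) q
    have hlast : Fin.last (2 * (m + 1)) = q := rfl
    set s := A q q / 2
    obtain ⟨r, hr⟩ : ∃ r, A (oldIdx v) q = s + r := ⟨A (oldIdx v) q - s, by omega⟩
    have hult := subPf_attach_ult hM v (X 0 ^ A p q) (X 1 ^ A (oldIdx v) p) (X 0 ^ s * X 1 ^ r)
    have hpen := subPf_attach_pen hM v (X 0 ^ A p q) (X 1 ^ A (oldIdx v) p) (X 0 ^ s * X 1 ^ r)
    have hult' := hult.trans (hpf.mul_left _)
    have hpen' := hpen.trans (hpf.mul_left _)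
    rw [← pow_add] at hult'
    rw [mul_assoc, ← pow_add] at hpen'
    refine ⟨attach M v (X 0 ^ A p q) (X 1 ^ A (oldIdx v) p) (X 0 ^ s * X 1 ^ r),
      A (oldIdx v) p + N, hM.attach, hdeg.attach hA.isSymm (isHomogeneous_X_pow _ _)
      (isHomogeneous_X_pow _ _) ?_, ?_, hult', ?_⟩
    · rw [hr]; exact (isHomogeneous_X_pow _ _).mul (isHomogeneous_X_pow _ _)
    · rw [hlast]; omega
    · refine fills_of_monomials fun a b c habc => ?_
      rcases c with _ | c
      · rw [pow_zero, mul_one]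
        by_cases ha : A p q ≤ a
        · obtain ⟨a', rfl⟩ := Nat.exists_eq_add_of_le ha
          have hab : (A.submatrix oldIdx oldIdx).trace / 2 = a' + b := by omega
          rw [hab] at hfill
          obtain ⟨t, ht, w, hw, htw⟩ := Submodule.mem_sup.1
            (hfill _ ((isHomogeneous_X_pow 0 a').mul (isHomogeneous_X_pow 1 b)))
          rw [pow_add, mul_assoc, ← htw, mul_add]
          exact add_mem (Ideal.mem_sup_left (Ideal.mul_mem_left _ _ ht))
            (Ideal.mem_sup_right (mul_mem_attach hM v _ _ _ hw))
        · refine Ideal.mem_sup_right ?_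
          by_cases hs : s ≤ a
          · exact Ideal.mem_of_dvd _ (hpen'.dvd.trans (mul_dvd_mul (pow_dvd_pow _ hs)
              (pow_dvd_pow _ (by omega)))) (subPf_mem_pfIdeal _ p)
          · exact Ideal.mem_of_dvd _ (hult'.dvd.trans (Dvd.dvd.mul_left
              (pow_dvd_pow _ (by omega)) _)) (subPf_mem_pfIdeal _ q)
      · refine Ideal.mem_sup_left (Ideal.mem_span_singleton.2 ?_)
        exact Dvd.dvd.mul_left (dvd_pow_self _ (Nat.succ_ne_zero c)) _

/-- A sequence of matrices, whose Pfaffians of index `0` are monomials in two variables with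
exponents varying in small steps. -/
lemma exists_subPf_zero_sequence : ∀ (m : ℕ)
    (A : Matrix (Fin (2 * m + 1)) (Fin (2 * m + 1)) ℕ), IsAveraged A → (∀ i, A i i ≤ A 0 0) →
    ∃ (G : ℕ → Matrix (Fin (2 * m + 1)) (Fin (2 * m + 1)) (MvPolynomial (Fin 3) ℂ))
      (N : ℕ) (c : ℕ → ℕ), (∀ i, IsSkew (G i)) ∧ (∀ i, DegMat (G i) A) ∧
      2 * N + A 0 0 = A.trace ∧ c 0 = 0 ∧ c m = N ∧ (∀ i, c i ≤ N) ∧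
      (∀ i, c (i + 1) ≤ c i + A 0 0) ∧
      ∀ i, Associated (subPf (G i) 0) (X 0 ^ c i * X 1 ^ (N - c i)) := by
  intro m
  induction m with
  | zero =>
    intro A hA h0
    refine ⟨0, 0, 0, fun _ => isSkew_zero, fun _ => degMat_zero A, ?_, rfl, rfl, fun _ => le_rfl,
      fun _ => Nat.zero_le _, fun _ => ?_⟩
    · simp [Matrix.trace]
    · rw [subPf_of_size_one]; simp
  | succ m ih =>
    intro A hA h0
    obtain ⟨G, N, c, hG, hdeg, hN, hc0, hcm, hcN, hc, hpf⟩ :=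
      ih _ (hA.submatrix oldIdx) fun i => h0 (oldIdx i)
    have htr := trace_eq_trace_oldIdx A
    simp only [Matrix.submatrix_apply, show oldIdx (0 : Fin (2 * m + 1)) = 0 from rfl] at hN hc
    have hpq := hA (penIdx m) (ultIdx m)
    have hp0 := h0 (penIdx m)
    have hq0 := h0 (ultIdx m)
    set e := A (penIdx m) (ultIdx m)
    refine ⟨fun i => if i ≤ m then attach (G i) 0 (X 1 ^ e) 0 0 else attach (G m) 0 (X 0 ^ e) 0 0,
      N + e, fun i => if i ≤ m then c i else N + e, fun i => ?_, fun i => ?_, ?_, ?_, ?_, fun i => ?_,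
      fun i => ?_, fun i => ?_⟩
    · dsimp only; split_ifs <;> exact (hG _).attach
    · dsimp only
      split_ifs <;> exact (hdeg _).attach hA.isSymm (isHomogeneous_X_pow _ _)
        (isHomogeneous_zero _ _ _) (isHomogeneous_zero _ _ _)
    · omega
    · simpa using hc0
    · simp
    · have := hcN i
      dsimp only; split_ifs <;> omega
    · have := hc i
      have := hcN i
      dsimp only
      split_ifs with h1 h2
      · omega
      · omega
      · obtain rfl : i = m := by omega
        omega
      · omega
    · dsimp only
      split_ifs with hi
      · refine (subPf_attach_old (hG i) 0 _ 0 0 0).trans (((hpf i).mul_left _).trans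
          (Associated.of_eq ?_))
        rw [show N + e - c i = e + (N - c i) by have := hcN i; omega, pow_add]
        ring
      · refine (subPf_attach_old (hG m) 0 _ 0 0 0).trans (((hpf m).mul_left _).trans
          (Associated.of_eq ?_))
        rw [hcm, Nat.sub_self, Nat.sub_self, add_comm N, pow_add, mul_assoc]

/-- Modulo `X 2`, the Pfaffians of index `0` of `m + 1` suitable matrices, multiplied by
`X 0 ^ u` and `X 1 ^ w`, fill a degree. -/
lemma exists_fills_of_subPf_zero (m : ℕ) (A : Matrix (Fin (2 * m + 1)) (Fin (2 * m + 1)) ℕ)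
    (hA : IsAveraged A) (h0 : ∀ i, A i i ≤ A 0 0) {u w n : ℕ} (huw : u + w ≤ A 0 0)
    (hn : A 0 0 + A.trace + 2 ≤ 2 * n) :
    ∃ G : Fin (m + 1) → Matrix (Fin (2 * m + 1)) (Fin (2 * m + 1)) (MvPolynomial (Fin 3) ℂ),
      (∀ i, IsSkew (G i)) ∧ (∀ i, DegMat (G i) A) ∧
      Fills n (Ideal.span (insert (X 2) (Set.range fun x : Fin (m + 1) × Bool =>
        cond x.2 (X 0 ^ u) (X 1 ^ w) * subPf (G x.1) 0))) := by
  obtain ⟨G, N, c, hG, hdeg, hN, hc0, hcm, hcN, hc, hpf⟩ := exists_subPf_zero_sequence m A hA h0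
  refine ⟨fun i => G i, fun i => hG i, fun i => hdeg i, fills_of_monomials fun a b k habk => ?_⟩
  rcases k with _ | k
  · rw [pow_zero, mul_one]
    obtain ⟨i, him, hi, hi'⟩ : ∃ i ≤ m, c i ≤ a ∧ (i = m ∨ a < c (i + 1)) := by
      have h0a : c 0 ≤ a := by omega
      have h1 := Nat.findGreatest_le (P := fun i => c i ≤ a) m
      refine ⟨_, h1, Nat.findGreatest_spec (P := fun i => c i ≤ a) (Nat.zero_le m) h0a, ?_⟩
      rcases h1.eq_or_lt with h | h
      · exact Or.inl h
      · exact Or.inr (not_le.1 (Nat.findGreatest_is_greatest (P := fun i => c i ≤ a)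
          (Nat.lt_succ_self _) h))
    have hci := hcN i
    have hci' := hc i
    have hmem : ∀ b : Bool, cond b (X 0 ^ u) (X 1 ^ w) * subPf (G i) 0 ∈
        Ideal.span (insert (X 2) (Set.range fun x : Fin (m + 1) × Bool =>
          cond x.2 (X 0 ^ u) (X 1 ^ w) * subPf (G x.1) 0)) := fun b =>
      Ideal.subset_span (Set.mem_insert_of_mem _ ⟨(⟨i, by omega⟩, b), rfl⟩)
    by_cases hau : u + c i ≤ a
    · refine Ideal.mem_of_dvd _ (((hpf i).mul_left _).dvd.trans ?_) (hmem true)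
      rw [cond_true, ← mul_assoc, ← pow_add]
      refine mul_dvd_mul (pow_dvd_pow _ hau) (pow_dvd_pow _ ?_)
      rcases hi' with rfl | hi' <;> omega
    · refine Ideal.mem_of_dvd _ (((hpf i).mul_left _).dvd.trans ?_) (hmem false)
      rw [cond_false, mul_left_comm, ← pow_add]
      exact mul_dvd_mul (pow_dvd_pow _ hi) (pow_dvd_pow _ (by omega))
  · refine Ideal.mem_of_dvd _ ?_ (Ideal.subset_span (Set.mem_insert _ _))
    exact Dvd.dvd.mul_left (dvd_pow_self _ (Nat.succ_ne_zero k)) _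

end Averaged

section Generic

lemma DegMat.pfaff_isHomogeneous {σ : Type*} {n : ℕ}
    {M : Matrix (Fin (2 * n)) (Fin (2 * n)) (MvPolynomial σ ℂ)}
    {A : Matrix (Fin (2 * n)) (Fin (2 * n)) ℕ} (hM : DegMat M A) (hA : IsAveraged A) :
    (pfaff M).IsHomogeneous (A.trace / 2) := by
  rw [← mem_homogeneousSubmodule, pfaff]
  refine Submodule.smul_mem _ _ (Submodule.sum_mem _ fun p _ => zsmul_mem ?_ _)
  rw [mem_homogeneousSubmodule]
  have h2 : A.trace = 2 * ∑ i : Fin n, A (p (pairEquiv n (i, 0))) (p (pairEquiv n (i, 1))) := by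
    rw [Matrix.trace, ← Equiv.sum_comp ((pairEquiv n).trans p), Fintype.sum_prod_type,
      Finset.mul_sum]
    refine Finset.sum_congr rfl fun i _ => ?_
    rw [Fin.sum_univ_two, hA]
    rfl
  rw [h2, Nat.mul_div_cancel_left _ two_pos]
  exact IsHomogeneous.prod Finset.univ _ _ fun i _ => hM (p (pairEquiv n (i, 0)))
    (p (pairEquiv n (i, 1)))

lemma DegMat.subPf_isHomogeneous {σ : Type*} {m : ℕ}
    {M : Matrix (Fin (2 * m + 1)) (Fin (2 * m + 1)) (MvPolynomial σ ℂ)}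
    {A : Matrix (Fin (2 * m + 1)) (Fin (2 * m + 1)) ℕ} (hM : DegMat M A) (hA : IsAveraged A)
    (v : Fin (2 * m + 1)) : ∃ d, (subPf M v).IsHomogeneous d :=
  ⟨_, DegMat.pfaff_isHomogeneous (A := A.submatrix v.succAbove v.succAbove)
    (fun _ _ => hM _ _) (hA.submatrix _)⟩

lemma exists_map_eval_eq_pfaff {σ τ : Type*} {n : ℕ}
    (M : Matrix (Fin (2 * n)) (Fin (2 * n)) (MvPolynomial σ (MvPolynomial τ ℂ))) :
    ∃ Ψ : MvPolynomial σ (MvPolynomial τ ℂ), ∀ c : τ → ℂ,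
      map (eval c) Ψ = pfaff (M.map (map (eval c))) := by
  refine ⟨C (C (((2 ^ n * n.factorial : ℕ) : ℂ)⁻¹)) * ∑ p : Equiv.Perm (Fin (2 * n)),
    (Equiv.Perm.sign p : ℤ) • ∏ i : Fin n, M (p ⟨2*i.1, by have := i.2; omega⟩)
      (p ⟨2*i.1+1, by have := i.2; omega⟩), fun c => ?_⟩
  rw [pfaff, map_mul, map_C, eval_C, smul_eq_C_mul, map_sum]
  simp only [map_zsmul, map_prod, Matrix.map_apply]

variable {k m : ℕ}

/-- The coefficients of the entries of a tuple of matrices. -/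
def matCoeffs (G : Fin k → Matrix (Fin m) (Fin m) (MvPolynomial (Fin 3) ℂ)) :
    Fin k × Fin m × Fin m × (Fin 3 →₀ ℕ) → ℂ :=
  fun x => coeff x.2.2.2 (G x.1 x.2.1 x.2.2.1)

/-- The tuple of matrices of forms of given degrees with indeterminate coefficients. -/
noncomputable def genericMat (A : Matrix (Fin m) (Fin m) ℕ) (i : Fin k) : Matrix (Fin m) (Fin m)
    (MvPolynomial (Fin 3) (MvPolynomial (Fin k × Fin m × Fin m × (Fin 3 →₀ ℕ)) ℂ)) :=
  fun j l => ∑ μ ∈ Finset.finsuppAntidiag Finset.univ (A j l), monomial μ (X (i, j, l, μ))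

lemma degMat_genericMat_map (A : Matrix (Fin m) (Fin m) ℕ) (i : Fin k)
    (c : Fin k × Fin m × Fin m × (Fin 3 →₀ ℕ) → ℂ) :
    DegMat ((genericMat A i).map (map (eval c))) A := by
  intro j l
  simp only [Matrix.map_apply, genericMat, map_sum, map_monomial]
  refine IsHomogeneous.sum _ _ _ fun μ hμ => isHomogeneous_monomial _ ?_
  rw [Finset.mem_finsuppAntidiag] at hμ
  rw [Finsupp.degree_eq_sum, hμ.1]

lemma genericMat_map_coeffs {A : Matrix (Fin m) (Fin m) ℕ}
    {G : Fin k → Matrix (Fin m) (Fin m) (MvPolynomial (Fin 3) ℂ)} (hG : ∀ i, DegMat (G i) A)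
    (i : Fin k) : (genericMat A i).map (map (eval (matCoeffs G))) = G i := by
  ext j l μ
  simp only [Matrix.map_apply, genericMat, map_sum, map_monomial, eval_X, coeff_sum,
    coeff_monomial, Finset.sum_ite_eq', matCoeffs]
  split_ifs with h
  · rfl
  · by_contra hne
    refine h (Finset.mem_finsuppAntidiag.2 ⟨?_, Finset.subset_univ _⟩)
    rw [← Finsupp.degree_eq_sum, Finsupp.degree_eq_weight_one]
    exact hG i j l (Ne.symm hne)

/-- Forms obtained from Pfaffians of a general tuple of matrices with a given degree matrix fill a
degree as soon as this happens for one tuple. -/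
lemma exists_polynomial_fills_subPf {A : Matrix (Fin (2 * m + 1)) (Fin (2 * m + 1)) ℕ}
    (hA : IsAveraged A) {κ : Type*} (r : κ → MvPolynomial (Fin 3) ℂ)
    (hr : ∀ j, ∃ n, (r j).IsHomogeneous n) (s : κ → Option (Fin k × Fin (2 * m + 1))) {d : ℕ}
    {G₀ : Fin k → Matrix (Fin (2 * m + 1)) (Fin (2 * m + 1)) (MvPolynomial (Fin 3) ℂ)}
    (hG₀ : ∀ i, DegMat (G₀ i) A)
    (h₀ : Fills d (Ideal.span
      (Set.range fun j => r j * (s j).elim 1 fun x => subPf (G₀ x.1) x.2))) :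
    ∃ P : MvPolynomial (Fin k × Fin (2 * m + 1) × Fin (2 * m + 1) × (Fin 3 →₀ ℕ)) ℂ,
      eval (matCoeffs G₀) P ≠ 0 ∧
      ∀ G : Fin k → Matrix (Fin (2 * m + 1)) (Fin (2 * m + 1)) (MvPolynomial (Fin 3) ℂ),
        (∀ i, DegMat (G i) A) → eval (matCoeffs G) P ≠ 0 →
        Fills d (Ideal.span (Set.range fun j => r j * (s j).elim 1 fun x => subPf (G x.1) x.2)) := by
  have hpf : ∀ x : Fin k × Fin (2 * m + 1), ∃ Ψ : MvPolynomial (Fin 3)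
      (MvPolynomial (Fin k × Fin (2 * m + 1) × Fin (2 * m + 1) × (Fin 3 →₀ ℕ)) ℂ),
      ∀ c, map (eval c) Ψ = subPf ((genericMat A x.1).map (map (eval c))) x.2 := fun x =>
    exists_map_eval_eq_pfaff ((genericMat A x.1).submatrix x.2.succAbove x.2.succAbove)
  choose Ψ hΨ using hpf
  have hmap : ∀ c j, map (eval c) (map C (r j) * (s j).elim 1 Ψ) =
      r j * (s j).elim 1 fun x => subPf ((genericMat A x.1).map (map (eval c))) x.2 := by
    intro c j
    rw [map_mul, map_map, show (eval c).comp C = RingHom.id ℂ from RingHom.ext fun x => eval_C x,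
      map_id]
    rcases s j with _ | x
    · simp
    · simp [hΨ]
  obtain ⟨P, hP, hfill⟩ := exists_polynomial_fills (d := d) (c₀ := matCoeffs G₀)
    (fun j => map C (r j) * (s j).elim 1 Ψ) (fun c j => by
      rw [hmap]
      obtain ⟨n, hn⟩ := hr j
      rcases s j with _ | x
      · exact ⟨n, by simpa using hn⟩
      · obtain ⟨n', hn'⟩ := (degMat_genericMat_map A x.1 c).subPf_isHomogeneous hA x.2
        exact ⟨n + n', hn.mul hn'⟩) (by simpa only [hmap, genericMat_map_coeffs hG₀] using h₀)
  exact ⟨P, hP, fun G hG hGP => by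
    simpa only [hmap, genericMat_map_coeffs hG] using hfill _ hGP⟩

/-- Two nonempty open conditions on tuples of skew-symmetric matrices are compatible. -/
lemma exists_eval_coeffs_ne_zero {A : Matrix (Fin m) (Fin m) ℕ}
    {G H : Fin k → Matrix (Fin m) (Fin m) (MvPolynomial (Fin 3) ℂ)}
    (hG : ∀ i, IsSkew (G i)) (hGA : ∀ i, DegMat (G i) A)
    (hH : ∀ i, IsSkew (H i)) (hHA : ∀ i, DegMat (H i) A)
    {P Q : MvPolynomial (Fin k × Fin m × Fin m × (Fin 3 →₀ ℕ)) ℂ}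
    (hP : eval (matCoeffs G) P ≠ 0) (hQ : eval (matCoeffs H) Q ≠ 0) :
    ∃ K : Fin k → Matrix (Fin m) (Fin m) (MvPolynomial (Fin 3) ℂ),
      (∀ i, IsSkew (K i)) ∧ (∀ i, DegMat (K i) A) ∧ eval (matCoeffs K) P ≠ 0 ∧
        eval (matCoeffs K) Q ≠ 0 := by
  let line : Fin k × Fin m × Fin m × (Fin 3 →₀ ℕ) → Polynomial ℂ := fun x =>
    Polynomial.C (matCoeffs G x) + Polynomial.X * Polynomial.C (matCoeffs H x - matCoeffs G x)
  let K : ℂ → Fin k → Matrix (Fin m) (Fin m) (MvPolynomial (Fin 3) ℂ) := fun t i =>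
    G i + t • (H i - G i)
  have hK : ∀ t P, (aeval line P).eval t = eval (matCoeffs (K t)) P := by
    intro t P
    have hc : matCoeffs (K t) = fun x => (line x).eval t := by
      ext x
      simp [matCoeffs, K, line]
    rw [hc]
    induction P using MvPolynomial.induction_on with
    | C a => simp
    | add p q hp hq => simp [hp, hq]
    | mul_X p i hp => simp [hp]
  have h0 : K 0 = G := by ext1 i; simp [K]
  have h1 : K 1 = H := by ext1 i; simp [K]
  have hP' : aeval line P ≠ 0 := fun h => hP (by rw [← h0, ← hK, h, Polynomial.eval_zero])
  have hQ' : aeval line Q ≠ 0 := fun h => hQ (by rw [← h1, ← hK, h, Polynomial.eval_zero])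
  obtain ⟨t, ht⟩ : ∃ t, (aeval line P * aeval line Q).eval t ≠ 0 := by
    by_contra! h
    exact mul_ne_zero hP' hQ' (Polynomial.funext fun t => by rw [h, Polynomial.eval_zero])
  rw [Polynomial.eval_mul, hK, hK] at ht
  refine ⟨K t, fun i j l => ?_, fun i j l => ?_, left_ne_zero_of_mul ht, right_ne_zero_of_mul ht⟩
  · simp only [K, Matrix.add_apply, Matrix.smul_apply, Matrix.sub_apply, hG i j l, hH i j l]
    module
  · rw [← mem_homogeneousSubmodule]
    exact add_mem (hGA i j l) (Submodule.smul_mem _ _ (sub_mem (hHA i j l) (hGA i j l)))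

end Generic

section Existence

variable {k m : ℕ}

lemma iSup_pfIdeal_eq {σ : Type*}
    (G : Fin k → Matrix (Fin (2 * m + 1)) (Fin (2 * m + 1)) (MvPolynomial σ ℂ)) :
    ⨆ i, pfIdeal (G i) =
      Ideal.span (Set.range fun x : Fin k × Fin (2 * m + 1) => subPf (G x.1) x.2) := by
  refine le_antisymm (iSup_le fun i => Ideal.span_le.2 ?_) (Ideal.span_le.2 ?_)
  · rintro _ ⟨v, rfl⟩
    exact Ideal.subset_span ⟨(i, v), rfl⟩
  · rintro _ ⟨x, rfl⟩
    exact Ideal.mem_iSup_of_mem x.1 (subPf_mem_pfIdeal _ _)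

/-- If the Pfaffians of some tuple of matrices fill a degree, then so do those of a general one. -/
lemma exists_polynomial_fills_iSup {A : Matrix (Fin (2 * m + 1)) (Fin (2 * m + 1)) ℕ}
    (hA : IsAveraged A) {d : ℕ}
    {G₀ : Fin k → Matrix (Fin (2 * m + 1)) (Fin (2 * m + 1)) (MvPolynomial (Fin 3) ℂ)}
    (hG₀ : ∀ i, DegMat (G₀ i) A) (h₀ : Fills d (⨆ i, pfIdeal (G₀ i))) :
    ∃ P : MvPolynomial (Fin k × Fin (2 * m + 1) × Fin (2 * m + 1) × (Fin 3 →₀ ℕ)) ℂ,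
      eval (matCoeffs G₀) P ≠ 0 ∧
      ∀ G : Fin k → Matrix (Fin (2 * m + 1)) (Fin (2 * m + 1)) (MvPolynomial (Fin 3) ℂ),
        (∀ i, DegMat (G i) A) → eval (matCoeffs G) P ≠ 0 → Fills d (⨆ i, pfIdeal (G i)) := by
  simp only [iSup_pfIdeal_eq] at h₀ ⊢
  simpa only [one_mul, Option.elim_some] using exists_polynomial_fills_subPf hA (fun _ => 1)
    (fun _ => ⟨0, isHomogeneous_one _ _⟩) some hG₀
    (by simpa only [one_mul, Option.elim_some] using h₀)

lemma exists_tuple_fills_and_fills {A : Matrix (Fin (2 * m + 1)) (Fin (2 * m + 1)) ℕ}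
    (hA : IsAveraged A) (h0 : ∀ i, A i i ≤ A 0 0) {u w d : ℕ} (huw : u + w ≤ A 0 0)
    (hd : A 0 0 + A.trace = 2 * d)
    {G₀ : Fin (m + 1) → Matrix (Fin (2 * m + 1)) (Fin (2 * m + 1)) (MvPolynomial (Fin 3) ℂ)}
    (hG₀ : ∀ i, IsSkew (G₀ i)) (hGA₀ : ∀ i, DegMat (G₀ i) A)
    (h₀ : Fills d (⨆ i, pfIdeal (G₀ i))) :
    ∃ G : Fin (m + 1) → Matrix (Fin (2 * m + 1)) (Fin (2 * m + 1)) (MvPolynomial (Fin 3) ℂ),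
      (∀ i, IsSkew (G i)) ∧ (∀ i, DegMat (G i) A) ∧ Fills d (⨆ i, pfIdeal (G i)) ∧
      Fills (d + 1) (Ideal.span (insert (X 2) (Set.range fun x : Fin (m + 1) × Bool =>
        cond x.2 (X 0 ^ u) (X 1 ^ w) * subPf (G x.1) 0))) := by
  obtain ⟨G₁, hG₁, hGA₁, h₁⟩ := exists_fills_of_subPf_zero m A hA h0 huw (n := d + 1) (by omega)
  have hset : ∀ G : Fin (m + 1) → Matrix (Fin (2 * m + 1)) (Fin (2 * m + 1))
      (MvPolynomial (Fin 3) ℂ), (insert (X 2) (Set.range fun x : Fin (m + 1) × Bool =>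
        cond x.2 (X 0 ^ u) (X 1 ^ w) * subPf (G x.1) 0)) =
      Set.range fun j : Option (Fin (m + 1) × Bool) =>
        (j.elim (X 2) fun x => cond x.2 (X 0 ^ u) (X 1 ^ w)) *
          (j.map fun x => (x.1, (0 : Fin (2 * m + 1)))).elim 1 fun x => subPf (G x.1) x.2 := by
    intro G
    rw [Option.range_eq]
    simp [Function.comp_def]
  obtain ⟨P, hP, hPfill⟩ := exists_polynomial_fills_iSup hA hGA₀ h₀
  rw [hset] at h₁
  obtain ⟨Q, hQ, hQfill⟩ := exists_polynomial_fills_subPf hA _ (by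
    rintro (_ | ⟨i, _ | _⟩)
    · exact ⟨1, isHomogeneous_X _ _⟩
    · exact ⟨w, isHomogeneous_X_pow _ _⟩
    · exact ⟨u, isHomogeneous_X_pow _ _⟩) _ hGA₁ h₁
  obtain ⟨G, hG, hGA, hGP, hGQ⟩ := exists_eval_coeffs_ne_zero hG₀ hGA₀ hG₁ hGA₁ hP hQ
  exact ⟨G, hG, hGA, hPfill G hGA hGP, hset G ▸ hQfill G hGA hGQ⟩

lemma IsAveraged.exists_trace_eq {A : Matrix (Fin (2 * m + 1)) (Fin (2 * m + 1)) ℕ}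
    (hA : IsAveraged A) (h0 : ∀ i, A i i ≤ A 0 0) : ∃ N, 2 * N + A 0 0 = A.trace := by
  obtain ⟨-, N, -, -, -, hN, -⟩ := exists_subPf_zero_sequence m A hA h0
  exact ⟨N, hN⟩

/-- There is a tuple of matrices with a given degree matrix whose Pfaffians fill the degree
`(A 0 0 + tr A) / 2`. -/
lemma exists_tuple_fills : ∀ (m : ℕ) (A : Matrix (Fin (2 * m + 1)) (Fin (2 * m + 1)) ℕ),
    IsAveraged A → (∀ i, A i i ≤ A 0 0) → ∀ d, A 0 0 + A.trace = 2 * d →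
    ∃ G : Fin (m + 1) → Matrix (Fin (2 * m + 1)) (Fin (2 * m + 1)) (MvPolynomial (Fin 3) ℂ),
      (∀ i, IsSkew (G i)) ∧ (∀ i, DegMat (G i) A) ∧ Fills d (⨆ i, pfIdeal (G i)) := by
  intro m
  induction m with
  | zero =>
    intro A hA h0 d hd
    refine ⟨fun _ => 0, fun _ => isSkew_zero, fun _ => degMat_zero A, fun F _ => ?_⟩
    have h1 := Ideal.mem_iSup_of_mem (S := fun _ : Fin (0 + 1) => pfIdeal
      (0 : Matrix (Fin (2 * 0 + 1)) (Fin (2 * 0 + 1)) (MvPolynomial (Fin 3) ℂ))) 0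
      (subPf_mem_pfIdeal _ 0)
    rw [subPf_of_size_one] at h1
    rw [(Ideal.eq_top_iff_one _).2 h1]
    trivial
  | succ m ih =>
    intro A hA h0 d hd
    have hA' := hA.submatrix (oldIdx (m := m))
    have h0' : ∀ i, A.submatrix oldIdx oldIdx i i ≤ A.submatrix oldIdx oldIdx 0 0 :=
      fun i => h0 (oldIdx i)
    have htr := trace_eq_trace_oldIdx A
    have hpq := hA (penIdx m) (ultIdx m)
    have hp := hA 0 (penIdx m)
    have hq := hA 0 (ultIdx m)
    have hp0 := h0 (penIdx m)
    have hq0 := h0 (ultIdx m)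
    have hA00 : A.submatrix oldIdx oldIdx 0 0 = A 0 0 := rfl
    obtain ⟨N, hN⟩ := hA'.exists_trace_eq h0'
    set e := A (penIdx m) (ultIdx m)
    set t := (A 0 0 + 1) / 2 with ht
    obtain ⟨w, hw⟩ : ∃ w, A 0 (penIdx m) = t + w := ⟨A 0 (penIdx m) - t, by omega⟩
    obtain ⟨u, hu⟩ : ∃ u, A 0 (ultIdx m) = t + u := ⟨A 0 (ultIdx m) - t, by omega⟩
    have hd' : A.submatrix oldIdx oldIdx 0 0 + (A.submatrix oldIdx oldIdx).trace =
      2 * (N + A 0 0) := by omega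
    obtain ⟨G₀, hG₀, hGA₀, h₀⟩ := ih _ hA' h0' _ hd'
    obtain ⟨G', hG', hGA', hfill, hfillz⟩ := exists_tuple_fills_and_fills hA' h0'
      (u := u) (w := w) (by omega) hd' hG₀ hGA₀ h₀
    obtain ⟨M, -, hM, hMA, -, -, hMfill⟩ := exists_fills_of_one_matrix (m + 1) A hA
    let B : Fin (m + 1) → Matrix (Fin (2 * (m + 1) + 1)) (Fin (2 * (m + 1) + 1))
      (MvPolynomial (Fin 3) ℂ) := fun i =>
        attach (G' i) 0 (X 2 ^ e) (X 2 ^ t * X 1 ^ w) (X 2 ^ t * X 0 ^ u)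
    let G : Fin (m + 1 + 1) → Matrix (Fin (2 * (m + 1) + 1)) (Fin (2 * (m + 1) + 1))
      (MvPolynomial (Fin 3) ℂ) := Fin.snoc B M
    have hGB : ∀ i : Fin (m + 1), G i.castSucc = B i := fun i => by simp [G]
    have hGM : G (Fin.last (m + 1)) = M := by simp [G]
    set I := ⨆ i, pfIdeal (G i) with hI
    have hIB : ∀ i, pfIdeal (B i) ≤ I := fun i => hGB i ▸ le_iSup (fun i => pfIdeal (G i)) _
    have hIM : pfIdeal M ≤ I := hGM ▸ le_iSup (fun i => pfIdeal (G i)) _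
    refine ⟨G, fun i => ?_, fun i => ?_, ?_⟩
    · induction i using Fin.lastCases with
      | last => rwa [hGM]
      | cast i => rw [hGB]; exact (hG' i).attach
    · induction i using Fin.lastCases with
      | last => rwa [hGM]
      | cast i =>
        rw [hGB]
        refine (hGA' i).attach hA.isSymm (isHomogeneous_X_pow _ _) ?_ ?_
        · rw [show oldIdx (0 : Fin (2 * m + 1)) = 0 from rfl, hw]
          exact (isHomogeneous_X_pow _ _).mul (isHomogeneous_X_pow _ _)
        · rw [show oldIdx (0 : Fin (2 * m + 1)) = 0 from rfl, hu]
          exact (isHomogeneous_X_pow _ _).mul (isHomogeneous_X_pow _ _)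
    · have hdescend : ∀ j ≤ e, ∀ H : MvPolynomial (Fin 3) ℂ,
          H.IsHomogeneous (N + A 0 0 + j) → X 2 ^ (e - j) * H ∈ I := by
        intro j
        induction j with
        | zero =>
          intro _ H hH
          refine Submodule.iSup_induction _ (motive := fun H => X 2 ^ e * H ∈ I) (hfill H hH)
            (fun i x hx => hIB i (mul_mem_attach (hG' i) _ _ _ _ hx)) (by simp)
            fun x y hx hy => ?_
          rw [mul_add]
          exact add_mem hx hy
        | succ j ihj =>
          intro hj H hH
          have hej : e - (j + 1) + 1 = e - j := by omega
          have htop := ihj (by omega)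
          rw [← hej] at htop
          by_cases hs : t ≤ e - (j + 1)
          · refine mul_mem_of_fills_span_insert ?_ (hfillz.of_le (by omega)) ?_ htop H hH
            · rintro _ ⟨⟨i, b⟩, rfl⟩
              obtain ⟨n, hn⟩ := (hGA' i).subPf_isHomogeneous hA' 0
              cases b
              · exact ⟨_, (isHomogeneous_X_pow _ _).mul hn⟩
              · exact ⟨_, (isHomogeneous_X_pow _ _).mul hn⟩
            · rintro _ ⟨⟨i, b⟩, rfl⟩
              cases b
              · refine Ideal.mem_of_dvd _ ?_ (hIB i (mul_subPf_mem_attach_ult (hG' i) 0 _ _ _))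
                rw [mul_assoc]
                exact mul_dvd_mul_right (pow_dvd_pow _ hs) _
              · refine Ideal.mem_of_dvd _ ?_ (hIB i (mul_subPf_mem_attach_pen (hG' i) 0 _ _ _))
                rw [mul_assoc]
                exact mul_dvd_mul_right (pow_dvd_pow _ hs) _
          · refine mul_mem_of_fills_span_insert (T := Set.range (subPf M)) ?_ ?_ ?_ htop H hH
            · rintro _ ⟨v, rfl⟩
              exact hMA.subPf_isHomogeneous hA v
            · rw [Ideal.span_insert]
              exact hMfill.of_le (by omega)
            · rintro _ ⟨v, rfl⟩
              exact Ideal.mul_mem_left _ _ (hIM (subPf_mem_pfIdeal M v))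
      intro F hF
      obtain rfl : d = N + A 0 0 + e := by omega
      simpa using hdescend e le_rfl F hF

end Existence

/-- Let `A` be a non-negative, ordered, symmetric, homogeneous integer
matrix of odd size `(2k-1) × (2k-1)`, `k > 1`. For a general choice of `k` skew-symmetric
matrices `G 0, …, G (k-1)` of forms in three variables with degree matrix `A`, the ideal
generated by the submaximal Pfaffians of all the `G i` contains every form of degree
`d ≥ (a₁₁ + tr A)/2`. Genericity is expressed by a nonzero polynomial `P` in the
coefficients of the tuple, cutting out a nonempty Zariski-open subset. -/
theorem submax_pfaffians_of_k_general_odd_matrices_fill_top_degrees_three_vars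
    (k : ℕ) (hk : 1 < k)
    (A : Matrix (Fin (2*k-1)) (Fin (2*k-1)) ℕ) (hsym : A.IsSymm) (hhom : HomogMat A)
    (hord : ∀ i j : Fin (2*k-1), i ≤ j → A j ⟨0, by omega⟩ ≤ A i ⟨0, by omega⟩) :
    ∃ P : MvPolynomial (Fin k × Fin (2*k-1) × Fin (2*k-1) × ((Fin 3) →₀ ℕ)) ℂ, P ≠ 0 ∧
      (∃ G : Fin k → Matrix (Fin (2*k-1)) (Fin (2*k-1)) (MvPolynomial (Fin 3) ℂ),
        (∀ i, IsSkew (G i)) ∧ (∀ i, DegMat (G i) A) ∧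
        MvPolynomial.eval
          (fun x => MvPolynomial.coeff x.2.2.2 (G x.1 x.2.1 x.2.2.1)) P ≠ 0) ∧
      ∀ G : Fin k → Matrix (Fin (2*k-1)) (Fin (2*k-1)) (MvPolynomial (Fin 3) ℂ),
        (∀ i, IsSkew (G i)) → (∀ i, DegMat (G i) A) →
        MvPolynomial.eval
          (fun x => MvPolynomial.coeff x.2.2.2 (G x.1 x.2.1 x.2.2.1)) P ≠ 0 →
        ∀ d : ℕ, A ⟨0, by omega⟩ ⟨0, by omega⟩ + Matrix.trace A ≤ 2 * d →
          ∀ F : MvPolynomial (Fin 3) ℂ, F.IsHomogeneous d →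
            F ∈ Ideal.span (⋃ i, submaxPfOdd (G i)) := by
  obtain ⟨m, rfl⟩ : ∃ m, k = m + 1 := ⟨k - 1, by omega⟩
  change Matrix (Fin (2 * m + 1)) (Fin (2 * m + 1)) ℕ at A
  have hA : IsAveraged A := fun i j => by
    have h1 := hhom i j j i
    have h2 := hsym.apply i j
    omega
  have h0 : ∀ i : Fin (2 * m + 1), A i i ≤ A 0 0 := fun i => by
    have h1 := hord ⟨0, by omega⟩ i (Nat.zero_le _)
    have h2 := hA i 0
    change A i 0 ≤ A 0 0 at h1
    omega
  obtain ⟨N, hN⟩ := IsAveraged.exists_trace_eq hA h0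
  have hd : A 0 0 + A.trace = 2 * (N + A 0 0) := by omega
  obtain ⟨G₀, hG₀, hGA₀, h₀⟩ := exists_tuple_fills m A hA h0 _ hd
  obtain ⟨P, hP, hfill⟩ := exists_polynomial_fills_iSup hA hGA₀ h₀
  refine ⟨P, fun h => hP (by rw [h, map_zero]), ⟨G₀, hG₀, hGA₀, hP⟩,
    fun G _ hGA hGP d hle F hF => ?_⟩
  change A 0 0 + A.trace ≤ 2 * d at hle
  have hmem := ((hfill G hGA hGP).of_le (by omega : N + A 0 0 ≤ d)) F hF
  refine (iSup_le fun i => Ideal.span_le.2 ?_ : ⨆ i, pfIdeal (G i) ≤ _) hmem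
  rintro _ ⟨v, rfl⟩
  exact Ideal.subset_span (Set.mem_iUnion.2 ⟨i, Fin.succAboveOrderEmb v, rfl⟩)
end

section
/- Let V ⊆ ℙ(R_d) be the closure of the set of forms of degree d in n+1 variables that are Pfaffians of skew-symmetric 2k×2k matrices of forms with a fixed symmetric homogeneous degree matrix A (with tr(A) = 2d). Let F be a general element of V, F = Pfaff(M) with M = (F_{ij}) a skew-symmetric 2k×2k matrix of forms with degree matrix A. Then the (affine cone over the) tangent space to V at F coincides with the degree-d graded piece of the ideal J = ⟨F, M_{ij}⟩ of R generated by F and the submaximal Pfaffians M_{ij} of M (viewed modulo the line spanned by F). -/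
open MvPolynomial

open scoped TensorProduct KaehlerDifferential

/-- A derivation from a subring of a field of characteristic zero extends to the field. -/
lemma Derivation.exists_extension_of_charZero {k B K : Type*} [Field k] [CommRing B] [Algebra k B]
    [Field K] [CharZero K] [Algebra k K] [Algebra B K] [IsScalarTower k B K]
    [FaithfulSMul B K] (D : Derivation k B K) :
    ∃ E : Derivation k K K, ∀ b, E (algebraMap B K b) = D b := by
  have := IsDomain.of_faithfulSMul B K
  let _ := FractionRing.liftAlgebra B K
  have : CharZero (FractionRing B) :=
    ((algebraMap (FractionRing B) K).charZero_iff (algebraMap (FractionRing B) K).injective).2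
      inferInstance
  obtain ⟨s, hs⟩ := exists_isTranscendenceBasis (FractionRing B) K
  have : Algebra.IsAlgebraic
      (IntermediateField.adjoin (FractionRing B) (Set.range ((↑) : s → K))) K :=
    hs.isAlgebraic_field
  have : Algebra.FormallySmooth (FractionRing B) K :=
    .of_algebraicIndependent_of_isSeparable hs.1
  have : Algebra.FormallySmooth B (FractionRing B) := .of_isLocalization (nonZeroDivisors B)
  have : Algebra.FormallySmooth B K := .comp B (FractionRing B) K
  have hinj : Function.Injective (KaehlerDifferential.mapBaseChange k B K) := by
    rw [← LinearMap.ker_eq_bot, eq_bot_iff]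
    intro x hx
    obtain ⟨y, rfl⟩ := (Algebra.H1Cotangent.exact_δ_mapBaseChange k B K x).1 hx
    rw [Subsingleton.elim y 0, map_zero]
    exact Submodule.zero_mem _
  obtain ⟨g, hg⟩ := LinearMap.exists_leftInverse_of_injective
    (KaehlerDifferential.mapBaseChange k B K) (LinearMap.ker_eq_bot.2 hinj)
  let ψ : TensorProduct B K (Ω[B⁄k]) →ₗ[K] K := D.liftKaehlerDifferential.liftBaseChange K
  refine ⟨(ψ ∘ₗ g).compDer (KaehlerDifferential.D k K), fun b => ?_⟩
  have h1 : KaehlerDifferential.D k K (algebraMap B K b) =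
      KaehlerDifferential.mapBaseChange k B K (1 ⊗ₜ KaehlerDifferential.D k B b) := by
    simp [KaehlerDifferential.mapBaseChange_tmul]
  have h2 := LinearMap.congr_fun hg (1 ⊗ₜ KaehlerDifferential.D k B b)
  simp only [LinearMap.comp_apply, LinearMap.id_apply] at h2
  simp [h1, h2, ψ, -KaehlerDifferential.mapBaseChange_tmul]

lemma MvPolynomial.derivation_apply_eq_sum {R σ M : Type*} [CommRing R] [AddCommGroup M]
    [Module R M] [Module (MvPolynomial σ R) M] [IsScalarTower R (MvPolynomial σ R) M]
    (D : Derivation R (MvPolynomial σ R) M) (g : MvPolynomial σ R) :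
    D g = ∑ t ∈ g.vars, pderiv t g • D (X t) := by
  classical
  let D₂ : Derivation R (MvPolynomial σ R) M :=
    ∑ t ∈ g.vars, (LinearMap.toSpanSingleton (MvPolynomial σ R) M (D (X t))).compDer (pderiv t)
  have h : ∀ p, D₂ p = ∑ t ∈ g.vars, pderiv t p • D (X t) := fun p => by
    simp only [D₂]
    induction g.vars using Finset.induction_on with
    | empty => simp
    | insert t s ht ih => simp [Finset.sum_insert ht, ih]
  rw [← h]
  refine derivation_eq_of_forall_mem_vars fun i hi => ?_
  rw [h, Finset.sum_eq_single i]
  · simp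
  · intro b _ hb
    simp [pderiv_X_of_ne hb.symm]
  · exact fun hi' => absurd hi hi'

lemma MvPolynomial.derivation_aeval {R ι S M : Type*} [CommRing R] [CommRing S] [Algebra R S]
    [AddCommGroup M] [Module R M] [Module S M] [IsScalarTower R S M]
    (D : Derivation R S M) (f : ι → S) (Φ : MvPolynomial ι R) :
    D (aeval f Φ) = ∑ i ∈ Φ.vars, aeval f (pderiv i Φ) • D (f i) := by
  let _ : Module (MvPolynomial ι R) M :=
    Module.compHom M (aeval f : MvPolynomial ι R →ₐ[R] S).toRingHom
  have hs : ∀ (p : MvPolynomial ι R) (m : M), p • m = aeval f p • m := fun _ _ => rfl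
  have : IsScalarTower R (MvPolynomial ι R) M := ⟨fun r p m => by simp [hs]⟩
  let D' : Derivation R (MvPolynomial ι R) M :=
    Derivation.mk' (D.toLinearMap ∘ₗ (aeval f : MvPolynomial ι R →ₐ[R] S).toLinearMap)
      (fun a b => by simp [hs])
  have := derivation_apply_eq_sum D' Φ
  simpa [D', hs] using this

lemma MvPolynomial.eval_aeval {k ι τ : Type*} [CommRing k] (x : τ → k) (f : ι → MvPolynomial τ k)
    (p : MvPolynomial ι k) : eval x (aeval f p) = eval (fun j => eval x (f j)) p := by
  rw [← coe_aeval_eq_eval, ← coe_aeval_eq_eval]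
  change ((aeval x).comp (aeval f)) p = _
  rw [comp_aeval]
  rfl

section GenericExactness

variable {k τ ι : Type*} [Field k] [CharZero k] [Fintype ι] (f : ι → MvPolynomial τ k)

lemma MvPolynomial.mem_span_jacobian_of_relations {K : Type*} [Field K]
    [Algebra (MvPolynomial τ k) K] [IsFractionRing (MvPolynomial τ k) K] (w : ι → K)
    (hw : ∀ Φ : MvPolynomial ι k, aeval f Φ = 0 →
      ∑ i, algebraMap (MvPolynomial τ k) K (aeval f (pderiv i Φ)) * w i = 0) :
    w ∈ Submodule.span K
      (Set.range fun (t : τ) (i : ι) => algebraMap (MvPolynomial τ k) K (pderiv t (f i))) := by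
  classical
  let _ : Algebra k K := ((algebraMap (MvPolynomial τ k) K).comp C).toAlgebra
  have : IsScalarTower k (MvPolynomial τ k) K := .of_algebraMap_eq fun x => rfl
  have : CharZero K := ((algebraMap k K).charZero_iff (algebraMap k K).injective).1 inferInstance
  let φ : MvPolynomial ι k →ₐ[k] MvPolynomial τ k := aeval f
  let B := φ.range
  have hBK : ∀ b : B, algebraMap B K b = algebraMap (MvPolynomial τ k) K b := fun _ => rfl
  have : FaithfulSMul B K := by
    rw [faithfulSMul_iff_algebraMap_injective]
    exact (IsFractionRing.injective (MvPolynomial τ k) K).comp Subtype.val_injective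
  let d : MvPolynomial ι k →ₗ[k] K := ∑ i, LinearMap.mulRight k (w i) ∘ₗ
    (IsScalarTower.toAlgHom k (MvPolynomial τ k) K).toLinearMap ∘ₗ φ.toLinearMap ∘ₗ
      (pderiv i).toLinearMap
  have hd : ∀ Φ, d Φ = ∑ i, algebraMap _ K (aeval f (pderiv i Φ)) * w i := fun Φ => by
    simp [d, φ]
  have hd0 : ∀ Φ Ψ, φ Φ = φ Ψ → d Φ = d Ψ := fun Φ Ψ h => by
    rw [← sub_eq_zero, ← map_sub, hd]
    exact hw _ (by rw [map_sub, sub_eq_zero]; exact h)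
  have hdm : ∀ Φ Ψ, d (Φ * Ψ) = algebraMap _ K (φ Φ) * d Ψ + algebraMap _ K (φ Ψ) * d Φ := by
    intro Φ Ψ
    simp only [hd, Finset.mul_sum, ← Finset.sum_add_distrib, Derivation.leibniz, smul_eq_mul,
      map_add, map_mul, φ]
    exact Finset.sum_congr rfl fun i _ => by ring
  choose g hg using fun b : B => b.2
  have hg' : ∀ b, φ (g b) = b := hg
  let D : Derivation k B K := Derivation.mk'
    { toFun := fun b => d (g b)
      map_add' := fun a b => by
        rw [← map_add]; exact hd0 _ _ (by simp [hg'])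
      map_smul' := fun c b => by
        rw [← map_smul]; exact hd0 _ _ (by simp [hg']) }
    (fun a b => by
      have h : d (g (a * b)) = d (g a * g b) := hd0 _ _ (by simp [hg'])
      simp only [LinearMap.coe_mk, AddHom.coe_mk, h, hdm, hg', Algebra.smul_def, hBK])
  obtain ⟨E, hE⟩ := D.exists_extension_of_charZero
  have hEf : ∀ i, E (algebraMap _ K (f i)) = w i := by
    intro i
    have h1 := hE ⟨f i, X i, by simp [φ]⟩
    rw [hBK] at h1
    refine h1.trans ?_
    change d (g _) = _
    rw [hd0 _ (X i) ((hg' _).trans (by simp [φ])), hd, Finset.sum_eq_single i]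
    · simp
    · intro b _ hb
      simp [pderiv_X_of_ne hb.symm]
    · simp
  have hsum : w = ∑ t ∈ Finset.univ.biUnion (fun i => (f i).vars),
      E (algebraMap (MvPolynomial τ k) K (X t)) • fun i =>
        algebraMap (MvPolynomial τ k) K (pderiv t (f i)) := by
    funext i
    rw [← hEf i]
    have h1 := derivation_apply_eq_sum (E.compAlgebraMap (MvPolynomial τ k)) (f i)
    simp only [Derivation.compAlgebraMap_apply] at h1
    rw [h1, Finset.sum_apply]
    simp only [Algebra.smul_def, Pi.smul_apply]
    rw [← Finset.sum_subset (Finset.subset_biUnion_of_mem (fun i => (f i).vars)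
      (Finset.mem_univ i))]
    · exact Finset.sum_congr rfl fun t _ => mul_comm _ _
    · intro t _ ht
      simp [pderiv_eq_zero_of_notMem_vars ht]
  rw [hsum]
  exact Submodule.sum_mem _ fun t _ => Submodule.smul_mem _ _ (Submodule.subset_span ⟨t, rfl⟩)

omit [Fintype ι] in
lemma IsFractionRing.exists_smul_eq_of_mem_span {A K κ : Type*} [CommRing A] [IsDomain A]
    [Field K] [Algebra A K] [IsFractionRing A K] (u : κ → ι → A) {y : ι → K}
    (hy : y ∈ Submodule.span K (Set.range fun (j : κ) (i : ι) => algebraMap A K (u j i))) :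
    ∃ P : A, P ≠ 0 ∧ ∃ z ∈ Submodule.span A (Set.range u),
      ∀ i, algebraMap A K P * y i = algebraMap A K (z i) := by
  induction hy using Submodule.span_induction with
  | mem x h =>
    obtain ⟨j, rfl⟩ := h
    exact ⟨1, one_ne_zero, u j, Submodule.subset_span ⟨j, rfl⟩, fun i => by simp⟩
  | zero => exact ⟨1, one_ne_zero, 0, Submodule.zero_mem _, fun i => by simp⟩
  | add x y _ _ hx hy =>
    obtain ⟨P, hP, z, hz, h⟩ := hx
    obtain ⟨Q, hQ, z', hz', h'⟩ := hy
    refine ⟨P * Q, mul_ne_zero hP hQ, Q • z + P • z',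
      Submodule.add_mem _ (Submodule.smul_mem _ _ hz) (Submodule.smul_mem _ _ hz'), fun i => ?_⟩
    simp only [Pi.add_apply, Pi.smul_apply, smul_eq_mul, map_add, map_mul, ← h, ← h']
    ring
  | smul a x _ hx =>
    obtain ⟨P, hP, z, hz, h⟩ := hx
    obtain ⟨b, c, hc, rfl⟩ := IsFractionRing.div_surjective (A := A) a
    have hc0 := nonZeroDivisors.ne_zero hc
    refine ⟨c * P, mul_ne_zero hc0 hP, b • z, Submodule.smul_mem _ _ hz, fun i => ?_⟩
    have : algebraMap A K c ≠ 0 := by simpa using hc0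
    simp only [Pi.smul_apply, smul_eq_mul, map_mul, ← h]
    field_simp

omit [CharZero k] [Fintype ι] in
lemma MvPolynomial.eval_mem_span {κ : Type*} (u : κ → ι → MvPolynomial τ k)
    {z : ι → MvPolynomial τ k}
    (hz : z ∈ Submodule.span (MvPolynomial τ k) (Set.range u)) (x : τ → k) :
    (fun i => eval x (z i)) ∈ Submodule.span k (Set.range fun j i => eval x (u j i)) := by
  induction hz using Submodule.span_induction with
  | mem z h =>
    obtain ⟨j, rfl⟩ := h
    exact Submodule.subset_span ⟨j, rfl⟩
  | zero =>
    convert! Submodule.zero_mem _ using 1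
  | add y z _ _ hy hz =>
    convert! Submodule.add_mem _ hy hz using 1
    funext i
    simp
  | smul a z _ hz =>
    convert! Submodule.smul_mem _ (eval x a) hz using 1
    funext i
    simp

/-- Generic smoothness for a polynomial map in characteristic zero: at a general point, the
tangent space to the closure of the image is the image of the differential. -/
lemma MvPolynomial.exists_generic_mem_span_jacobian :
    ∃ P : MvPolynomial τ k, P ≠ 0 ∧ ∀ x : τ → k, eval x P ≠ 0 → ∀ v : ι → k,
      (∀ Φ : MvPolynomial ι k, aeval f Φ = 0 →
        ∑ i, eval (fun j => eval x (f j)) (pderiv i Φ) * v i = 0) →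
      v ∈ Submodule.span k (Set.range fun (t : τ) (i : ι) => eval x (pderiv t (f i))) := by
  classical
  set K := FractionRing (MvPolynomial τ k) with hK
  let J : τ → ι → MvPolynomial τ k := fun t i => pderiv t (f i)
  let G : {Φ : MvPolynomial ι k // aeval f Φ = 0} → ι → MvPolynomial τ k :=
    fun Φ i => aeval f (pderiv i Φ.1)
  let W := Submodule.span K (Set.range fun t i => algebraMap _ K (J t i))
  let U := Submodule.span K (Set.range fun Φ i => algebraMap _ K (G Φ i))
  have hUW : ∀ φ : Module.Dual K (ι → K), (∀ w ∈ W, φ w = 0) →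
      (fun i => φ (Pi.single i 1)) ∈ U := by
    intro φ hφ
    let e : (ι → K) ≃ₗ[K] Module.Dual K (ι → K) := (Pi.basisFun K ι).constr K
    have he : ∀ u w, e u w = ∑ i, w i * u i := fun u w => by
      simp [e, Module.Basis.constr_apply_fintype]
    have h1 : (U.map e.toLinearMap).dualCoannihilator ≤ W := by
      intro w hw
      refine mem_span_jacobian_of_relations f w fun Φ hΦ => ?_
      rw [Submodule.mem_dualCoannihilator] at hw
      have := hw _ (Submodule.mem_map_of_mem (Submodule.subset_span ⟨⟨Φ, hΦ⟩, rfl⟩))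
      simpa [he, G, mul_comm] using this
    have h2 : φ ∈ (U.map e.toLinearMap).dualCoannihilator.dualAnnihilator :=
      (Submodule.mem_dualAnnihilator _).2 fun w hw => hφ w (h1 hw)
    rw [Subspace.dualCoannihilator_dualAnnihilator_eq] at h2
    obtain ⟨u, hu, rfl⟩ := h2
    convert! hu using 1
    funext i
    simp [he, Pi.single_apply]
  obtain ⟨q, hq⟩ := LinearMap.exists_leftInverse_of_injective W.subtype (by simp)
  have hq' : ∀ w (hw : w ∈ W), (q w : ι → K) = w := fun w hw =>
    congrArg Subtype.val (LinearMap.congr_fun hq ⟨w, hw⟩)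
  have hz := fun i : ι => IsFractionRing.exists_smul_eq_of_mem_span J (q (Pi.single i 1)).2
  have hy := fun j : ι => IsFractionRing.exists_smul_eq_of_mem_span G
    (hUW (LinearMap.proj j ∘ₗ (LinearMap.id - W.subtype ∘ₗ q))
      (fun w hw => by simp [hq' w hw]))
  choose P hP z hz hPz using hz
  choose Q hQ y hy hQy using hy
  have key : ∀ i j, P i * Q j * (if i = j then 1 else 0) = Q j * z i j + P i * y j i := by
    intro i j
    apply IsFractionRing.injective (MvPolynomial τ k) K
    simp only [map_mul, map_add, ← hPz, ← hQy]
    simp only [LinearMap.comp_apply, LinearMap.sub_apply, LinearMap.id_apply,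
      LinearMap.proj_apply, Pi.sub_apply, Submodule.subtype_apply, Pi.single_apply, @eq_comm _ j i]
    split_ifs <;> simp <;> ring
  refine ⟨(∏ i, P i) * ∏ j, Q j, mul_ne_zero (Finset.prod_ne_zero_iff.2 fun i _ => hP i)
    (Finset.prod_ne_zero_iff.2 fun i _ => hQ i), fun x hx v hv => ?_⟩
  rw [map_mul, map_prod, map_prod] at hx
  have hPx : ∀ i, eval x (P i) ≠ 0 := fun i =>
    Finset.prod_ne_zero_iff.1 (left_ne_zero_of_mul hx) i (Finset.mem_univ i)
  have hQx : ∀ i, eval x (Q i) ≠ 0 := fun i =>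
    Finset.prod_ne_zero_iff.1 (right_ne_zero_of_mul hx) i (Finset.mem_univ i)
  have hyv : ∀ j, ∑ i, eval x (y j i) * v i = 0 := by
    intro j
    have hle : Submodule.span k (Set.range fun Φ i => eval x (G Φ i)) ≤
        LinearMap.ker (∑ i, LinearMap.mulRight k (v i) ∘ₗ LinearMap.proj i) := by
      rw [Submodule.span_le]
      rintro _ ⟨Φ, rfl⟩
      have h1 := hv Φ.1 Φ.2
      have h2 := eval_aeval x f
      simpa [G, h2, -aeval_eq_bind₁] using h1
    simpa using hle (eval_mem_span G (hy j) x)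
  have hv' : v = ∑ i, (v i / eval x (P i)) • fun j => eval x (z i j) := by
    funext j
    have h1 : ∀ i, v i * (if i = j then 1 else 0) =
        v i / eval x (P i) * eval x (z i j) + (eval x (Q j))⁻¹ * (eval x (y j i) * v i) := by
      intro i
      have h2 := congrArg (eval x) (key i j)
      simp only [map_mul, map_add] at h2
      have h3 : eval x (if i = j then 1 else 0) = (if i = j then 1 else 0 : k) := by
        split_ifs <;> simp
      rw [h3] at h2
      have := hPx i
      have := hQx j
      field_simp
      linear_combination (v i) * h2
    have h2 := Finset.sum_congr rfl fun i (_ : i ∈ Finset.univ) => h1 i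
    rw [Finset.sum_add_distrib, ← Finset.mul_sum, hyv] at h2
    simpa using h2
  rw [hv']
  exact Submodule.sum_mem _ fun i _ => Submodule.smul_mem _ _ (eval_mem_span J (hz i) x)

end GenericExactness

section PfaffianSum

variable {R : Type*} [CommRing R] {n : ℕ}

/-- The first element of the `i`-th consecutive pair in `Fin (2 * n)`. -/
def pairFst (i : Fin n) : Fin (2 * n) := ⟨2 * i.1, by have := i.2; omega⟩

/-- The second element of the `i`-th consecutive pair in `Fin (2 * n)`. -/
def pairSnd (i : Fin n) : Fin (2 * n) := ⟨2 * i.1 + 1, by have := i.2; omega⟩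

/-- The Pfaffian multiplied by `2 ^ n * n!`, over an arbitrary commutative ring. -/
def pfSum (M : Matrix (Fin (2 * n)) (Fin (2 * n)) R) : R :=
  ∑ p : Equiv.Perm (Fin (2 * n)), (Equiv.Perm.sign p : ℤ) •
    ∏ i : Fin n, M (p (pairFst i)) (p (pairSnd i))

/-- The differential of `pfSum` at `M` in the direction `N`. -/
def pfSumDiff (M N : Matrix (Fin (2 * n)) (Fin (2 * n)) R) : R :=
  ∑ p : Equiv.Perm (Fin (2 * n)), (Equiv.Perm.sign p : ℤ) •
    ∑ i : Fin n, ∏ j : Fin n, (if j = i then N else M) (p (pairFst j)) (p (pairSnd j))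

lemma pfaff_eq_smul_pfSum {σ : Type*}
    (M : Matrix (Fin (2 * n)) (Fin (2 * n)) (MvPolynomial σ ℂ)) :
    pfaff M = (((2 ^ n * n.factorial : ℕ) : ℂ)⁻¹) • pfSum M := rfl

lemma pfSumDiff_self (M : Matrix (Fin (2 * n)) (Fin (2 * n)) R) :
    pfSumDiff M M = n • pfSum M := by
  simp only [pfSumDiff, pfSum, ite_self, Finset.sum_const, Finset.card_univ, Fintype.card_fin,
    Finset.smul_sum]
  exact Finset.sum_congr rfl fun p _ => smul_comm _ _ _

lemma RingHom.map_pfSum {S : Type*} [CommRing S] (φ : R →+* S)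
    (M : Matrix (Fin (2 * n)) (Fin (2 * n)) R) : φ (pfSum M) = pfSum (M.map φ) := by
  simp [pfSum]

lemma RingHom.map_pfSumDiff {S : Type*} [CommRing S] (φ : R →+* S)
    (M N : Matrix (Fin (2 * n)) (Fin (2 * n)) R) :
    φ (pfSumDiff M N) = pfSumDiff (M.map φ) (N.map φ) := by
  simp only [pfSumDiff, map_sum, map_zsmul, map_prod]
  refine Finset.sum_congr rfl fun p _ => congrArg _ <| Finset.sum_congr rfl fun i _ =>
    Finset.prod_congr rfl fun j _ => ?_
  split_ifs <;> rfl

lemma Derivation.map_prod_eq_sum {k ι : Type*} [CommRing k] [Algebra k R] [DecidableEq ι]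
    (D : Derivation k R R) (s : Finset ι) (f : ι → R) :
    D (∏ j ∈ s, f j) = ∑ i ∈ s, ∏ j ∈ s, if j = i then D (f j) else f j := by
  induction s using Finset.induction_on with
  | empty => simp
  | insert a s ha ih =>
    rw [Finset.prod_insert ha, Derivation.leibniz, Finset.sum_insert ha, Finset.prod_insert ha,
      ih, if_pos rfl, Finset.smul_sum, add_comm, smul_eq_mul, mul_comm]
    congr 1
    · congr 1
      exact Finset.prod_congr rfl fun j hj => by rw [if_neg (by rintro rfl; exact ha hj)]
    · refine Finset.sum_congr rfl fun i hi => ?_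
      rw [Finset.prod_insert ha, if_neg (by rintro rfl; exact ha hi), smul_eq_mul]

lemma Derivation.map_pfSum {k : Type*} [CommRing k] [Algebra k R] (D : Derivation k R R)
    (M : Matrix (Fin (2 * n)) (Fin (2 * n)) R) : D (pfSum M) = pfSumDiff M (M.map D) := by
  simp only [pfSum, pfSumDiff, map_sum, map_zsmul, D.map_prod_eq_sum]
  refine Finset.sum_congr rfl fun p _ => congrArg _ <| Finset.sum_congr rfl fun i _ =>
    Finset.prod_congr rfl fun j _ => ?_
  split_ifs <;> rfl

lemma pfSum_submatrix_perm {m : Type*} (M : Matrix m m R) (g : Fin (2 * n) → m)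
    (ρ : Equiv.Perm (Fin (2 * n))) :
    pfSum (M.submatrix (g ∘ ρ) (g ∘ ρ)) =
      (Equiv.Perm.sign ρ : ℤ) • pfSum (M.submatrix g g) := by
  simp only [pfSum, Finset.smul_sum, Matrix.submatrix_apply, Function.comp_apply]
  rw [← Equiv.sum_comp (Equiv.mulLeft ρ⁻¹)]
  refine Finset.sum_congr rfl fun p _ => ?_
  simp [mul_assoc]

/-- Permuting the consecutive pairs in `Fin (2 * n)`. -/
def pairPerm (s : Equiv.Perm (Fin n)) : Equiv.Perm (Fin (2 * n)) :=
  (finProdFinEquiv.trans (finCongr (mul_comm n 2))).permCongr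
    (Equiv.prodCongrLeft fun _ : Fin 2 => s)

lemma pairPerm_pairFst (s : Equiv.Perm (Fin n)) (i : Fin n) :
    pairPerm s (pairFst i) = pairFst (s i) := by
  have h : ∀ j : Fin n, (finProdFinEquiv.trans (finCongr (mul_comm n 2))) (j, (0 : Fin 2)) =
    pairFst j := fun j => by ext; simp [pairFst]
  rw [pairPerm, ← h, Equiv.permCongr_apply, Equiv.symm_apply_apply, ← h]
  rfl

lemma pairPerm_pairSnd (s : Equiv.Perm (Fin n)) (i : Fin n) :
    pairPerm s (pairSnd i) = pairSnd (s i) := by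
  have h : ∀ j : Fin n, (finProdFinEquiv.trans (finCongr (mul_comm n 2))) (j, (1 : Fin 2)) =
    pairSnd j := fun j => by ext; simp [pairSnd, add_comm]
  rw [pairPerm, ← h, Equiv.permCongr_apply, Equiv.symm_apply_apply, ← h]
  rfl

lemma sign_pairPerm (s : Equiv.Perm (Fin n)) : Equiv.Perm.sign (pairPerm s) = 1 := by
  rw [pairPerm, Equiv.Perm.sign_permCongr, Equiv.Perm.sign_prodCongrLeft]
  simp

/-- The inclusion omitting the last two elements. -/
def dropPair (n : ℕ) : Fin (2 * n) ↪ Fin (2 * (n + 1)) :=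
  Fin.castLEEmb (by omega)

lemma pairFst_castSucc (i : Fin n) : pairFst i.castSucc = dropPair n (pairFst i) := rfl

lemma pairSnd_castSucc (i : Fin n) : pairSnd i.castSucc = dropPair n (pairSnd i) := rfl

lemma dropPair_ne_pairFst_last (j : Fin (2 * n)) : dropPair n j ≠ pairFst (Fin.last n) := by
  intro h
  have h1 := congrArg Fin.val h
  have h2 : (j : ℕ) = 2 * n := h1
  omega

lemma dropPair_ne_pairSnd_last (j : Fin (2 * n)) : dropPair n j ≠ pairSnd (Fin.last n) := by
  intro h
  have h1 := congrArg Fin.val h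
  have h2 : (j : ℕ) = 2 * n + 1 := h1
  omega

lemma pairFst_ne_pairSnd (i : Fin n) : pairFst i ≠ pairSnd i := by
  simp [pairFst, pairSnd]

lemma exists_dropPair_eq (x : Fin (2 * (n + 1))) :
    (∃ j, x = dropPair n j) ∨ x = pairFst (Fin.last n) ∨ x = pairSnd (Fin.last n) := by
  by_cases h : x.1 < 2 * n
  · exact Or.inl ⟨⟨x.1, h⟩, rfl⟩
  · right
    have := x.2
    rcases (by omega : x.1 = 2 * n ∨ x.1 = 2 * n + 1) with h | h
    · exact Or.inl (Fin.ext h)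
    · exact Or.inr (Fin.ext h)

/-- Extending a permutation by fixing the last two elements. -/
def extendPerm (r : Equiv.Perm (Fin (2 * n))) : Equiv.Perm (Fin (2 * (n + 1))) :=
  r.viaFintypeEmbedding (dropPair n)

lemma extendPerm_dropPair (r : Equiv.Perm (Fin (2 * n))) (j : Fin (2 * n)) :
    extendPerm r (dropPair n j) = dropPair n (r j) :=
  Equiv.Perm.viaFintypeEmbedding_apply_image _ _ _

lemma extendPerm_pairFst_last (r : Equiv.Perm (Fin (2 * n))) :
    extendPerm r (pairFst (Fin.last n)) = pairFst (Fin.last n) :=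
  Equiv.Perm.viaFintypeEmbedding_apply_notMem_range _ _
    fun ⟨j, hj⟩ => dropPair_ne_pairFst_last j hj

lemma extendPerm_pairSnd_last (r : Equiv.Perm (Fin (2 * n))) :
    extendPerm r (pairSnd (Fin.last n)) = pairSnd (Fin.last n) :=
  Equiv.Perm.viaFintypeEmbedding_apply_notMem_range _ _
    fun ⟨j, hj⟩ => dropPair_ne_pairSnd_last j hj

lemma sign_extendPerm (r : Equiv.Perm (Fin (2 * n))) :
    Equiv.Perm.sign (extendPerm r) = Equiv.Perm.sign r :=
  Equiv.Perm.viaFintypeEmbedding_sign _ _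

lemma pfSumDiff_eq_last (M N : Matrix (Fin (2 * (n + 1))) (Fin (2 * (n + 1))) R) :
    pfSumDiff M N = (n + 1) • ∑ p : Equiv.Perm (Fin (2 * (n + 1))),
      (Equiv.Perm.sign p : ℤ) •
        ((∏ i : Fin n, M (p (dropPair n (pairFst i))) (p (dropPair n (pairSnd i)))) *
          N (p (pairFst (Fin.last n))) (p (pairSnd (Fin.last n)))) := by
  simp only [pfSumDiff, Finset.smul_sum (N := R) (s := (Finset.univ : Finset (Fin (n + 1))))]
  rw [Finset.sum_comm]
  have h : ∀ i : Fin (n + 1), ∑ p : Equiv.Perm (Fin (2 * (n + 1))), (Equiv.Perm.sign p : ℤ) •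
      ∏ j : Fin (n + 1), (if j = i then N else M) (p (pairFst j)) (p (pairSnd j)) =
      ∑ p : Equiv.Perm (Fin (2 * (n + 1))),
      (Equiv.Perm.sign p : ℤ) •
        ((∏ i : Fin n, M (p (dropPair n (pairFst i))) (p (dropPair n (pairSnd i)))) *
          N (p (pairFst (Fin.last n))) (p (pairSnd (Fin.last n)))) := by
    intro i
    rw [← Equiv.sum_comp (Equiv.mulRight (pairPerm (Equiv.swap i (Fin.last n))))]
    refine Finset.sum_congr rfl fun p _ => ?_
    rw [Equiv.coe_mulRight, Equiv.Perm.sign_mul, sign_pairPerm, mul_one]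
    congr 1
    simp only [Equiv.Perm.mul_apply, pairPerm_pairFst, pairPerm_pairSnd]
    rw [← Equiv.prod_comp (Equiv.swap i (Fin.last n)), Fin.prod_univ_castSucc]
    simp only [Equiv.swap_apply_self, Equiv.swap_apply_right, Equiv.swap_apply_left, if_true,
      ← pairFst_castSucc, ← pairSnd_castSucc]
    congr 1
    refine Finset.prod_congr rfl fun j _ => ?_
    rw [if_neg]
    intro h
    have := congrArg (Equiv.swap i (Fin.last n)) h
    rw [Equiv.swap_apply_self, Equiv.swap_apply_left] at this
    exact (Fin.castSucc_lt_last j).ne this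
  rw [Finset.sum_congr rfl fun i _ => h i, Finset.sum_const, Finset.card_univ, Fintype.card_fin]

/-- Expansion of the differential of the Pfaffian in terms of submaximal Pfaffians. -/
lemma factorial_smul_pfSumDiff (M N : Matrix (Fin (2 * (n + 1))) (Fin (2 * (n + 1))) R) :
    (2 * n).factorial • pfSumDiff M N = (n + 1) • ∑ p : Equiv.Perm (Fin (2 * (n + 1))),
      (Equiv.Perm.sign p : ℤ) • (pfSum (M.submatrix (p ∘ dropPair n) (p ∘ dropPair n)) *
          N (p (pairFst (Fin.last n))) (p (pairSnd (Fin.last n)))) := by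
  rw [pfSumDiff_eq_last, smul_comm]
  congr 1
  have h : ∀ r : Equiv.Perm (Fin (2 * n)), ∑ p : Equiv.Perm (Fin (2 * (n + 1))),
      (Equiv.Perm.sign p : ℤ) •
        ((∏ i : Fin n, M (p (dropPair n (pairFst i))) (p (dropPair n (pairSnd i)))) *
          N (p (pairFst (Fin.last n))) (p (pairSnd (Fin.last n)))) =
      ∑ p : Equiv.Perm (Fin (2 * (n + 1))), (Equiv.Perm.sign p : ℤ) •
        (((Equiv.Perm.sign r : ℤ) • ∏ i : Fin n, M (p (dropPair n (r (pairFst i))))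
            (p (dropPair n (r (pairSnd i))))) *
          N (p (pairFst (Fin.last n))) (p (pairSnd (Fin.last n)))) := by
    intro r
    rw [← Equiv.sum_comp (Equiv.mulRight (extendPerm r))]
    refine Finset.sum_congr rfl fun p _ => ?_
    simp only [Equiv.coe_mulRight, Equiv.Perm.sign_mul, sign_extendPerm, Equiv.Perm.mul_apply,
      extendPerm_dropPair, extendPerm_pairFst_last, extendPerm_pairSnd_last, Units.val_mul,
      mul_smul, smul_mul_assoc]
  have h2 := Finset.sum_congr (rfl : (Finset.univ : Finset (Equiv.Perm (Fin (2 * n)))) = _)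
    fun r _ => h r
  rw [Finset.sum_const, Finset.card_univ, Fintype.card_perm, Fintype.card_fin,
    Finset.sum_comm] at h2
  rw [h2]
  refine Finset.sum_congr rfl fun p _ => ?_
  rw [← Finset.smul_sum, ← Finset.sum_mul]
  rfl

lemma exists_orderEmb_comp_perm {m : ℕ} (g : Fin n ↪ Fin m) :
    ∃ (e : Fin n ↪o Fin m) (ρ : Equiv.Perm (Fin n)), (g : Fin n → Fin m) = e ∘ ρ := by
  classical
  have hc : (Finset.univ.map g).card = n := by simp
  let e := (Finset.univ.map g).orderEmbOfFin hc
  have he : ∀ i, ∃ j, e j = g i := fun i => by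
    have : g i ∈ Set.range e := by
      rw [Finset.range_orderEmbOfFin]
      simp
    exact this
  choose ρ hρ using he
  have hinj : Function.Injective ρ := fun a b hab => g.injective (by rw [← hρ, ← hρ, hab])
  exact ⟨e, Equiv.ofBijective ρ (Finite.injective_iff_bijective.1 hinj),
    funext fun i => (hρ i).symm⟩

/-- The differential of the Pfaffian in the direction of an elementary skew-symmetric matrix is a
nonzero multiple of a submaximal Pfaffian. -/
lemma exists_smul_pfSumDiff_single (M : Matrix (Fin (2 * (n + 1))) (Fin (2 * (n + 1))) R)
    (q : Equiv.Perm (Fin (2 * (n + 1)))) (h : R) :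
    ∃ c : ℕ, c ≠ 0 ∧ (2 * n).factorial • pfSumDiff M
      (Matrix.single (q (pairFst (Fin.last n))) (q (pairSnd (Fin.last n))) h -
        Matrix.single (q (pairSnd (Fin.last n))) (q (pairFst (Fin.last n))) h) =
      c • (Equiv.Perm.sign q : ℤ) •
        (pfSum (M.submatrix (q ∘ dropPair n) (q ∘ dropPair n)) * h) := by
  classical
  set a := pairFst (Fin.last n) with ha
  set b := pairSnd (Fin.last n) with hb
  have hab : a ≠ b := pairFst_ne_pairSnd _
  set N := Matrix.single (q a) (q b) h - Matrix.single (q b) (q a) h with hN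
  have key : ∀ p : Equiv.Perm (Fin (2 * (n + 1))), p a = q a → p b = q b →
      (Equiv.Perm.sign p : ℤ) • pfSum (M.submatrix (p ∘ dropPair n) (p ∘ dropPair n)) =
      (Equiv.Perm.sign q : ℤ) • pfSum (M.submatrix (q ∘ dropPair n) (q ∘ dropPair n)) := by
    intro p hpa hpb
    have hex : ∀ j, ∃ i, p (dropPair n j) = q (dropPair n i) := by
      intro j
      rcases exists_dropPair_eq (q⁻¹ (p (dropPair n j))) with ⟨i, hi⟩ | hi | hi
      · exact ⟨i, by rw [← hi]; simp⟩
      · rw [Equiv.Perm.inv_eq_iff_eq, ← ha, ← hpa] at hi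
        exact absurd (p.injective hi) (dropPair_ne_pairFst_last j)
      · rw [Equiv.Perm.inv_eq_iff_eq, ← hb, ← hpb] at hi
        exact absurd (p.injective hi) (dropPair_ne_pairSnd_last j)
    choose ρ hρ using hex
    have hinj : Function.Injective ρ := fun i j hij =>
      (dropPair n).injective (p.injective (by rw [hρ, hρ, hij]))
    let r := Equiv.ofBijective ρ (Finite.injective_iff_bijective.1 hinj)
    have hp : p = q * extendPerm r := by
      ext1 x
      rcases exists_dropPair_eq x with ⟨i, rfl⟩ | rfl | rfl
      · rw [Equiv.Perm.mul_apply, extendPerm_dropPair, hρ]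
        rfl
      · rw [Equiv.Perm.mul_apply, extendPerm_pairFst_last, ← ha, hpa]
      · rw [Equiv.Perm.mul_apply, extendPerm_pairSnd_last, ← hb, hpb]
    have hc : (p ∘ dropPair n : Fin (2 * n) → _) = (q ∘ dropPair n) ∘ r := funext hρ
    rw [hc, pfSum_submatrix_perm, smul_smul, hp, Equiv.Perm.sign_mul, sign_extendPerm]
    congr 1
    simp [mul_assoc]
  have hterm : ∀ p : Equiv.Perm (Fin (2 * (n + 1))),
      (Equiv.Perm.sign p : ℤ) •
        (pfSum (M.submatrix (p ∘ dropPair n) (p ∘ dropPair n)) * N (p a) (p b)) =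
      if (p a = q a ∧ p b = q b) ∨ (p a = q b ∧ p b = q a) then
        (Equiv.Perm.sign q : ℤ) • (pfSum (M.submatrix (q ∘ dropPair n) (q ∘ dropPair n)) * h)
      else 0 := by
    intro p
    have hqab : q a ≠ q b := q.injective.ne hab
    split_ifs with hp
    · rcases hp with ⟨h1, h2⟩ | ⟨h1, h2⟩
      · have hv : N (p a) (p b) = h := by
          rw [h1, h2]
          simp [hN, hqab]
        rw [hv, ← smul_mul_assoc, key p h1 h2, smul_mul_assoc]
      · have hv : N (p a) (p b) = -h := by
          rw [h1, h2]
          simp [hN, hqab, hqab.symm]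
        have hs := key (p * Equiv.swap a b) (by simp [h2]) (by simp [h1])
        have hd : ((p * Equiv.swap a b : Equiv.Perm _) ∘ dropPair n : Fin (2 * n) → _) =
            p ∘ dropPair n := by
          funext j
          exact congrArg p (Equiv.swap_apply_of_ne_of_ne (dropPair_ne_pairFst_last j)
            (dropPair_ne_pairSnd_last j))
        rw [hd, Equiv.Perm.sign_mul, Equiv.Perm.sign_swap hab] at hs
        rw [hv, ← smul_mul_assoc (Equiv.Perm.sign q : ℤ), ← hs]
        simp [mul_assoc]
    · have hv : N (p a) (p b) = 0 := by
        have h1 : ¬ (q a = p a ∧ q b = p b) := fun h' => hp (Or.inl ⟨h'.1.symm, h'.2.symm⟩)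
        have h2 : ¬ (q b = p a ∧ q a = p b) := fun h' => hp (Or.inr ⟨h'.1.symm, h'.2.symm⟩)
        simp [hN, h1, h2]
      rw [hv, mul_zero, smul_zero]
  refine ⟨(n + 1) * (Finset.univ.filter fun p : Equiv.Perm (Fin (2 * (n + 1))) =>
    (p a = q a ∧ p b = q b) ∨ (p a = q b ∧ p b = q a)).card, ?_, ?_⟩
  · refine mul_ne_zero n.succ_ne_zero (Finset.card_ne_zero_of_mem (a := q) ?_)
    simp
  · rw [factorial_smul_pfSumDiff, Finset.sum_congr rfl fun p _ => hterm p, mul_smul,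
      ← Finset.sum_filter, Finset.sum_const]

end PfaffianSum

section CoefficientwiseDerivation

variable {k σ B : Type*} [CommRing k] [CommRing B] [Algebra k B]

/-- A derivation of `B` applied to every coefficient is a derivation of `MvPolynomial σ B`. -/
lemma Derivation.exists_coeff_eq (D : Derivation k B B) :
    ∃ E : Derivation k (MvPolynomial σ B) (MvPolynomial σ B),
      ∀ (G : MvPolynomial σ B) (m : σ →₀ ℕ), coeff m (E G) = D (coeff m G) := by
  classical
  obtain ⟨f, hf⟩ : ∃ f : MvPolynomial σ B → MvPolynomial σ B,
      ∀ (G : MvPolynomial σ B) (m : σ →₀ ℕ), coeff m (f G) = D (coeff m G) := by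
    refine ⟨fun G => ∑ l ∈ G.support, monomial l (D (coeff l G)), fun G m => ?_⟩
    simp only [coeff_sum, coeff_monomial]
    rw [Finset.sum_ite_eq', ite_eq_left_iff]
    intro h
    rw [notMem_support_iff.1 h, map_zero]
  refine ⟨Derivation.mk'
    { toFun := f
      map_add' := fun G H => by
        ext m
        simp only [coeff_add, hf, map_add]
      map_smul' := fun c G => by
        ext m
        simp only [coeff_smul, hf, Derivation.map_smul, RingHom.id_apply] }
    fun G H => ?_, hf⟩
  ext m
  simp only [LinearMap.coe_mk, AddHom.coe_mk, hf, smul_eq_mul, coeff_add, coeff_mul,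
    map_sum, Derivation.leibniz, Finset.sum_add_distrib]
  rw [Finsupp.sum_antidiagonal_swap m fun x y => coeff y H * D (coeff x G)]

end CoefficientwiseDerivation

section PfaffianDegree

lemma sum_pairFst_add_pairSnd {n : ℕ} (f : Fin (2 * n) → ℕ) :
    ∑ i : Fin n, (f (pairFst i) + f (pairSnd i)) = ∑ x, f x := by
  rw [← Equiv.sum_comp (finProdFinEquiv.trans (finCongr (mul_comm n 2))), Fintype.sum_prod_type]
  refine Finset.sum_congr rfl fun i _ => ?_
  rw [Fin.sum_univ_two]
  congr 2 <;> ext <;> simp [pairFst, pairSnd, add_comm]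

lemma HomogMat.sum_pairs_eq {n d : ℕ} {A : Matrix (Fin (2 * n)) (Fin (2 * n)) ℕ}
    (hhom : HomogMat A) (hsym : A.IsSymm) (htr : Matrix.trace A = 2 * d)
    (p : Equiv.Perm (Fin (2 * n))) : ∑ i : Fin n, A (p (pairFst i)) (p (pairSnd i)) = d := by
  have h : ∀ i j, 2 * A i j = A i i + A j j := fun i j => by
    have h1 := hhom i j j i
    have h2 := hsym.apply i j
    omega
  have h3 : 2 * ∑ i : Fin n, A (p (pairFst i)) (p (pairSnd i)) = 2 * d := by
    rw [Finset.mul_sum, Finset.sum_congr rfl fun i _ => h _ _,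
      sum_pairFst_add_pairSnd fun x => A (p x) (p x), Equiv.sum_comp p fun x => A x x, ← htr]
    rfl
  omega

variable {σ : Type*} {n d : ℕ} {A : Matrix (Fin (2 * n)) (Fin (2 * n)) ℕ}
  {M N : Matrix (Fin (2 * n)) (Fin (2 * n)) (MvPolynomial σ ℂ)}

lemma DegMat.isHomogeneous_pfSum (hM : DegMat M A)
    (hA : ∀ p : Equiv.Perm (Fin (2 * n)), ∑ i : Fin n, A (p (pairFst i)) (p (pairSnd i)) = d) :
    (pfSum M).IsHomogeneous d := by
  refine IsHomogeneous.sum _ _ _ fun p _ =>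
    zsmul_mem (K := homogeneousSubmodule σ ℂ d) ?_ _
  rw [mem_homogeneousSubmodule, ← hA p]
  exact IsHomogeneous.prod _ _ _ fun i _ => hM _ _

lemma DegMat.isHomogeneous_pfSumDiff (hM : DegMat M A) (hN : DegMat N A)
    (hA : ∀ p : Equiv.Perm (Fin (2 * n)), ∑ i : Fin n, A (p (pairFst i)) (p (pairSnd i)) = d) :
    (pfSumDiff M N).IsHomogeneous d := by
  refine IsHomogeneous.sum _ _ _ fun p _ =>
    zsmul_mem (K := homogeneousSubmodule σ ℂ d) ?_ _
  rw [mem_homogeneousSubmodule, ← hA p]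
  refine IsHomogeneous.sum _ _ _ fun i _ => IsHomogeneous.prod _ _ _ fun j _ => ?_
  split_ifs
  exacts [hN _ _, hM _ _]

lemma sum_pairs_dropPair_add {n d : ℕ} {A : Matrix (Fin (2 * (n + 1))) (Fin (2 * (n + 1))) ℕ}
    (hA : ∀ p : Equiv.Perm (Fin (2 * (n + 1))),
      ∑ i : Fin (n + 1), A (p (pairFst i)) (p (pairSnd i)) = d)
    (q : Equiv.Perm (Fin (2 * (n + 1)))) (r : Equiv.Perm (Fin (2 * n))) :
    ∑ i : Fin n, A.submatrix (q ∘ dropPair n) (q ∘ dropPair n) (r (pairFst i)) (r (pairSnd i)) +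
      A (q (pairFst (Fin.last n))) (q (pairSnd (Fin.last n))) = d := by
  rw [← hA (q * extendPerm r), Fin.sum_univ_castSucc]
  simp only [pairFst_castSucc, pairSnd_castSucc, Equiv.Perm.mul_apply, extendPerm_dropPair,
    extendPerm_pairFst_last, extendPerm_pairSnd_last]
  rfl

lemma MvPolynomial.homogeneousComponent_mem_of_mem_span {R : Type*} [CommRing R]
    {S : Set (MvPolynomial σ R)} (W : Submodule R (MvPolynomial σ R))
    (hW : ∀ s ∈ S, ∃ e, s.IsHomogeneous e ∧
      ∀ g i, g.IsHomogeneous i → i + e = d → g * s ∈ W)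
    {w : MvPolynomial σ R} (hw : w ∈ Ideal.span S) : homogeneousComponent d w ∈ W := by
  suffices h : ∀ g : MvPolynomial σ R, homogeneousComponent d (g * w) ∈ W by
    simpa using h 1
  induction hw using Submodule.span_induction with
  | mem s hs =>
    intro g
    obtain ⟨e, he, hmem⟩ := hW s hs
    rw [← sum_homogeneousComponent g, Finset.sum_mul, map_sum]
    refine Submodule.sum_mem _ fun i _ => ?_
    have hi := homogeneousComponent_isHomogeneous i g
    rw [homogeneousComponent_of_mem (hi.mul he)]
    split_ifs with h
    · exact hmem _ _ hi h.symm
    · exact zero_mem _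
  | zero => simp
  | add x y _ _ hx hy =>
    intro g
    rw [mul_add, map_add]
    exact add_mem (hx g) (hy g)
  | smul a x _ hx =>
    intro g
    rw [smul_eq_mul, ← mul_assoc]
    exact hx _

end PfaffianDegree

section PfaffianIdeal

variable {σ : Type*} {n d : ℕ} {A : Matrix (Fin (2 * (n + 1))) (Fin (2 * (n + 1))) ℕ}
  {M N : Matrix (Fin (2 * (n + 1))) (Fin (2 * (n + 1))) (MvPolynomial σ ℂ)}

/-- `pfSumDiff M` as a linear map. -/
noncomputable def pfSumDiffLinear
    (M : Matrix (Fin (2 * (n + 1))) (Fin (2 * (n + 1))) (MvPolynomial σ ℂ)) :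
    Matrix (Fin (2 * (n + 1))) (Fin (2 * (n + 1))) (MvPolynomial σ ℂ) →ₗ[ℂ] MvPolynomial σ ℂ where
  toFun := pfSumDiff M
  map_add' N N' := by
    simp only [pfSumDiff_eq_last, Matrix.add_apply, mul_add, smul_add, Finset.sum_add_distrib]
  map_smul' c N := by
    simp only [pfSumDiff_eq_last, Matrix.smul_apply, mul_smul_comm, RingHom.id_apply,
      Finset.smul_sum]
    refine Finset.sum_congr rfl fun p _ => ?_
    rw [smul_comm c, smul_comm c]

lemma pfSumDiffLinear_apply : pfSumDiffLinear M N = pfSumDiff M N := rfl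

/-- The skew-symmetric matrices of forms with symmetric degree matrix `A`. -/
def skewDegSubmodule (σ : Type*) {m : Type*} (A : Matrix m m ℕ) :
    Submodule ℂ (Matrix m m (MvPolynomial σ ℂ)) where
  carrier := {M | IsSkew M ∧ DegMat M A}
  add_mem' hM hN := ⟨fun i j => by simp [hM.1 i j, hN.1 i j, add_comm],
    fun i j => (hM.2 i j).add (hN.2 i j)⟩
  zero_mem' := ⟨fun i j => by simp, fun i j => isHomogeneous_zero _ _ _⟩
  smul_mem' c M hM := ⟨fun i j => by simp [hM.1 i j],
    fun i j => (homogeneousSubmodule σ ℂ _).smul_mem c (hM.2 i j)⟩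

lemma single_sub_single_mem_skewDegSubmodule {m : Type*} [DecidableEq m] {A : Matrix m m ℕ}
    (hA : A.IsSymm) (a b : m) {h : MvPolynomial σ ℂ} (hh : h.IsHomogeneous (A a b)) :
    Matrix.single a b h - Matrix.single b a h ∈ skewDegSubmodule σ A := by
  refine ⟨fun i j => ?_, fun i j => ?_⟩
  · simp only [Matrix.sub_apply, Matrix.single_apply, neg_sub]
    congr 1 <;> simp only [and_comm]
  · refine IsHomogeneous.sub ?_ ?_ <;> rw [Matrix.single_apply] <;> split_ifs with hij
    · rwa [← hij.1, ← hij.2]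
    · exact isHomogeneous_zero _ _ _
    · rwa [← hij.1, ← hij.2, hA.apply]
    · exact isHomogeneous_zero _ _ _

/-- Every directional derivative of the Pfaffian lies in the ideal of submaximal Pfaffians. -/
lemma pfSumDiff_mem_span (M N : Matrix (Fin (2 * (n + 1))) (Fin (2 * (n + 1))) (MvPolynomial σ ℂ)) :
    pfSumDiff M N ∈ Ideal.span (submaxPfEven M) := by
  set I := Ideal.span (submaxPfEven M)
  have hsmul : ∀ (c : ℂ) {x}, x ∈ I → c • x ∈ I := fun c x hx =>
    (I.restrictScalars ℂ).smul_mem c hx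
  have hpf : ∀ e : Fin (2 * n) ↪o Fin (2 * (n + 1)), pfSum (M.submatrix e e) ∈ I := by
    intro e
    have h : pfaff (M.submatrix e e) ∈ I := Ideal.subset_span ⟨e, rfl⟩
    rw [pfaff_eq_smul_pfSum] at h
    have h0 : ((2 ^ n * n.factorial : ℕ) : ℂ) ≠ 0 :=
      Nat.cast_ne_zero.2 (by positivity)
    simpa [smul_smul, h0, -Nat.cast_mul] using hsmul ((2 ^ n * n.factorial : ℕ) : ℂ) h
  have h1 : ((2 * n).factorial : ℂ) • pfSumDiff M N ∈ I := by
    rw [Nat.cast_smul_eq_nsmul, factorial_smul_pfSumDiff]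
    refine nsmul_mem (sum_mem fun p _ => zsmul_mem (Ideal.mul_mem_right _ _ ?_) _) _
    obtain ⟨e, ρ, he⟩ := exists_orderEmb_comp_perm ((dropPair n).trans p.toEmbedding)
    have he' : (p ∘ dropPair n : Fin (2 * n) → _) = e ∘ ρ := he
    rw [he', pfSum_submatrix_perm]
    exact zsmul_mem (hpf e) _
  have h0 : ((2 * n).factorial : ℂ) ≠ 0 := Nat.cast_ne_zero.2 (Nat.factorial_ne_zero _)
  simpa [smul_smul, h0] using hsmul ((2 * n).factorial : ℂ)⁻¹ h1

/-- Degree-`d` elements of the ideal generated by the Pfaffian and the submaximal Pfaffians are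
directional derivatives of the Pfaffian. -/
lemma exists_eq_pfSumDiff_of_mem_span (hsym : A.IsSymm)
    (hA : ∀ p : Equiv.Perm (Fin (2 * (n + 1))),
      ∑ i : Fin (n + 1), A (p (pairFst i)) (p (pairSnd i)) = d)
    (hM : IsSkew M) (hdeg : DegMat M A) {v : MvPolynomial σ ℂ} (hv : v.IsHomogeneous d)
    (hmem : v ∈ Ideal.span ({pfaff M} ∪ submaxPfEven M)) :
    ∃ N, IsSkew N ∧ DegMat N A ∧ pfSumDiff M N = v := by
  suffices h : v ∈ (skewDegSubmodule σ A).map (pfSumDiffLinear M) by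
    obtain ⟨N, hN, rfl⟩ := h
    exact ⟨N, hN.1, hN.2, rfl⟩
  rw [← homogeneousComponent_eq_self hv]
  refine homogeneousComponent_mem_of_mem_span _ ?_ hmem
  rintro s (rfl | ⟨e, rfl⟩)
  · refine ⟨d, ?_, fun g i hg hi => ?_⟩
    · rw [pfaff_eq_smul_pfSum]
      exact (homogeneousSubmodule σ ℂ d).smul_mem _ (hdeg.isHomogeneous_pfSum hA)
    · obtain rfl : i = 0 := by omega
      rw [← totalDegree_zero_iff_isHomogeneous, totalDegree_eq_zero_iff_eq_C] at hg
      rw [hg, ← smul_eq_C_mul, pfaff_eq_smul_pfSum]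
      refine Submodule.smul_mem _ _ (Submodule.smul_mem _ _ ?_)
      have h0 : ((n + 1 : ℕ) : ℂ) ≠ 0 := Nat.cast_ne_zero.2 n.succ_ne_zero
      have h1 : pfSum M = ((n + 1 : ℕ) : ℂ)⁻¹ • pfSumDiffLinear M M := by
        rw [pfSumDiffLinear_apply, pfSumDiff_self, ← Nat.cast_smul_eq_nsmul ℂ, smul_smul,
          inv_mul_cancel₀ h0, one_smul]
      rw [h1]
      exact Submodule.smul_mem _ _ (Submodule.mem_map_of_mem ⟨hM, hdeg⟩)
  · obtain ⟨q, hq⟩ := Equiv.Perm.exists_extending_pair (dropPair n) e (dropPair n).injective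
      e.injective
    set a := q (pairFst (Fin.last n))
    set b := q (pairSnd (Fin.last n))
    have hq' : (q ∘ dropPair n : Fin (2 * n) → _) = e := funext hq
    have hdrop := fun r => sum_pairs_dropPair_add hA q r
    rw [hq'] at hdrop
    refine ⟨d - A a b, ?_, fun g i hg hi => ?_⟩
    · change (pfaff (n := n) (M.submatrix e e)).IsHomogeneous (d - A a b)
      rw [pfaff_eq_smul_pfSum]
      refine (homogeneousSubmodule σ ℂ _).smul_mem _ (DegMat.isHomogeneous_pfSum
        (A := A.submatrix e e) (fun i j => hdeg _ _) fun r => ?_)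
      exact Nat.eq_sub_of_add_eq (hdrop r)
    · have hle : A a b ≤ d := (hdrop 1) ▸ Nat.le_add_left _ _
      obtain rfl : i = A a b := by omega
      change g * pfaff (n := n) (M.submatrix e e) ∈ _
      obtain ⟨c, hc, hcq⟩ := exists_smul_pfSumDiff_single M q g
      rw [hq'] at hcq
      have hc' : ((c : ℤ) * (Equiv.Perm.sign q : ℤ) : ℂ) ≠ 0 := by
        simp [hc]
      have h1 : g * pfSum (M.submatrix e e) =
          ((c : ℤ) * (Equiv.Perm.sign q : ℤ) : ℂ)⁻¹ • ((2 * n).factorial : ℂ) •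
            pfSumDiffLinear M (Matrix.single a b g - Matrix.single b a g) := by
        rw [eq_inv_smul_iff₀ hc', pfSumDiffLinear_apply, Nat.cast_smul_eq_nsmul, hcq, mul_smul,
          Int.cast_smul_eq_zsmul, Int.cast_smul_eq_zsmul, natCast_zsmul, mul_comm g]
      rw [pfaff_eq_smul_pfSum, mul_smul_comm, h1]
      exact Submodule.smul_mem _ _ <| Submodule.smul_mem _ _ <| Submodule.smul_mem _ _ <|
        Submodule.mem_map_of_mem (single_sub_single_mem_skewDegSubmodule hsym a b hg)

end PfaffianIdeal

section GenericSkewMatrix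

/-- The coordinates on the space of skew-symmetric matrices of forms with degree matrix `A`:
positions above the diagonal together with a monomial of the prescribed degree. -/
abbrev SkewCoord (σ : Type*) {l : Type*} [LT l] (A : Matrix l l ℕ) :=
  {t : l × l × (σ →₀ ℕ) // t.1 < t.2.1 ∧ t.2.2.degree = A t.1 t.2.1}

variable {σ l : Type*} [LinearOrder l] {A : Matrix l l ℕ}

instance SkewCoord.finite [Finite σ] [Finite l] : Finite (SkewCoord σ A) := by
  refine Set.Finite.to_subtype (Set.Finite.subset (s := ⋃ i : l, ⋃ j : l,
    (fun m : σ →₀ ℕ => (i, j, m)) '' {m | m.degree = A i j}) ?_ ?_)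
  · exact Set.finite_iUnion fun i => Set.finite_iUnion fun j =>
      (Finsupp.finite_of_degree_eq _).image _
  · rintro ⟨i, j, m⟩ h
    simp only [Set.mem_iUnion]
    exact ⟨i, j, m, h.2, rfl⟩

variable {S : Type*} [CommRing S] [Fintype (SkewCoord σ A)]

/-- The skew-symmetric matrix of forms with given coordinates. -/
noncomputable def skewOfCoord (c : SkewCoord σ A → S) : Matrix l l (MvPolynomial σ S) :=
  ∑ t, (Matrix.single t.1.1 t.1.2.1 (monomial t.1.2.2 (c t)) -
    Matrix.single t.1.2.1 t.1.1 (monomial t.1.2.2 (c t)))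

lemma map_coeff_skewOfCoord {S' : Type*} [CommRing S'] (g : S →+ S') (c : SkewCoord σ A → S)
    (i j : l) (m : σ →₀ ℕ) :
    g (coeff m (skewOfCoord c i j)) = coeff m (skewOfCoord (fun t => g (c t)) i j) := by
  classical
  simp only [skewOfCoord, Matrix.sum_apply, coeff_sum, map_sum, Matrix.sub_apply, coeff_sub,
    map_sub, Matrix.single_apply, apply_ite (coeff m), apply_ite g, coeff_zero, map_zero,
    coeff_monomial]

lemma coeff_skewOfCoord (c : SkewCoord σ A → S) (t : SkewCoord σ A) :
    coeff t.1.2.2 (skewOfCoord c t.1.1 t.1.2.1) = c t := by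
  classical
  simp only [skewOfCoord, Matrix.sum_apply, coeff_sum, Matrix.sub_apply, coeff_sub,
    Matrix.single_apply, apply_ite (coeff t.1.2.2), coeff_zero, coeff_monomial]
  rw [Finset.sum_eq_single t]
  · rw [if_pos ⟨rfl, rfl⟩, if_pos rfl, if_neg (fun h => t.2.1.ne' h.1), sub_zero]
  · intro s _ hs
    have hst : ¬ (s.1.2.1 = t.1.1 ∧ s.1.1 = t.1.2.1) := fun h =>
      lt_asymm s.2.1 (by rw [h.1, h.2]; exact t.2.1)
    rw [if_neg hst, sub_zero]
    split_ifs with h1 h2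
    · exact absurd (Subtype.ext (Prod.ext h1.1 (Prod.ext h1.2 h2))) hs
    · rfl
    · rfl
  · simp

lemma skewOfCoord_mem (hA : A.IsSymm) (c : SkewCoord σ A → ℂ) :
    skewOfCoord c ∈ skewDegSubmodule σ A :=
  sum_mem fun t _ => single_sub_single_mem_skewDegSubmodule hA _ _
    (isHomogeneous_monomial _ t.2.2)

lemma skewOfCoord_coeff (hA : A.IsSymm) {M : Matrix l l (MvPolynomial σ ℂ)}
    (hM : M ∈ skewDegSubmodule σ A) :
    skewOfCoord (fun t : SkewCoord σ A => coeff t.1.2.2 (M t.1.1 t.1.2.1)) = M := by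
  have hN := skewOfCoord_mem hA fun t : SkewCoord σ A => coeff t.1.2.2 (M t.1.1 t.1.2.1)
  set N := skewOfCoord fun t : SkewCoord σ A => coeff t.1.2.2 (M t.1.1 t.1.2.1) with hNdef
  have hlt : ∀ i j, i < j → N i j = M i j := fun i j hij => by
    ext m
    by_cases hm : m.degree = A i j
    · exact coeff_skewOfCoord _ (⟨(i, j, m), hij, hm⟩ : SkewCoord σ A)
    · rw [(hN.2 i j).coeff_eq_zero hm, (hM.2 i j).coeff_eq_zero hm]
  have hdiag : ∀ {Q : Matrix l l (MvPolynomial σ ℂ)}, IsSkew Q → ∀ i, Q i i = 0 := fun hQ i =>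
    self_eq_neg.1 (hQ i i)
  ext1 i j
  rcases lt_trichotomy i j with h | rfl | h
  · exact hlt i j h
  · rw [hdiag hN.1, hdiag hM.1]
  · rw [hN.1 j i, hM.1 j i, hlt j i h]

end GenericSkewMatrix

section GenericPfaffian

variable {σ : Type*} {n : ℕ} {A : Matrix (Fin (2 * n)) (Fin (2 * n)) ℕ} [Fintype (SkewCoord σ A)]

/-- The coefficient of the monomial `m` in the Pfaffian of a skew-symmetric matrix of forms with
degree matrix `A`, as a polynomial in the coordinates of the matrix. -/
noncomputable def pfaffCoeff (A : Matrix (Fin (2 * n)) (Fin (2 * n)) ℕ)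
    [Fintype (SkewCoord σ A)] (m : σ →₀ ℕ) : MvPolynomial (SkewCoord σ A) ℂ :=
  (((2 ^ n * n.factorial : ℕ) : ℂ)⁻¹) •
    coeff m (pfSum (skewOfCoord (X : SkewCoord σ A → MvPolynomial (SkewCoord σ A) ℂ)))

lemma map_eval_skewOfCoord (x : SkewCoord σ A → ℂ)
    (c : SkewCoord σ A → MvPolynomial (SkewCoord σ A) ℂ) :
    (skewOfCoord c).map (MvPolynomial.map (eval x)) = skewOfCoord fun t => eval x (c t) := by
  ext i j m
  rw [Matrix.map_apply, coeff_map]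
  exact map_coeff_skewOfCoord (eval x : _ →+* ℂ).toAddMonoidHom c i j m

lemma eval_pfaffCoeff (x : SkewCoord σ A → ℂ) (m : σ →₀ ℕ) :
    eval x (pfaffCoeff A m) = coeff m (pfaff (skewOfCoord x)) := by
  rw [pfaffCoeff, smul_eval, ← coeff_map, RingHom.map_pfSum, map_eval_skewOfCoord,
    pfaff_eq_smul_pfSum, coeff_smul, smul_eq_mul]
  simp only [eval_X]

lemma eval_derivation_pfaffCoeff (x : SkewCoord σ A → ℂ)
    (D : Derivation ℂ (MvPolynomial (SkewCoord σ A) ℂ) (MvPolynomial (SkewCoord σ A) ℂ))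
    (m : σ →₀ ℕ) :
    eval x (D (pfaffCoeff A m)) = (((2 ^ n * n.factorial : ℕ) : ℂ)⁻¹) *
      coeff m (pfSumDiff (skewOfCoord x) (skewOfCoord fun t => eval x (D (X t)))) := by
  obtain ⟨E, hE⟩ := D.exists_coeff_eq (σ := σ)
  have h : (skewOfCoord (X : SkewCoord σ A → MvPolynomial (SkewCoord σ A) ℂ)).map E =
      skewOfCoord fun t => D (X t) := by
    ext1 i j
    refine MvPolynomial.ext _ _ fun l => ?_
    rw [Matrix.map_apply, hE]
    exact map_coeff_skewOfCoord D.toLinearMap.toAddMonoidHom _ i j l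
  rw [pfaffCoeff, Derivation.map_smul, smul_eval, ← hE, E.map_pfSum, h, ← coeff_map,
    RingHom.map_pfSumDiff, map_eval_skewOfCoord, map_eval_skewOfCoord]
  simp only [eval_X]

end GenericPfaffian

section TangentSpace

variable {σ : Type*} {n d : ℕ} {A : Matrix (Fin (2 * n)) (Fin (2 * n)) ℕ}

lemma sum_support_eq_sum_degree [Fintype {m : σ →₀ ℕ // m.degree = d}] {v : MvPolynomial σ ℂ}
    (hv : v.IsHomogeneous d) (f : (σ →₀ ℕ) → ℂ) :
    ∑ m ∈ v.support, coeff m v * f m =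
      ∑ i : {m : σ →₀ ℕ // m.degree = d}, coeff i.1 v * f i.1 := by
  classical
  refine Eq.trans ?_ (Finset.sum_map Finset.univ (Function.Embedding.subtype _)
    fun m => coeff m v * f m)
  refine Finset.sum_subset (fun m hm => ?_) fun m _ hm => by
    rw [notMem_support_iff.1 hm, zero_mul]
  have : m.degree = d := by
    by_contra h
    exact mem_support_iff.1 hm (hv.coeff_eq_zero h)
  simpa using this

/-- Directional derivatives of the Pfaffian are tangent to the locus of Pfaffians. -/
lemma sum_coeff_pfSumDiff_mul_eval_pderiv_eq_zero [Fintype (SkewCoord σ A)]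
    (hsym : A.IsSymm) (M N : Matrix (Fin (2 * n)) (Fin (2 * n)) (MvPolynomial σ ℂ))
    (hM : M ∈ skewDegSubmodule σ A) (hN : N ∈ skewDegSubmodule σ A)
    (Φ : MvPolynomial (σ →₀ ℕ) ℂ)
    (hΦ : ∀ M' ∈ skewDegSubmodule σ A, eval (fun m => coeff m (pfaff M')) Φ = 0) :
    ∑ m ∈ (pfSumDiff M N).support, coeff m (pfSumDiff M N) *
      eval (fun m' => coeff m' (pfaff M)) (pderiv m Φ) = 0 := by
  classical
  set x : SkewCoord σ A → ℂ := fun t => coeff t.1.2.2 (M t.1.1 t.1.2.1)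
  have hx : skewOfCoord x = M := skewOfCoord_coeff hsym hM
  set s : SkewCoord σ A → ℂ := fun t => coeff t.1.2.2 (N t.1.1 t.1.2.1)
  have hs : skewOfCoord s = N := skewOfCoord_coeff hsym hN
  have heval : ∀ (y : SkewCoord σ A → ℂ) (Ψ : MvPolynomial (σ →₀ ℕ) ℂ),
      eval y (aeval (pfaffCoeff A) Ψ) = eval (fun m => coeff m (pfaff (skewOfCoord y))) Ψ := by
    intro y Ψ
    simp only [← eval_pfaffCoeff]
    exact eval_aeval _ _ _
  have h0 : aeval (pfaffCoeff A) Φ = 0 := MvPolynomial.funext fun y => by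
    rw [heval, map_zero, hΦ _ (skewOfCoord_mem hsym y)]
  have h1 := derivation_aeval (mkDerivation ℂ fun t => C (s t) :
    Derivation ℂ (MvPolynomial (SkewCoord σ A) ℂ) (MvPolynomial (SkewCoord σ A) ℂ)) (pfaffCoeff A) Φ
  rw [h0, map_zero] at h1
  have h2 := congrArg (eval x) h1
  simp only [map_zero, map_sum, smul_eq_mul, map_mul, heval, eval_derivation_pfaffCoeff,
    mkDerivation_X, eval_C, hx, hs] at h2
  have h3 : ((2 ^ n * n.factorial : ℕ) : ℂ)⁻¹ ≠ 0 :=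
    inv_ne_zero (Nat.cast_ne_zero.2 (by positivity))
  have h4 : ∑ m ∈ Φ.vars, coeff m (pfSumDiff M N) *
      eval (fun m' => coeff m' (pfaff M)) (pderiv m Φ) = 0 := by
    refine (mul_eq_zero.1 (?_ : _ * _ = (0 : ℂ))).resolve_left h3
    rw [Finset.mul_sum, h2]
    exact Finset.sum_congr rfl fun m _ => by ring
  rw [← h4]
  refine (Finset.sum_subset (Finset.subset_union_left (s₂ := Φ.vars)) fun m _ hm => ?_).trans
    (Finset.sum_subset Finset.subset_union_right fun m _ hm => ?_).symm
  · rw [notMem_support_iff.1 hm, zero_mul]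
  · rw [pderiv_eq_zero_of_notMem_vars hm, map_zero, mul_zero]

end TangentSpace

section GenericTangentSpace

variable {σ : Type*} {n d : ℕ} {A : Matrix (Fin (2 * (n + 1))) (Fin (2 * (n + 1))) ℕ}

/-- At a general point, the tangent space to the locus of Pfaffians is contained in the ideal
generated by the submaximal Pfaffians. -/
lemma exists_generic_tangent_mem_span [Finite σ] [Fintype (SkewCoord σ A)] (hsym : A.IsSymm)
    (hA : ∀ p : Equiv.Perm (Fin (2 * (n + 1))),
      ∑ i : Fin (n + 1), A (p (pairFst i)) (p (pairSnd i)) = d) :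
    ∃ P : MvPolynomial (SkewCoord σ A) ℂ, P ≠ 0 ∧ ∀ x, eval x P ≠ 0 →
      ∀ v : MvPolynomial σ ℂ, v.IsHomogeneous d →
        (∀ Φ : MvPolynomial (σ →₀ ℕ) ℂ,
          (∀ M' ∈ skewDegSubmodule σ A, eval (fun m => coeff m (pfaff M')) Φ = 0) →
          ∑ m ∈ v.support, coeff m v *
            eval (fun m' => coeff m' (pfaff (skewOfCoord x))) (pderiv m Φ) = 0) →
        v ∈ Ideal.span (submaxPfEven (skewOfCoord x)) := by
  classical
  have : Finite {m : σ →₀ ℕ // m.degree = d} := (Finsupp.finite_of_degree_eq d).to_subtype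
  have := Fintype.ofFinite {m : σ →₀ ℕ // m.degree = d}
  obtain ⟨P, hP, hspan⟩ := exists_generic_mem_span_jacobian
    fun i : {m : σ →₀ ℕ // m.degree = d} => pfaffCoeff A i.1
  refine ⟨P, hP, fun x hx v hv htan => ?_⟩
  have hcoeff := hspan x hx (fun i => coeff i.1 v) fun Φ hΦ => by
    have h := htan (rename Subtype.val Φ) fun M' hM' => by
      have h1 := congrArg (eval fun t : SkewCoord σ A => coeff t.1.2.2 (M' t.1.1 t.1.2.1)) hΦ
      rw [eval_aeval, map_zero] at h1
      simp only [eval_pfaffCoeff, skewOfCoord_coeff hsym hM'] at h1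
      rw [eval_rename]
      exact h1
    rw [sum_support_eq_sum_degree hv] at h
    rw [← h]
    refine Finset.sum_congr rfl fun i _ => ?_
    rw [pderiv_rename Subtype.val_injective, eval_rename, mul_comm]
    simp only [eval_pfaffCoeff]
    rfl
  set I := Ideal.span (submaxPfEven (skewOfCoord x))
  let L : MvPolynomial σ ℂ →ₗ[ℂ] ({m : σ →₀ ℕ // m.degree = d} → ℂ) :=
    LinearMap.pi fun i => lcoeff ℂ i.1
  have hle : Submodule.span ℂ (Set.range fun t i =>
      eval x (pderiv t (pfaffCoeff A (Subtype.val (p := fun m : σ →₀ ℕ => m.degree = d) i)))) ≤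
      (I.restrictScalars ℂ ⊓ homogeneousSubmodule σ ℂ d).map L := by
    rw [Submodule.span_le]
    rintro _ ⟨t, rfl⟩
    refine ⟨((2 ^ (n + 1) * (n + 1).factorial : ℕ) : ℂ)⁻¹ • pfSumDiff (skewOfCoord x)
      (skewOfCoord fun s => eval x (pderiv t (X s))), ⟨Submodule.smul_mem _ _
        (pfSumDiff_mem_span _ _), Submodule.smul_mem _ _ ?_⟩, ?_⟩
    · exact (skewOfCoord_mem hsym _).2.isHomogeneous_pfSumDiff (skewOfCoord_mem hsym _).2 hA
    · funext i
      exact (eval_derivation_pfaffCoeff x (pderiv t) i.1).symm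
  obtain ⟨u, ⟨huI, hud⟩, huv⟩ := hle hcoeff
  have huv' : u = v := by
    ext m
    by_cases hm : m.degree = d
    · exact congrFun huv ⟨m, hm⟩
    · rw [hv.coeff_eq_zero hm, IsHomogeneous.coeff_eq_zero hud hm]
  exact huv' ▸ huI

end GenericTangentSpace

/-- Let `V ⊆ ℙ(R_d)` be the closure of the locus of degree-`d` forms in
`n+1` variables that are Pfaffians of skew-symmetric `2k × 2k` matrices of forms with
fixed symmetric homogeneous degree matrix `A` (with `tr A = 2d`), and let `F = pfaff M`
be a general point of `V`. Then the affine cone over the tangent space to `V` at `F`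
is the degree-`d` piece of the ideal `J = ⟨F, M_ij⟩` generated by `F` and the submaximal
Pfaffians of `M`.

The (Zariski) tangent space at `F` of the affine cone over `V` is formalized by
directional derivatives: a degree-`d` form `v` is tangent iff for every polynomial `Φ` in
the coefficients of degree-`d` forms vanishing on all Pfaffians of matrices with degree
matrix `A` (hence on their closure `V`), the directional derivative of `Φ` at `F` along
`v` vanishes. Genericity of `M` is expressed by a nonzero polynomial `P` in the
coefficients of `M`, cutting out a nonempty Zariski-open subset. -/
theorem tangent_space_of_pfaffian_locus_eq_degree_piece_of_pfaffian_ideal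
    (n k d : ℕ) (hk : 0 < k)
    (A : Matrix (Fin (2*k)) (Fin (2*k)) ℕ) (hsym : A.IsSymm) (hhom : HomogMat A)
    (htr : Matrix.trace A = 2 * d) :
    ∃ P : MvPolynomial (Fin (2*k) × Fin (2*k) × ((Fin (n+1)) →₀ ℕ)) ℂ, P ≠ 0 ∧
      (∃ M : Matrix (Fin (2*k)) (Fin (2*k)) (MvPolynomial (Fin (n+1)) ℂ),
        IsSkew M ∧ DegMat M A ∧
        MvPolynomial.eval (fun x => MvPolynomial.coeff x.2.2 (M x.1 x.2.1)) P ≠ 0) ∧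
      ∀ M : Matrix (Fin (2*k)) (Fin (2*k)) (MvPolynomial (Fin (n+1)) ℂ),
        IsSkew M → DegMat M A →
        MvPolynomial.eval (fun x => MvPolynomial.coeff x.2.2 (M x.1 x.2.1)) P ≠ 0 →
        ∀ v : MvPolynomial (Fin (n+1)) ℂ, v.IsHomogeneous d →
          ((∀ Φ : MvPolynomial ((Fin (n+1)) →₀ ℕ) ℂ,
              (∀ M' : Matrix (Fin (2*k)) (Fin (2*k)) (MvPolynomial (Fin (n+1)) ℂ),
                IsSkew M' → DegMat M' A →
                MvPolynomial.eval (fun m => MvPolynomial.coeff m (pfaff M')) Φ = 0) →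
              ∑ m ∈ v.support,
                (MvPolynomial.coeff m v) *
                  MvPolynomial.eval (fun m' => MvPolynomial.coeff m' (pfaff M))
                    (MvPolynomial.pderiv m Φ) = 0)
           ↔ v ∈ Ideal.span ({pfaff M} ∪ submaxPfEven M)) := by
  obtain ⟨k, rfl⟩ := Nat.exists_eq_succ_of_ne_zero hk.ne'
  have hA := hhom.sum_pairs_eq hsym htr
  have := Fintype.ofFinite (SkewCoord (Fin (n+1)) A)
  obtain ⟨P, hP, htan⟩ := exists_generic_tangent_mem_span (σ := Fin (n+1)) hsym hA
  have heval : ∀ M : Matrix _ _ (MvPolynomial (Fin (n+1)) ℂ),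
      eval (fun x => coeff x.2.2 (M x.1 x.2.1)) (rename Subtype.val P) =
        eval (fun t : SkewCoord (Fin (n+1)) A => coeff t.1.2.2 (M t.1.1 t.1.2.1)) P :=
    fun M => by rw [eval_rename]; rfl
  refine ⟨rename Subtype.val P, ?_, ?_, ?_⟩
  · rwa [Ne, map_eq_zero_iff _ (rename_injective _ Subtype.val_injective)]
  · obtain ⟨x, hx⟩ : ∃ x, eval x P ≠ 0 := by
      by_contra! h
      exact hP (MvPolynomial.funext fun x => by rw [h, map_zero])
    have hmem := skewOfCoord_mem hsym x
    refine ⟨skewOfCoord x, hmem.1, hmem.2, ?_⟩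
    rw [heval]
    simpa only [coeff_skewOfCoord] using hx
  · intro M hskew hdeg hMP v hv
    have hM : M ∈ skewDegSubmodule (Fin (n+1)) A := ⟨hskew, hdeg⟩
    rw [heval] at hMP
    constructor
    · intro h
      have h1 := htan _ hMP v hv
      rw [skewOfCoord_coeff hsym hM] at h1
      exact Ideal.span_mono Set.subset_union_right
        (h1 fun Φ hΦ => h Φ fun M' h1 h2 => hΦ M' ⟨h1, h2⟩)
    · intro h Φ hΦ
      obtain ⟨N, hN1, hN2, rfl⟩ := exists_eq_pfSumDiff_of_mem_span hsym hA hskew hdeg hv h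
      exact sum_coeff_pfSumDiff_mul_eval_pderiv_eq_zero hsym M N hM ⟨hN1, hN2⟩ Φ
        fun M' hM' => hΦ M' hM'.1 hM'.2
end
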